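/- Let P₁, P₂ be the second-order operators P₁(x,D) = Σ_{j,k}(μδ_jk + t_jk)∂²_{jk}, P₂(x,D) = Σ_{j,k}((λ+2μ)δ_jk + t_jk)∂²_{jk} on a connected open set Ω ⊂ ℝ³ containing 0, uniformly elliptic with coefficients in the Gevrey class G^s(Ω). Assume α > 0 satisfies α > (λ₃^ℓ − λ₁^ℓ)/λ₁^ℓ for ℓ = 1,2, where λ₁^ℓ ≤ λ₂^ℓ ≤ λ₃^ℓ are the eigenvalues of the coefficient matrix of P_ℓ at 0, and that s < 1 + 1/α. Let P = P₂P₁ and let a_β (|β| ≤ 3) be 7×7-matrix-valued functions in G^s(Ω). If U : Ω → ℝ⁷ is smooth, satisfies P U = Σ_{|β|≤3} a_β ∂^β U in Ω, and ∫_{R ≤ |x| ≤ 2R} |U|² dx = O(R^N) as R → 0 for every N > 0, then U vanishes identically on a neighborhood of 0. -/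

import Mathlib

open MeasureTheory Metric Finset

noncomputable section

/-- `ℝ³` with the Euclidean norm. -/
abbrev E3 := EuclideanSpace ℝ (Fin 3)
/-- `ℝ⁷` with the Euclidean norm. -/
abbrev E7 := EuclideanSpace ℝ (Fin 7)

/-- The partial derivative `∂_i f`. -/
def pd (i : Fin 3) (f : E3 → ℝ) : E3 → ℝ :=
  fun x => fderiv ℝ f x (EuclideanSpace.single i 1)

/-- The multiindex partial derivative `∂^β f`. -/
def mpd (β : Fin 3 → ℕ) (f : E3 → ℝ) : E3 → ℝ :=
  (pd 0)^[β 0] ((pd 1)^[β 1] ((pd 2)^[β 2] f))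

/-- The length `|β|` of a multiindex. -/
def mdeg (β : Fin 3 → ℕ) : ℕ := β 0 + β 1 + β 2

/-- `f` belongs to the Gevrey class `G^s(Ω)`. -/
def GevreyOn (s : ℝ) (Ω : Set E3) (f : E3 → ℝ) : Prop :=
  ContDiffOn ℝ (⊤ : ℕ∞) f Ω ∧ ∃ c > 0, ∃ A > 0, ∀ β : Fin 3 → ℕ, ∀ x ∈ Ω,
    |mpd β f x| ≤ c * A ^ mdeg β * (Nat.factorial (mdeg β) : ℝ) ^ s

/-- The second-order operator `Σ_{j,k} a_jk(x) ∂²_{jk}` applied to a scalar function. -/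
def op2 (a : Fin 3 → Fin 3 → E3 → ℝ) (f : E3 → ℝ) : E3 → ℝ :=
  fun x => ∑ j, ∑ k, a j k x * pd j (pd k f) x

/-- Uniform (strong) ellipticity of `Σ_{j,k} a_jk(x) ∂²_{jk}` on `Ω`. -/
def UnifElliptic (a : Fin 3 → Fin 3 → E3 → ℝ) (Ω : Set E3) : Prop :=
  ∃ c0 > 0, ∀ x ∈ Ω, ∀ ξ : Fin 3 → ℝ,
    c0 * (∑ i, ξ i ^ 2) ≤ ∑ j, ∑ k, a j k x * ξ j * ξ k

/-- The coefficient matrix of the operator at a point. -/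
def coefMatrix (a : Fin 3 → Fin 3 → E3 → ℝ) (x : E3) : Matrix (Fin 3) (Fin 3) ℝ :=
  Matrix.of fun j k => a j k x

/-- `α > (λ₃ - λ₁)/λ₁` where `λ₁ ≤ λ₂ ≤ λ₃` are the eigenvalues of the coefficient
matrix at `0`: equivalently (the eigenvalues being positive), for any pair of
eigenvalues the corresponding ratio is `< α`. -/
def EigCond (a : Fin 3 → Fin 3 → E3 → ℝ) (α : ℝ) : Prop :=
  ∀ h : (coefMatrix a 0).IsHermitian, ∀ i j : Fin 3,
    (h.eigenvalues i - h.eigenvalues j) / h.eigenvalues j < α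

/-- The coefficients `a¹_jk = μ δ_jk + t_jk` of `P₁`. -/
def a1coef (t : Fin 3 → Fin 3 → E3 → ℝ) (mu : E3 → ℝ) : Fin 3 → Fin 3 → E3 → ℝ :=
  fun j k x => mu x * (if j = k then 1 else 0) + t j k x

/-- The coefficients `a²_jk = (λ + 2μ) δ_jk + t_jk` of `P₂`. -/
def a2coef (t : Fin 3 → Fin 3 → E3 → ℝ) (lam mu : E3 → ℝ) : Fin 3 → Fin 3 → E3 → ℝ :=
  fun j k x => (lam x + 2 * mu x) * (if j = k then 1 else 0) + t j k x

/-- The divergence `∇·u`. -/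
def divg (u : E3 → Fin 3 → ℝ) (x : E3) : ℝ := ∑ i, pd i (fun y => u y i) x

/-- The curl `∇×u`. -/
def curl (u : E3 → Fin 3 → ℝ) (x : E3) : Fin 3 → ℝ :=
  ![pd 1 (fun y => u y 2) x - pd 2 (fun y => u y 1) x,
    pd 2 (fun y => u y 0) x - pd 0 (fun y => u y 2) x,
    pd 0 (fun y => u y 1) x - pd 1 (fun y => u y 0) x]

/-- The infinitesimal strain `E = (∇u + (∇u)ᵗ)/2`. -/
def strain (u : E3 → Fin 3 → ℝ) (x : E3) (i j : Fin 3) : ℝ :=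
  (pd j (fun y => u y i) x + pd i (fun y => u y j) x) / 2

/-- The stress tensor `σ = T + (∇u)T + λ(tr E)I + 2μE`. -/
def stress (t : Fin 3 → Fin 3 → E3 → ℝ) (lam mu : E3 → ℝ) (u : E3 → Fin 3 → ℝ)
    (x : E3) (i j : Fin 3) : ℝ :=
  t i j x + (∑ k, pd k (fun y => u y i) x * t k j x)
    + lam x * divg u x * (if i = j then 1 else 0)
    + 2 * mu x * strain u x i j

/-- The residual stress system `∇·σ + κ²ρu = 0` on `Ω`. -/
def ResSystem (t : Fin 3 → Fin 3 → E3 → ℝ) (lam mu rho : E3 → ℝ) (κ : ℝ)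
    (u : E3 → Fin 3 → ℝ) (Ω : Set E3) : Prop :=
  ∀ x ∈ Ω, ∀ i : Fin 3,
    (∑ j, pd j (fun y => stress t lam mu u y i j) x) + κ ^ 2 * rho x * u x i = 0

/-- The vector `U = (u, ∇·u, ∇×u) : Ω → ℝ⁷`. -/
def Ufull (u : E3 → Fin 3 → ℝ) : E3 → Fin 7 → ℝ :=
  fun x => ![u x 0, u x 1, u x 2, divg u x, curl u x 0, curl u x 1, curl u x 2]

/-- The lower-order term `Σ_{|β|≤3} a_β ∂^β U`, component `i`. -/
def lowOrd (aβ : (Fin 3 → ℕ) → E3 → Fin 7 → Fin 7 → ℝ) (U : E3 → Fin 7 → ℝ)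
    (x : E3) (i : Fin 7) : ℝ :=
  ∑ β ∈ Finset.univ.filter (fun β : Fin 3 → Fin 4 => mdeg (fun k => (β k : ℕ)) ≤ 3),
    ∑ j, aβ (fun k => (β k : ℕ)) x i j * mpd (fun k => (β k : ℕ)) (fun y => U y j) x

section

/-- Iterated partial derivatives along a word; the head of the word is applied first. -/
def dw : List (Fin 3) → (E3 → ℝ) → E3 → ℝ
  | [], f => f
  | i :: w, f => dw w (pd i f)

/-- Smoothness on a set. -/
def Sm (O : Set E3) (f : E3 → ℝ) : Prop := ContDiffOn ℝ (⊤ : ℕ∞) f O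

/-- Test functions: smooth functions with compact support contained in `O`. -/
structure TF (O : Set E3) (u : E3 → ℝ) : Prop where
  smooth : ContDiff ℝ (⊤ : ℕ∞) u
  cpt : HasCompactSupport u
  sub : tsupport u ⊆ O

lemma dw_nil (f : E3 → ℝ) : dw [] f = f := rfl
lemma dw_cons (i : Fin 3) (w : List (Fin 3)) (f : E3 → ℝ) : dw (i :: w) f = dw w (pd i f) := rfl

lemma dw_append (w w' : List (Fin 3)) (f : E3 → ℝ) : dw (w ++ w') f = dw w' (dw w f) := by
  induction w generalizing f with
  | nil => rfl
  | cons i w ih => exact ih _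

section smoothOn

variable {O : Set E3} {f g : E3 → ℝ} {x : E3}

lemma Sm.contDiffAt (hO : IsOpen O) (hf : Sm O f) (hx : x ∈ O) :
    ContDiffAt ℝ (⊤ : ℕ∞) f x := ContDiffOn.contDiffAt hf (hO.mem_nhds hx)

lemma Sm.diffAt (hO : IsOpen O) (hf : Sm O f) (hx : x ∈ O) : DifferentiableAt ℝ f x :=
  (hf.contDiffAt hO hx).differentiableAt (by simp)

lemma Sm.mono {O' : Set E3} (hf : Sm O f) (h : O' ⊆ O) : Sm O' f := ContDiffOn.mono hf h

lemma Sm.pd (hO : IsOpen O) (hf : Sm O f) (i : Fin 3) : Sm O (pd i f) :=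
  (ContDiffOn.fderiv_of_isOpen (m := (⊤ : ℕ∞)) hf hO (by simp)).clm_apply contDiffOn_const

lemma Sm.dw (hO : IsOpen O) (hf : Sm O f) (w : List (Fin 3)) : Sm O (dw w f) := by
  induction w generalizing f with
  | nil => exact hf
  | cons i w ih => exact ih (hf.pd hO i)

lemma Sm.add (hf : Sm O f) (hg : Sm O g) : Sm O (fun x => f x + g x) := ContDiffOn.add hf hg
lemma Sm.sub (hf : Sm O f) (hg : Sm O g) : Sm O (fun x => f x - g x) := ContDiffOn.sub hf hg
lemma Sm.mul (hf : Sm O f) (hg : Sm O g) : Sm O (fun x => f x * g x) := ContDiffOn.mul hf hg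

lemma Sm.pow (hf : Sm O f) (n : ℕ) : Sm O (fun x => f x ^ n) := ContDiffOn.pow hf n
lemma Sm.const (c : ℝ) : Sm O (fun _ => c) := contDiffOn_const
lemma Sm.sum {ι : Type*} {s : Finset ι} {F : ι → E3 → ℝ} (hF : ∀ i ∈ s, Sm O (F i)) :
    Sm O (fun x => ∑ i ∈ s, F i x) := ContDiffOn.sum hF
lemma Sm.coord (j : Fin 3) : Sm O (fun x => x j) :=
  (EuclideanSpace.proj (𝕜 := ℝ) j : E3 →L[ℝ] ℝ).contDiff.contDiffOn
lemma Sm.congr (hf : Sm O f) (h : ∀ x ∈ O, g x = f x) : Sm O g := ContDiffOn.congr hf h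
lemma Sm.continuousOn (hf : Sm O f) : ContinuousOn f O := ContDiffOn.continuousOn hf

lemma pd_congr (hO : IsOpen O) (h : ∀ x ∈ O, f x = g x) (i : Fin 3) (hx : x ∈ O) :
    pd i f x = pd i g x := by
  unfold pd
  rw [Filter.EventuallyEq.fderiv_eq]
  filter_upwards [hO.mem_nhds hx] with y hy using h y hy

lemma dw_congr (hO : IsOpen O) (h : ∀ x ∈ O, f x = g x) (w : List (Fin 3)) (hx : x ∈ O) :
    dw w f x = dw w g x := by
  induction w generalizing f g with
  | nil => exact h x hx
  | cons i w ih => exact ih (fun y hy => pd_congr hO h i hy)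

lemma pd_comm (hO : IsOpen O) (hf : Sm O f) (hx : x ∈ O) (i j : Fin 3) :
    pd i (pd j f) x = pd j (pd i f) x := by
  have hs := (hf.contDiffAt hO hx).isSymmSndFDerivAt
    (by simpa using ENat.LEInfty.out)
  have hd : DifferentiableAt ℝ (fderiv ℝ f) x :=
    ((hf.contDiffAt hO hx).fderiv_right (m := 1)
        (by rw [one_add_one_eq_two]; exact ENat.LEInfty.out)).differentiableAt
      (by simp)
  have key : ∀ i j, pd i (pd j f) x
      = fderiv ℝ (fderiv ℝ f) x (EuclideanSpace.single i 1) (EuclideanSpace.single j 1) := by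
    intro i j
    unfold pd
    rw [fderiv_clm_apply hd (differentiableAt_const _)]
    simp
  rw [key, key]
  exact hs _ _

lemma dw_perm (hO : IsOpen O) {w w' : List (Fin 3)} (h : w.Perm w') (hf : Sm O f) (hx : x ∈ O) :
    dw w f x = dw w' f x := by
  induction h generalizing f with
  | nil => rfl
  | cons i _ ih => exact ih (hf.pd hO i)
  | swap i j l => exact dw_congr hO (fun y hy => pd_comm hO hf hy i j) l hx
  | trans _ _ ih1 ih2 => exact (ih1 hf).trans (ih2 hf)

/-- `f` is smooth on `O` and its partial derivative in direction `i` is `d` there. -/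
def PdOn (O : Set E3) (i : Fin 3) (f d : E3 → ℝ) : Prop := Sm O f ∧ ∀ x ∈ O, pd i f x = d x

variable {i : Fin 3} {f' g' : E3 → ℝ}

lemma Sm.pdOn (hf : Sm O f) (i : Fin 3) : PdOn O i f (_root_.pd i f) := ⟨hf, fun _ _ => rfl⟩

lemma PdOn.add (hO : IsOpen O) (hf : PdOn O i f f') (hg : PdOn O i g g') :
    PdOn O i (fun x => f x + g x) (fun x => f' x + g' x) := by
  refine ⟨hf.1.add hg.1, fun x hx => ?_⟩
  beta_reduce
  rw [← hf.2 x hx, ← hg.2 x hx]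
  unfold pd
  rw [fderiv_fun_add (hf.1.diffAt hO hx) (hg.1.diffAt hO hx)]
  rfl

lemma PdOn.sub (hO : IsOpen O) (hf : PdOn O i f f') (hg : PdOn O i g g') :
    PdOn O i (fun x => f x - g x) (fun x => f' x - g' x) := by
  refine ⟨hf.1.sub hg.1, fun x hx => ?_⟩
  beta_reduce
  rw [← hf.2 x hx, ← hg.2 x hx]
  unfold pd
  rw [fderiv_fun_sub (hf.1.diffAt hO hx) (hg.1.diffAt hO hx)]
  rfl

lemma PdOn.mul (hO : IsOpen O) (hf : PdOn O i f f') (hg : PdOn O i g g') :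
    PdOn O i (fun x => f x * g x) (fun x => f' x * g x + f x * g' x) := by
  refine ⟨hf.1.mul hg.1, fun x hx => ?_⟩
  beta_reduce
  rw [← hf.2 x hx, ← hg.2 x hx]
  unfold pd
  rw [fderiv_fun_mul (hf.1.diffAt hO hx) (hg.1.diffAt hO hx)]
  simp; ring

lemma PdOn.const (c : ℝ) : PdOn O i (fun _ => c) (fun _ => 0) :=
  ⟨Sm.const c, fun x _ => by simp [pd]⟩

lemma PdOn.const_mul (hO : IsOpen O) (hf : PdOn O i f f') (c : ℝ) :
    PdOn O i (fun x => c * f x) (fun x => c * f' x) := by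
  have := (PdOn.const (O := O) (i := i) c).mul hO hf
  simpa using this

lemma PdOn.sum (hO : IsOpen O) {ι : Type*} {s : Finset ι} {F F' : ι → E3 → ℝ}
    (hF : ∀ j ∈ s, PdOn O i (F j) (F' j)) :
    PdOn O i (fun x => ∑ j ∈ s, F j x) (fun x => ∑ j ∈ s, F' j x) := by
  classical
  induction s using Finset.induction_on with
  | empty => simpa using PdOn.const 0
  | insert a s ha ih =>
    simp only [Finset.sum_insert ha]
    exact (hF a (by simp)).add hO (ih fun j hj => hF j (by simp [hj]))

lemma PdOn.coord (j : Fin 3) : PdOn O i (fun x => x j) (fun _ => if j = i then 1 else 0) := by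
  refine ⟨Sm.coord j, fun x _ => ?_⟩
  unfold pd
  have : (fun x : E3 => x j) = (EuclideanSpace.proj (𝕜 := ℝ) j : E3 →L[ℝ] ℝ) := rfl
  rw [this, ContinuousLinearMap.fderiv]
  simp

/-- Chain rule with an outer real function. -/
lemma PdOn.comp (hO : IsOpen O) (hf : PdOn O i f f') {φ φ' : ℝ → ℝ} {s : Set ℝ}
    (hs : ∀ y ∈ s, ContDiffAt ℝ (⊤ : ℕ∞) φ y ∧ HasDerivAt φ (φ' y) y) (hm : ∀ x ∈ O, f x ∈ s) :
    PdOn O i (fun x => φ (f x)) (fun x => φ' (f x) * f' x) := by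
  refine ⟨fun x hx => ?_, fun x hx => ?_⟩
  · exact ((hs _ (hm x hx)).1.comp x (hf.1.contDiffAt hO hx)).contDiffWithinAt
  · beta_reduce
    rw [← hf.2 x hx]
    unfold pd
    have := (hs _ (hm x hx)).2.comp_hasFDerivAt x (hf.1.diffAt hO hx).hasFDerivAt
    have h2 : fderiv ℝ (fun x => φ (f x)) x = φ' (f x) • fderiv ℝ f x := this.fderiv
    rw [h2]; rfl

lemma dw_add (hO : IsOpen O) (hf : Sm O f) (hg : Sm O g) (hx : x ∈ O) (w : List (Fin 3)) :
    dw w (fun x => f x + g x) x = dw w f x + dw w g x := by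
  induction w generalizing f g with
  | nil => rfl
  | cons i w ih =>
    rw [dw_cons, dw_congr hO ((hf.pdOn i).add hO (hg.pdOn i)).2 w hx]
    exact ih (hf.pd hO i) (hg.pd hO i)

lemma dw_const_mul (hO : IsOpen O) (hf : Sm O f) (hx : x ∈ O) (c : ℝ) (w : List (Fin 3)) :
    dw w (fun x => c * f x) x = c * dw w f x := by
  induction w generalizing f with
  | nil => rfl
  | cons i w ih =>
    rw [dw_cons, dw_congr hO ((hf.pdOn i).const_mul hO c).2 w hx]
    exact ih (hf.pd hO i)

lemma dw_sub (hO : IsOpen O) (hf : Sm O f) (hg : Sm O g) (hx : x ∈ O) (w : List (Fin 3)) :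
    dw w (fun x => f x - g x) x = dw w f x - dw w g x := by
  have := dw_add hO hf ((Sm.const (-1)).mul hg) hx w
  rw [dw_const_mul hO hg hx] at this
  simp only [neg_one_mul, ← sub_eq_add_neg] at this
  exact this

lemma dw_const (c : ℝ) (w : List (Fin 3)) (hw : w ≠ []) : dw w (fun _ : E3 => c) = fun _ => 0 := by
  have h0 : ∀ (i : Fin 3) (c : ℝ), pd i (fun _ : E3 => c) = fun _ => 0 := by
    intro i c; funext x; simp [pd]
  have h1 : ∀ w : List (Fin 3), dw w (fun _ : E3 => (0 : ℝ)) = fun _ => 0 := by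
    intro w
    induction w with
    | nil => rfl
    | cons i w ih => rw [dw_cons, h0, ih]
  cases w with
  | nil => exact absurd rfl hw
  | cons i w => rw [dw_cons, h0, h1]

lemma dw_sum (hO : IsOpen O) {ι : Type*} {s : Finset ι} {F : ι → E3 → ℝ}
    (hF : ∀ j ∈ s, Sm O (F j)) (hx : x ∈ O) (w : List (Fin 3)) :
    dw w (fun x => ∑ j ∈ s, F j x) x = ∑ j ∈ s, dw w (F j) x := by
  classical
  induction s using Finset.induction_on with
  | empty =>
    simp only [Finset.sum_empty]
    cases w with
    | nil => rfl
    | cons i w => rw [dw_const 0 _ (by simp)]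
  | insert a s ha ih =>
    simp only [Finset.sum_insert ha]
    rw [dw_add hO (hF a (by simp)) (Sm.sum fun j hj => hF j (by simp [hj])) hx,
      ih fun j hj => hF j (by simp [hj])]

end smoothOn

section testFunctions

variable {O : Set E3} {f u v : E3 → ℝ}

lemma TF.sm (hu : TF O u) (O' : Set E3) : Sm O' u := hu.smooth.contDiffOn
lemma TF.mono {O' : Set E3} (hu : TF O u) (h : O ⊆ O') : TF O' u := ⟨hu.1, hu.2, hu.3.trans h⟩

lemma TF.zero_of_notMem (hu : TF O u) {x : E3} (hx : x ∉ O) : u x = 0 :=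
  image_eq_zero_of_notMem_tsupport fun h => hx (hu.sub h)

lemma TF.smul (hO : IsOpen O) (hf : Sm O f) (hu : TF O u) : TF O (fun x => f x * u x) := by
  have hsub : tsupport (fun x => f x * u x) ⊆ tsupport u := tsupport_mul_subset_right
  refine ⟨?_, hu.cpt.mul_left, hsub.trans hu.sub⟩
  rw [contDiff_iff_contDiffAt]
  intro x
  by_cases hx : x ∈ tsupport u
  · exact (hf.contDiffAt hO (hu.sub hx)).mul hu.smooth.contDiffAt
  · have : (fun x => f x * u x) =ᶠ[nhds x] fun _ => 0 := by
      filter_upwards [(isClosed_tsupport u).isOpen_compl.mem_nhds hx] with y hy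
      rw [image_eq_zero_of_notMem_tsupport hy, mul_zero]
    exact contDiffAt_const.congr_of_eventuallyEq this

lemma TF.pd (hu : TF O u) (i : Fin 3) : TF O (pd i u) := by
  have h1 : tsupport (_root_.pd i u) ⊆ tsupport u := by
    refine closure_minimal (fun x hx => ?_) isClosed_closure
    apply support_fderiv_subset ℝ
    intro h
    apply hx
    simp [_root_.pd, h]
  refine ⟨?_, ?_, h1.trans hu.sub⟩
  · have := (hu.sm Set.univ).pd isOpen_univ i
    exact contDiffOn_univ.1 this
  · exact hu.cpt.mono' ((subset_tsupport _).trans h1)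

lemma TF.dw (hu : TF O u) (w : List (Fin 3)) : TF O (dw w u) := by
  induction w generalizing u with
  | nil => exact hu
  | cons i w ih => exact ih (hu.pd i)

lemma TF.add (hu : TF O u) (hv : TF O v) : TF O (fun x => u x + v x) := by
  have h : tsupport (fun x => u x + v x) ⊆ tsupport u ∪ tsupport v := tsupport_add u v
  exact ⟨hu.1.add hv.1, hu.2.add hv.2, h.trans (Set.union_subset hu.3 hv.3)⟩

lemma TF.zero : TF O (fun _ => 0) :=
  ⟨contDiff_const, HasCompactSupport.zero, by simp [tsupport]⟩

lemma TF.const_mul (hu : TF O u) (c : ℝ) : TF O (fun x => c * u x) :=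
  ⟨contDiff_const.mul hu.1, hu.2.mul_left, (tsupport_mul_subset_right).trans hu.3⟩

lemma TF.neg (hu : TF O u) : TF O (fun x => - u x) := by
  simpa using hu.const_mul (-1)

lemma TF.sub' (hu : TF O u) (hv : TF O v) : TF O (fun x => u x - v x) := by
  simpa [sub_eq_add_neg] using hu.add hv.neg

lemma TF.sum {ι : Type*} {s : Finset ι} {F : ι → E3 → ℝ} (hF : ∀ j ∈ s, TF O (F j)) :
    TF O (fun x => ∑ j ∈ s, F j x) := by
  classical
  induction s using Finset.induction_on with
  | empty => simpa using TF.zero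
  | insert a s ha ih =>
    simp only [Finset.sum_insert ha]
    exact (hF a (by simp)).add (ih fun j hj => hF j (by simp [hj]))

lemma TF.mul (hu : TF O u) (hv : TF O v) : TF O (fun x => u x * v x) :=
  ⟨hu.1.mul hv.1, hv.2.mul_left, (tsupport_mul_subset_right).trans hv.3⟩

lemma TF.sq (hu : TF O u) : TF O (fun x => u x ^ 2) := by
  simpa [pow_two] using hu.mul hu

lemma TF.integrable (hu : TF O u) : Integrable u volume :=
  hu.smooth.continuous.integrable_of_hasCompactSupport hu.cpt

lemma integral_pd (hu : TF O u) (i : Fin 3) : ∫ x, pd i u x = 0 := by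
  have h1 : Integrable (pd i u) volume := (hu.pd i).integrable
  have := integral_mul_fderiv_eq_neg_fderiv_mul_of_integrable (μ := (volume : Measure E3))
    (f := fun _ : E3 => (1 : ℝ)) (g := u) (v := EuclideanSpace.single i 1)
    (by simp) (by simp only [one_mul]; exact h1) (by simpa using hu.integrable)
    (fun x _ => differentiableAt_const _)
    (fun x _ => (hu.smooth.differentiable (by simp)) x)
  simpa [pd] using this

/-- Two integrands that agree up to a divergence of test functions have the same integral. -/
lemma integral_eq_of_divergence {F G : E3 → ℝ} {H : Fin 3 → E3 → ℝ} (hG : TF O G)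
    (hH : ∀ i, TF O (H i)) (h : ∀ x, F x = G x + ∑ i, pd i (H i) x) :
    ∫ x, F x = ∫ x, G x := by
  simp_rw [h]
  rw [integral_add hG.integrable
    (integrable_finsetSum _ fun i _ => ((hH i).pd i).integrable),
    integral_finsetSum _ fun i _ => ((hH i).pd i).integrable]
  simp [integral_pd (hH _)]

end testFunctions

end

section

/-- The punctured ball of radius `R` about the origin. -/
def pb (R : ℝ) : Set E3 := {x | x ≠ 0 ∧ ‖x‖ < R}

lemma isOpen_pb (R : ℝ) : IsOpen (pb R) :=
  isOpen_ne.inter (isOpen_lt continuous_norm continuous_const)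

lemma pb_mono {R R' : ℝ} (h : R' ≤ R) : pb R' ⊆ pb R := fun _ hx => ⟨hx.1, hx.2.trans_le h⟩

lemma pb_subset_ball (R : ℝ) : pb R ⊆ ball 0 R := fun x hx => by simpa using hx.2

lemma norm_pos_of_mem_pb {R : ℝ} {x : E3} (hx : x ∈ pb R) : 0 < ‖x‖ := norm_pos_iff.2 hx.1

/-- Symbols of order `p` on the punctured ball: `k`-th derivatives are `O(‖x‖ ^ (p - k))`. -/
def Sy (R p : ℝ) (f : E3 → ℝ) : Prop :=
  Sm (pb R) f ∧ ∀ w : List (Fin 3), ∃ C : ℝ, ∀ x ∈ pb R, |dw w f x| ≤ C * ‖x‖ ^ (p - w.length)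

section symbols
variable {R p q : ℝ} {f g : E3 → ℝ}

lemma Sy.bound (hf : Sy R p f) : ∃ C : ℝ, 0 ≤ C ∧ ∀ x ∈ pb R, |f x| ≤ C * ‖x‖ ^ p := by
  obtain ⟨C, hC⟩ := hf.2 []
  refine ⟨|C|, abs_nonneg _, fun x hx => (hC x hx).trans ?_⟩
  simp only [List.length_nil, Nat.cast_zero, sub_zero]
  gcongr
  exact le_abs_self C

lemma Sy.pd (hf : Sy R p f) (i : Fin 3) : Sy R (p - 1) (pd i f) := by
  refine ⟨hf.1.pd (isOpen_pb R) i, fun w => ?_⟩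
  obtain ⟨C, hC⟩ := hf.2 (i :: w)
  refine ⟨C, fun x hx => ?_⟩
  have := hC x hx
  rw [dw_cons] at this
  convert this using 3
  simp; ring

lemma Sy.congr (hf : Sy R p f) (h : ∀ x ∈ pb R, g x = f x) : Sy R p g :=
  ⟨hf.1.congr h, fun w => (hf.2 w).imp fun C hC x hx => by
    rw [dw_congr (isOpen_pb R) h w hx]; exact hC x hx⟩

lemma Sy.add (hf : Sy R p f) (hg : Sy R p g) : Sy R p (fun x => f x + g x) := by
  refine ⟨hf.1.add hg.1, fun w => ?_⟩
  obtain ⟨C, hC⟩ := hf.2 w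
  obtain ⟨D, hD⟩ := hg.2 w
  refine ⟨C + D, fun x hx => ?_⟩
  rw [dw_add (isOpen_pb R) hf.1 hg.1 hx, add_mul]
  exact (abs_add_le _ _).trans (add_le_add (hC x hx) (hD x hx))

lemma Sy.const_mul (hf : Sy R p f) (c : ℝ) : Sy R p (fun x => c * f x) := by
  refine ⟨(Sm.const c).mul hf.1, fun w => ?_⟩
  obtain ⟨C, hC⟩ := hf.2 w
  refine ⟨|c| * C, fun x hx => ?_⟩
  rw [dw_const_mul (isOpen_pb R) hf.1 hx, abs_mul, mul_assoc]
  exact mul_le_mul_of_nonneg_left (hC x hx) (abs_nonneg _)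

lemma Sy.sub (hf : Sy R p f) (hg : Sy R p g) : Sy R p (fun x => f x - g x) :=
  (hf.add (hg.const_mul (-1))).congr fun x _ => by ring

lemma Sy.zero : Sy R p (fun _ => 0) := by
  refine ⟨Sm.const 0, fun w => ⟨0, fun x _ => ?_⟩⟩
  rcases w with _ | ⟨i, w⟩
  · simp [dw_nil]
  · rw [dw_const 0 _ (by simp)]; simp

lemma Sy.sum {ι : Type*} {s : Finset ι} {F : ι → E3 → ℝ} (hF : ∀ j ∈ s, Sy R p (F j)) :
    Sy R p (fun x => ∑ j ∈ s, F j x) := by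
  classical
  induction s using Finset.induction_on with
  | empty => simpa using Sy.zero
  | insert a s ha ih =>
    simp only [Finset.sum_insert ha]
    exact (hF a (by simp)).add (ih fun j hj => hF j (by simp [hj]))

lemma Sy.mul (hf : Sy R p f) (hg : Sy R q g) : Sy R (p + q) (fun x => f x * g x) := by
  refine ⟨hf.1.mul hg.1, fun w => ?_⟩
  induction w generalizing p q f g with
  | nil =>
    obtain ⟨C, hC0, hC⟩ := hf.bound
    obtain ⟨D, hD0, hD⟩ := hg.bound
    refine ⟨C * D, fun x hx => ?_⟩
    have hx0 := norm_pos_of_mem_pb hx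
    simp only [dw_nil, List.length_nil, Nat.cast_zero, sub_zero, abs_mul, Real.rpow_add hx0]
    calc |f x| * |g x| ≤ (C * ‖x‖ ^ p) * (D * ‖x‖ ^ q) := by
          gcongr
          · exact hC x hx
          · exact hD x hx
      _ = _ := by ring
  | cons i w ih =>
    obtain ⟨C, hC⟩ := ih (hf.pd i) hg
    obtain ⟨D, hD⟩ := ih hf (hg.pd i)
    refine ⟨C + D, fun x hx => ?_⟩
    have hO := isOpen_pb R
    rw [dw_cons, dw_congr hO ((hf.1.pdOn i).mul hO (hg.1.pdOn i)).2 w hx,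
      dw_add hO ((hf.1.pd hO i).mul hg.1) (hf.1.mul (hg.1.pd hO i)) hx, add_mul]
    refine (abs_add_le _ _).trans (add_le_add ?_ ?_)
    · rw [show p + q - ((i :: w).length : ℝ) = p - 1 + q - w.length by
        push_cast [List.length_cons]; ring]
      exact hC x hx
    · rw [show p + q - ((i :: w).length : ℝ) = p + (q - 1) - w.length by
        push_cast [List.length_cons]; ring]
      exact hD x hx

lemma Sy.mono (hR : R ≤ 1) (h : q ≤ p) (hf : Sy R p f) : Sy R q f := by
  refine ⟨hf.1, fun w => ?_⟩
  obtain ⟨C, hC⟩ := hf.2 w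
  refine ⟨|C|, fun x hx => (hC x hx).trans ?_⟩
  have hx0 := norm_pos_of_mem_pb hx
  have h1 : ‖x‖ ^ (p - w.length) ≤ ‖x‖ ^ (q - w.length) :=
    Real.rpow_le_rpow_of_exponent_ge hx0 (hx.2.le.trans hR) (by linarith)
  calc C * ‖x‖ ^ (p - w.length) ≤ |C| * ‖x‖ ^ (p - w.length) := by
        gcongr; exact le_abs_self C
    _ ≤ _ := by gcongr

lemma exists_bound_dw {O : Set E3} (hO : IsOpen O) (hf : Sm O f) (hR : closedBall 0 R ⊆ O)
    (w : List (Fin 3)) : ∃ C, 0 ≤ C ∧ ∀ x ∈ closedBall (0 : E3) R, |dw w f x| ≤ C := by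
  obtain ⟨C, hC⟩ := (isCompact_closedBall (0 : E3) R).exists_bound_of_continuousOn
    ((hf.dw hO w).continuousOn.mono hR)
  exact ⟨|C|, abs_nonneg _, fun x hx => (hC x hx).trans (le_abs_self C)⟩

lemma Sy.of_smooth {O : Set E3} (hO : IsOpen O) (hf : Sm O f) (hR : closedBall 0 R ⊆ O)
    (hR1 : R ≤ 1) : Sy R 0 f := by
  have hsub : pb R ⊆ closedBall 0 R := (pb_subset_ball R).trans ball_subset_closedBall
  refine ⟨hf.mono (hsub.trans hR), fun w => ?_⟩
  obtain ⟨C, hC0, hC⟩ := exists_bound_dw hO hf hR w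
  refine ⟨C, fun x hx => (hC x (hsub hx)).trans ?_⟩
  have hx0 := norm_pos_of_mem_pb hx
  have : 1 ≤ ‖x‖ ^ ((0 : ℝ) - w.length) :=
    Real.one_le_rpow_of_pos_of_le_one_of_nonpos hx0 (hx.2.le.trans hR1) (by simp)
  nlinarith

lemma Sy.of_smooth_zero {O : Set E3} (hO : IsOpen O) (hf : Sm O f) (hR : closedBall 0 R ⊆ O)
    (hR1 : R ≤ 1) (h0 : f 0 = 0) : Sy R 1 f := by
  have hsub : pb R ⊆ closedBall 0 R := (pb_subset_ball R).trans ball_subset_closedBall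
  refine ⟨hf.mono (hsub.trans hR), fun w => ?_⟩
  rcases w with _ | ⟨i, w⟩
  · have hc : ContinuousOn (fderiv ℝ f) (closedBall 0 R) :=
      (ContDiffOn.continuousOn_fderiv_of_isOpen hf hO (by simp)).mono hR
    obtain ⟨C, hC⟩ := (isCompact_closedBall (0 : E3) R).exists_bound_of_continuousOn hc
    refine ⟨C, fun x hx => ?_⟩
    have hR0 : 0 ≤ R := (norm_nonneg x).trans hx.2.le
    have := (convex_closedBall (0 : E3) R).norm_image_sub_le_of_norm_fderiv_le (𝕜 := ℝ) (f := f)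
      (fun y hy => hf.diffAt hO (hR hy)) hC (mem_closedBall_self hR0) (hsub hx)
    simpa [h0, dw_nil] using this
  · obtain ⟨C, hC0, hC⟩ := exists_bound_dw hO hf hR (i :: w)
    refine ⟨C, fun x hx => (hC x (hsub hx)).trans ?_⟩
    have hx0 := norm_pos_of_mem_pb hx
    have : 1 ≤ ‖x‖ ^ ((1 : ℝ) - (i :: w).length) :=
      Real.one_le_rpow_of_pos_of_le_one_of_nonpos hx0 (hx.2.le.trans hR1) (by simp)
    nlinarith

lemma Sy.coord (hR1 : R ≤ 1) (j : Fin 3) : Sy R 1 (fun x => x j) :=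
  Sy.of_smooth_zero isOpen_univ (Sm.coord j) (Set.subset_univ _) hR1 rfl

lemma Sy.const (hR1 : R ≤ 1) (c : ℝ) : Sy R 0 (fun _ => c) :=
  Sy.of_smooth isOpen_univ (Sm.const c) (Set.subset_univ _) hR1

end symbols

lemma norm_sq_E3 (x : E3) : ‖x‖ ^ 2 = ∑ j, x j ^ 2 := EuclideanSpace.real_norm_sq_eq x

lemma norm_rpow_eq (x : E3) (p : ℝ) : ‖x‖ ^ p = (∑ j, x j * x j) ^ (p / 2) := by
  have : (∑ j, x j * x j) = ‖x‖ ^ (2 : ℝ) := by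
    rw [Real.rpow_two, norm_sq_E3]; simp [pow_two]
  rw [this, ← Real.rpow_mul (norm_nonneg x)]
  congr 1; ring

lemma PdOn.norm_rpow (R p : ℝ) (i : Fin 3) :
    PdOn (pb R) i (fun x => ‖x‖ ^ p) (fun x => p * (x i * ‖x‖ ^ (p - 2))) := by
  have hO := isOpen_pb R
  have h1 : PdOn (pb R) i (fun x => ∑ j, x j * x j) (fun x => 2 * x i) := by
    have := PdOn.sum hO (s := Finset.univ)
      fun (j : Fin 3) _ => (PdOn.coord (O := pb R) (i := i) j).mul hO (PdOn.coord (i := i) j)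
    refine ⟨this.1, fun x hx => (this.2 x hx).trans ?_⟩
    simp [Finset.sum_add_distrib, two_mul]
  have hpos : ∀ x ∈ pb R, (∑ j, x j * x j) ∈ Set.Ioi (0 : ℝ) := by
    intro x hx
    have := pow_pos (norm_pos_of_mem_pb hx) 2
    rw [norm_sq_E3] at this
    simpa [pow_two] using this
  have h2 := h1.comp hO (φ := fun y => y ^ (p / 2)) (φ' := fun y => (p / 2) * y ^ (p / 2 - 1))
    (s := Set.Ioi 0) (fun y hy => ⟨Real.contDiffAt_rpow_const_of_ne (ne_of_gt hy),
      Real.hasDerivAt_rpow_const (Or.inl (ne_of_gt hy))⟩) hpos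
  refine ⟨h2.1.congr fun x _ => norm_rpow_eq x p, fun x hx => ?_⟩
  rw [pd_congr hO (fun x _ => norm_rpow_eq x p) i hx, h2.2 x hx]
  beta_reduce
  rw [norm_rpow_eq x (p - 2)]
  rw [show (p - 2) / 2 = p / 2 - 1 by ring]
  ring

lemma Sy.norm_rpow {R : ℝ} (hR1 : R ≤ 1) (p : ℝ) : Sy R p (fun x => ‖x‖ ^ p) := by
  have hO := isOpen_pb R
  refine ⟨(PdOn.norm_rpow R p 0).1, fun w => ?_⟩
  induction hn : w.length using Nat.strong_induction_on generalizing w p with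
  | _ n ih =>
  rcases w with _ | ⟨i, w⟩
  · refine ⟨1, fun x _ => ?_⟩
    have : n = 0 := by simpa using hn.symm
    subst this
    simp only [dw_nil, Nat.cast_zero, sub_zero, one_mul]
    rw [abs_of_nonneg (by positivity)]
  · -- a truncated product rule
    have prod : ∀ (v : List (Fin 3)), v.length ≤ w.length → ∀ (f : E3 → ℝ) (a b : ℝ), Sy R a f →
        ∃ C : ℝ, ∀ x ∈ pb R, |dw v (fun x => f x * ‖x‖ ^ b) x| ≤ C * ‖x‖ ^ (a + b - v.length) := by
      intro v hv
      induction v with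
      | nil =>
        intro f a b hf
        obtain ⟨C, hC0, hC⟩ := hf.bound
        refine ⟨C, fun x hx => ?_⟩
        have hx0 := norm_pos_of_mem_pb hx
        simp only [dw_nil, List.length_nil, Nat.cast_zero, sub_zero, abs_mul, Real.rpow_add hx0]
        rw [abs_of_nonneg (by positivity : 0 ≤ ‖x‖ ^ b), ← mul_assoc]
        gcongr
        exact hC x hx
      | cons j v ihv =>
        intro f a b hf
        have hv' : v.length ≤ w.length := by simp at hv; omega
        obtain ⟨C, hC⟩ := ihv hv' _ _ b (hf.pd j)
        obtain ⟨D, hD⟩ := ihv hv' (fun x => f x * x j) _ (b - 2) (hf.mul (Sy.coord hR1 j))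
        refine ⟨C + |b| * D, fun x hx => ?_⟩
        have h2 := (hf.1.pdOn j).mul hO (PdOn.norm_rpow R b j)
        have h3 : ∀ x ∈ pb R, _root_.pd j (fun x => f x * ‖x‖ ^ b) x =
            (_root_.pd j f x * ‖x‖ ^ b) + b * (f x * x j * ‖x‖ ^ (b - 2)) := by
          intro x hx
          rw [h2.2 x hx]; ring
        have s1 : Sm (pb R) (fun x => f x * x j * ‖x‖ ^ (b - 2)) :=
          (hf.1.mul (Sm.coord j)).mul (PdOn.norm_rpow R _ 0).1
        rw [dw_cons, dw_congr hO h3 v hx, dw_add hO ((hf.1.pd hO j).mul (PdOn.norm_rpow R _ 0).1)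
          ((Sm.const b).mul s1) hx, dw_const_mul hO s1 hx, add_mul]
        refine (abs_add_le _ _).trans (add_le_add ?_ ?_)
        · rw [show a + b - ((j :: v).length : ℝ) = a - 1 + b - v.length by
            push_cast [List.length_cons]; ring]
          exact hC x hx
        · rw [abs_mul, mul_assoc]
          refine mul_le_mul_of_nonneg_left ?_ (abs_nonneg _)
          rw [show a + b - ((j :: v).length : ℝ) = a + 1 + (b - 2) - v.length by
            push_cast [List.length_cons]; ring]
          exact hD x hx
    obtain ⟨C, hC⟩ := prod w le_rfl (fun x => x i) 1 (p - 2) (Sy.coord hR1 i)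
    refine ⟨|p| * C, fun x hx => ?_⟩
    have h2 := PdOn.norm_rpow R p i
    rw [dw_cons, dw_congr hO h2.2 w hx,
      dw_const_mul hO ((Sm.coord i).mul (PdOn.norm_rpow R _ 0).1) hx, abs_mul, mul_assoc]
    refine mul_le_mul_of_nonneg_left ?_ (abs_nonneg _)
    rw [show p - (n : ℝ) = 1 + (p - 2) - w.length by
      rw [← hn]; push_cast [List.length_cons]; ring]
    exact hC x hx

end

section

/-- The squared length of the gradient. -/
def gsq (u : E3 → ℝ) (x : E3) : ℝ := ∑ i, pd i u x ^ 2
/-- The squared length of the Hessian. -/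
def hsq (u : E3 → ℝ) (x : E3) : ℝ := ∑ i, gsq (pd i u) x
/-- The squared length of the tensor of third derivatives. -/
def tsq (u : E3 → ℝ) (x : E3) : ℝ := ∑ i, hsq (pd i u) x

section energy
variable {O : Set E3} {u v : E3 → ℝ}

lemma gsq_nonneg (u : E3 → ℝ) (x : E3) : 0 ≤ gsq u x := sum_nonneg fun _ _ => sq_nonneg _
lemma hsq_nonneg (u : E3 → ℝ) (x : E3) : 0 ≤ hsq u x := sum_nonneg fun _ _ => gsq_nonneg _ _
lemma tsq_nonneg (u : E3 → ℝ) (x : E3) : 0 ≤ tsq u x := sum_nonneg fun _ _ => hsq_nonneg _ _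

lemma TF.gsq (hu : TF O u) : TF O (gsq u) := TF.sum fun i _ => (hu.pd i).sq
lemma TF.hsq (hu : TF O u) : TF O (hsq u) := TF.sum fun i _ => (hu.pd i).gsq
lemma TF.tsq (hu : TF O u) : TF O (tsq u) := TF.sum fun i _ => (hu.pd i).hsq

lemma TF.op2 {b : Fin 3 → Fin 3 → E3 → ℝ} (hO : IsOpen O) (hb : ∀ j k, Sm O (b j k))
    (hu : TF O u) : TF O (op2 b u) :=
  TF.sum fun j _ => TF.sum fun k _ => ((hu.pd k).pd j).smul hO (hb j k)

lemma TF.integral_mono (hu : TF O u) (hv : TF O v) (h : ∀ x, u x ≤ v x) :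
    ∫ x, u x ≤ ∫ x, v x := MeasureTheory.integral_mono hu.integrable hv.integrable h

lemma TF.pd_mul (hu : TF O u) (hv : TF O v) (i : Fin 3) (x : E3) :
    _root_.pd i (fun x => u x * v x) x = _root_.pd i u x * v x + u x * _root_.pd i v x :=
  (((hu.sm Set.univ).pdOn i).mul isOpen_univ ((hv.sm Set.univ).pdOn i)).2 x trivial

lemma TF.ibp (hu : TF O u) (hv : TF O v) (i : Fin 3) :
    ∫ x, _root_.pd i u x * v x = - ∫ x, u x * _root_.pd i v x := by
  have h := integral_pd (hu.mul hv) i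
  simp_rw [hu.pd_mul hv i] at h
  rw [integral_add ((hu.pd i).mul hv).integrable (hu.mul (hv.pd i)).integrable] at h
  linarith

lemma TF.comm (hu : TF O u) (i j : Fin 3) :
    _root_.pd i (_root_.pd j u) = _root_.pd j (_root_.pd i u) :=
  funext fun _ => pd_comm isOpen_univ (hu.sm Set.univ) trivial i j

lemma integral_hessian_swap (hu : TF O u) (i j k : Fin 3) :
    ∫ x, pd j (pd i u) x * pd k (pd i u) x = ∫ x, pd i (pd i u) x * pd j (pd k u) x := by
  rw [(hu.pd i).ibp ((hu.pd i).pd k) j, (hu.pd i).ibp ((hu.pd k).pd j) i, (hu.pd i).comm j k,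
    hu.comm j i, hu.comm j k, (hu.pd j).comm i k]

lemma integral_hsq_le_const {b0 : Fin 3 → Fin 3 → ℝ} {c0 : ℝ} (hc0 : 0 < c0)
    (hell : ∀ ξ : Fin 3 → ℝ, c0 * ∑ i, ξ i ^ 2 ≤ ∑ j, ∑ k, b0 j k * ξ j * ξ k) (hu : TF O u) :
    c0 ^ 2 * ∫ x, hsq u x ≤ 3 * ∫ x, (∑ j, ∑ k, b0 j k * pd j (pd k u) x) ^ 2 := by
  have hP : TF O (fun x => ∑ j, ∑ k, b0 j k * pd j (pd k u) x) :=
    TF.sum fun j _ => TF.sum fun k _ => ((hu.pd k).pd j).const_mul _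
  have hL : TF O (fun x => ∑ i, pd i (pd i u) x) := TF.sum fun i _ => (hu.pd i).pd i
  have e1 : ∫ x, ∑ i, ∑ j, ∑ k, b0 j k * (pd j (pd i u) x * pd k (pd i u) x)
      = ∫ x, (∑ i, pd i (pd i u) x) * (∑ j, ∑ k, b0 j k * pd j (pd k u) x) := by
    have h2 : ∀ x, (∑ i, pd i (pd i u) x) * (∑ j, ∑ k, b0 j k * pd j (pd k u) x) =
        ∑ i, ∑ j, ∑ k, b0 j k * (pd i (pd i u) x * pd j (pd k u) x) := by
      intro x
      rw [sum_mul]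
      refine sum_congr rfl fun i _ => ?_
      rw [mul_sum]
      refine sum_congr rfl fun j _ => ?_
      rw [mul_sum]
      exact sum_congr rfl fun k _ => by ring
    have t1 : ∀ i j k, TF O (fun x => b0 j k * (pd j (pd i u) x * pd k (pd i u) x)) :=
      fun i j k => (((hu.pd i).pd j).mul ((hu.pd i).pd k)).const_mul _
    have t2 : ∀ i j k, TF O (fun x => b0 j k * (pd i (pd i u) x * pd j (pd k u) x)) :=
      fun i j k => (((hu.pd i).pd i).mul ((hu.pd k).pd j)).const_mul _
    simp_rw [h2]
    rw [integral_finsetSum _ fun i _ => (TF.sum fun j _ => TF.sum fun k _ => t1 i j k).integrable,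
      integral_finsetSum _ fun i _ => (TF.sum fun j _ => TF.sum fun k _ => t2 i j k).integrable]
    refine sum_congr rfl fun i _ => ?_
    rw [integral_finsetSum _ fun j _ => (TF.sum fun k _ => t1 i j k).integrable,
      integral_finsetSum _ fun j _ => (TF.sum fun k _ => t2 i j k).integrable]
    refine sum_congr rfl fun j _ => ?_
    rw [integral_finsetSum _ fun k _ => (t1 i j k).integrable,
      integral_finsetSum _ fun k _ => (t2 i j k).integrable]
    refine sum_congr rfl fun k _ => ?_
    rw [integral_const_mul, integral_const_mul, integral_hessian_swap hu]
  have e2 : ∫ x, c0 * hsq u x ≤ ∫ x, ∑ i, ∑ j, ∑ k,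
      b0 j k * (pd j (pd i u) x * pd k (pd i u) x) := by
    refine TF.integral_mono (hu.hsq.const_mul _) (TF.sum fun i _ => TF.sum fun j _ =>
      TF.sum fun k _ => (((hu.pd i).pd j).mul ((hu.pd i).pd k)).const_mul _) fun x => ?_
    unfold hsq gsq
    rw [mul_sum]
    refine sum_le_sum fun i _ => (hell fun j => pd j (pd i u) x).trans (le_of_eq ?_)
    exact sum_congr rfl fun j _ => sum_congr rfl fun k _ => by ring
  have e3 : ∫ x, (∑ i, pd i (pd i u) x) * (∑ j, ∑ k, b0 j k * pd j (pd k u) x) ≤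
      ∫ x, ((c0 / 2) * hsq u x + (3 / (2 * c0)) * (∑ j, ∑ k, b0 j k * pd j (pd k u) x) ^ 2) := by
    refine TF.integral_mono (hL.mul hP) ((hu.hsq.const_mul _).add (hP.sq.const_mul _)) fun x => ?_
    have h1 : (∑ i, pd i (pd i u) x) ^ 2 ≤ 3 * hsq u x := by
      have := sq_sum_le_card_mul_sum_sq (s := Finset.univ) (f := fun i : Fin 3 => pd i (pd i u) x)
      refine this.trans ?_
      simp only [card_univ, Fintype.card_fin, Nat.cast_ofNat]
      refine mul_le_mul_of_nonneg_left (sum_le_sum fun i _ => ?_) (by norm_num)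
      exact single_le_sum (f := fun j => pd j (pd i u) x ^ 2) (fun j _ => sq_nonneg _) (mem_univ i)
    generalize (∑ i, pd i (pd i u) x) = L at *
    generalize (∑ j, ∑ k, b0 j k * pd j (pd k u) x) = P at *
    have h2 : L * P ≤ (c0 / 6) * L ^ 2 + (3 / (2 * c0)) * P ^ 2 := by
      have h3 : (c0 / 6) * L ^ 2 + (3 / (2 * c0)) * P ^ 2 - L * P =
        (c0 / 6) * (L - 3 / c0 * P) ^ 2 := by field_simp; ring
      have : 0 ≤ (c0 / 6) * (L - 3 / c0 * P) ^ 2 := by positivity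
      linarith
    nlinarith
  rw [integral_const_mul] at e2
  rw [integral_add (hu.hsq.const_mul _).integrable (hP.sq.const_mul _).integrable,
    integral_const_mul, integral_const_mul] at e3
  have e4 := e2.trans (e1.le.trans e3)
  have e5 : c0 / 2 * ∫ x, hsq u x ≤
      3 / (2 * c0) * ∫ x, (∑ j, ∑ k, b0 j k * pd j (pd k u) x) ^ 2 := by linarith
  have e6 := mul_le_mul_of_nonneg_left e5 (by positivity : 0 ≤ 2 * c0)
  calc _ = 2 * c0 * (c0 / 2 * ∫ x, hsq u x) := by ring
    _ ≤ _ := e6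
    _ = _ := by field_simp

lemma integral_hsq_le_of_close {b : Fin 3 → Fin 3 → E3 → ℝ} {c0 : ℝ} (hc0 : 0 < c0)
    (hell : ∀ ξ : Fin 3 → ℝ, c0 * ∑ i, ξ i ^ 2 ≤ ∑ j, ∑ k, b j k 0 * ξ j * ξ k)
    (hO : IsOpen O) (hb : ∀ j k, Sm O (b j k))
    (hclose : ∀ j k, ∀ x ∈ O, |b j k x - b j k 0| ≤ c0 / 11) (hu : TF O u) :
    ∫ x, hsq u x ≤ 12 / c0 ^ 2 * ∫ x, op2 b u x ^ 2 := by
  have h0 := integral_hsq_le_const hc0 hell hu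
  have hP : TF O (fun x => ∑ j, ∑ k, b j k 0 * pd j (pd k u) x) :=
    TF.sum fun j _ => TF.sum fun k _ => ((hu.pd k).pd j).const_mul _
  have hQ := hu.op2 hO hb
  have h1 : ∫ x, (∑ j, ∑ k, b j k 0 * pd j (pd k u) x) ^ 2 ≤
      ∫ x, (2 * op2 b u x ^ 2 + 18 * (c0 / 11) ^ 2 * hsq u x) := by
    refine TF.integral_mono hP.sq ((hQ.sq.const_mul _).add (hu.hsq.const_mul _)) fun x => ?_
    have h2 : ((∑ j, ∑ k, b j k 0 * pd j (pd k u) x) - op2 b u x) ^ 2 ≤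
        9 * ((c0 / 11) ^ 2 * hsq u x) := by
      by_cases hx : x ∈ O
      · have e : (∑ j, ∑ k, b j k 0 * pd j (pd k u) x) - op2 b u x =
            ∑ j, ∑ k, (b j k 0 - b j k x) * pd j (pd k u) x := by
          unfold op2
          simp only [← sum_sub_distrib, sub_mul]
        have a1 := sq_sum_le_card_mul_sum_sq (s := Finset.univ)
          (f := fun j : Fin 3 => ∑ k, (b j k 0 - b j k x) * pd j (pd k u) x)
        have a2 : ∀ j : Fin 3, (∑ k, (b j k 0 - b j k x) * pd j (pd k u) x) ^ 2 ≤
            3 * ∑ k, (c0 / 11) ^ 2 * pd j (pd k u) x ^ 2 := by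
          intro j
          have := sq_sum_le_card_mul_sum_sq (s := Finset.univ)
            (f := fun k : Fin 3 => (b j k 0 - b j k x) * pd j (pd k u) x)
          refine this.trans ?_
          simp only [card_univ, Fintype.card_fin, Nat.cast_ofNat]
          refine mul_le_mul_of_nonneg_left (sum_le_sum fun k _ => ?_) (by norm_num)
          rw [mul_pow]
          refine mul_le_mul_of_nonneg_right ?_ (sq_nonneg _)
          rw [sq_le_sq, abs_sub_comm, abs_of_pos (by positivity : 0 < c0 / 11)]
          exact hclose j k x hx
        rw [e]
        refine a1.trans ?_
        simp only [card_univ, Fintype.card_fin, Nat.cast_ofNat]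
        have a3 := sum_le_sum fun (j : Fin 3) (_ : j ∈ Finset.univ) => a2 j
        have a4 : (∑ j : Fin 3, 3 * ∑ k, (c0 / 11) ^ 2 * pd j (pd k u) x ^ 2) =
            3 * ((c0 / 11) ^ 2 * hsq u x) := by
          unfold hsq gsq
          rw [← mul_sum, sum_comm]
          simp only [mul_sum]
        linarith
      · rw [hP.zero_of_notMem hx, hQ.zero_of_notMem hx, hu.hsq.zero_of_notMem hx]; simp
    nlinarith [sq_nonneg ((∑ j, ∑ k, b j k 0 * pd j (pd k u) x) - 2 * op2 b u x)]
  rw [integral_add (hQ.sq.const_mul _).integrable (hu.hsq.const_mul _).integrable,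
    integral_const_mul, integral_const_mul] at h1
  have hI : 0 ≤ ∫ x, hsq u x := integral_nonneg fun x => hsq_nonneg u x
  rw [div_mul_eq_mul_div, le_div_iff₀ (by positivity)]
  have : 0 ≤ c0 ^ 2 * ∫ x, hsq u x := by positivity
  nlinarith

end energy

end

section

/-- Spectral bounds for a positive symmetric form whose eigenvalues lie in `[l₁, l₃]`. -/
structure Gap (b : Fin 3 → Fin 3 → ℝ) (l1 l3 : ℝ) : Prop where
  sym : ∀ j k, b j k = b k j
  pos : 0 < l1
  le : l1 ≤ l3
  low : ∀ ξ : Fin 3 → ℝ, l1 * ∑ j, ξ j ^ 2 ≤ ∑ j, ξ j * ∑ k, b j k * ξ k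
  up : ∀ ξ : Fin 3 → ℝ, ∑ j, (∑ k, b j k * ξ k) ^ 2 ≤ l3 * ∑ j, ξ j * ∑ k, b j k * ξ k
  mid : ∀ ξ : Fin 3 → ℝ, ∑ j, (∑ k, b j k * ξ k) ^ 2 ≤
    (l1 + l3) * (∑ j, ξ j * ∑ k, b j k * ξ k) - l1 * l3 * ∑ j, ξ j ^ 2

lemma exists_gap {a : Fin 3 → Fin 3 → E3 → ℝ} {α c0 : ℝ} (hsym : ∀ j k, a j k 0 = a k j 0)
    (hc0 : 0 < c0)
    (hell : ∀ ξ : Fin 3 → ℝ, c0 * ∑ i, ξ i ^ 2 ≤ ∑ j, ∑ k, a j k 0 * ξ j * ξ k)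
    (heig : EigCond a α) :
    ∃ l1 l3, Gap (fun j k => a j k 0) l1 l3 ∧ l3 < (1 + α) * l1 := by
  have hM : (coefMatrix a 0).IsHermitian := by
    ext j k
    simp [coefMatrix, hsym j k]
  set M := coefMatrix a 0 with hMdef
  set L := hM.eigenvalues
  set V := hM.eigenvectorBasis
  let A : E3 → E3 := fun ξ => WithLp.toLp 2 (M.mulVec (WithLp.ofLp ξ))
  have hA : ∀ ξ j, A ξ j = ∑ k, a j k 0 * ξ k := by
    intro ξ j
    simp [A, hMdef, coefMatrix, Matrix.mulVec, dotProduct]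
  have hin : ∀ x y : E3, inner ℝ x y = ∑ j, x j * y j := by
    intro x y
    rw [PiLp.inner_apply]
    exact sum_congr rfl fun j _ => by simp [mul_comm]
  have hAsym : ∀ x y : E3, inner ℝ x (A y) = inner ℝ (A x) y := by
    intro x y
    simp only [hin, hA, Fin.sum_univ_three]
    rw [hsym 1 0, hsym 2 0, hsym 2 1]
    ring
  have hAV : ∀ i, A (V i) = L i • V i := by
    intro i
    have h := hM.mulVec_eigenvectorBasis i
    ext j
    have := congrFun h j
    simpa [A] using this
  have hc : ∀ i ξ, inner ℝ (V i) (A ξ) = L i * inner ℝ (V i) ξ := by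
    intro i ξ
    rw [hAsym, hAV, inner_smul_left]; simp
  have s0 : ∀ ξ : E3, ∑ j, ξ j ^ 2 = ∑ i, inner ℝ (V i) ξ ^ 2 := by
    intro ξ
    have h := V.sum_inner_mul_inner ξ ξ
    rw [hin ξ ξ] at h
    simp only [pow_two]
    rw [← h]
    exact sum_congr rfl fun i _ => by rw [real_inner_comm ξ]
  have s1 : ∀ ξ : E3, ∑ j, ξ j * ∑ k, a j k 0 * ξ k = ∑ i, L i * inner ℝ (V i) ξ ^ 2 := by
    intro ξ
    have h := V.sum_inner_mul_inner ξ (A ξ)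
    rw [hin ξ (A ξ)] at h
    simp only [hA] at h
    rw [← h]
    refine sum_congr rfl fun i _ => ?_
    rw [hc, real_inner_comm ξ]; ring
  have s2 : ∀ ξ : E3, ∑ j, (∑ k, a j k 0 * ξ k) ^ 2 = ∑ i, L i ^ 2 * inner ℝ (V i) ξ ^ 2 := by
    intro ξ
    have h := s0 (A ξ)
    simp only [hA, hc] at h
    rw [h]
    exact sum_congr rfl fun i _ => by ring
  have hLpos : ∀ i, 0 < L i := by
    intro i
    have h := hell (fun j => V i j)
    have e : ∑ j, ∑ k, a j k 0 * V i j * V i k = ∑ j, V i j * ∑ k, a j k 0 * V i k := by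
      simp only [mul_sum]
      exact sum_congr rfl fun j _ => sum_congr rfl fun k _ => by ring
    have hN : ∀ i', inner ℝ (V i') (V i) = if i' = i then (1 : ℝ) else 0 := by
      intro i'; exact orthonormal_iff_ite.1 V.orthonormal i' i
    rw [e, s0 (V i), s1 (V i)] at h
    simp [hN] at h
    linarith
  obtain ⟨m, -, hm⟩ := exists_min_image (Finset.univ : Finset (Fin 3)) L ⟨0, mem_univ _⟩
  obtain ⟨n, -, hn⟩ := exists_max_image (Finset.univ : Finset (Fin 3)) L ⟨0, mem_univ _⟩
  refine ⟨L m, L n, ⟨hsym, hLpos m, hm n (mem_univ _), fun ξ => ?_, fun ξ => ?_, fun ξ => ?_⟩, ?_⟩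
  · have h0 := s0 (WithLp.toLp 2 ξ)
    have h1 := s1 (WithLp.toLp 2 ξ)
    simp only at h0 h1
    rw [h0, h1, mul_sum]
    exact sum_le_sum fun i _ => mul_le_mul_of_nonneg_right (hm i (mem_univ _)) (sq_nonneg _)
  · have h1 := s1 (WithLp.toLp 2 ξ)
    have h2 := s2 (WithLp.toLp 2 ξ)
    simp only at h1 h2
    rw [h1, h2, mul_sum]
    refine sum_le_sum fun i _ => ?_
    rw [← mul_assoc]
    refine mul_le_mul_of_nonneg_right ?_ (sq_nonneg _)
    nlinarith [hn i (mem_univ _), hLpos i]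
  · have h0 := s0 (WithLp.toLp 2 ξ)
    have h1 := s1 (WithLp.toLp 2 ξ)
    have h2 := s2 (WithLp.toLp 2 ξ)
    simp only at h0 h1 h2
    rw [h0, h1, h2, mul_sum, mul_sum, ← sum_sub_distrib]
    refine sum_le_sum fun i _ => ?_
    rw [← mul_assoc, ← sub_mul]
    refine mul_le_mul_of_nonneg_right ?_ (sq_nonneg _)
    nlinarith [mul_nonneg (sub_nonneg.2 (hm i (mem_univ _))) (sub_nonneg.2 (hn i (mem_univ _)))]
  · have h := heig hM n m
    rw [div_lt_iff₀ (hLpos m)] at h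
    linarith

/-- The algebraic inequality behind the pseudoconvexity of the weight `r ^ (-α)`. -/
lemma Gap.pseudoconvex {b : Fin 3 → Fin 3 → ℝ} {l1 l3 α : ℝ} (h : Gap b l1 l3) (hα : 0 < α)
    (hgap : l3 < (1 + α) * l1) :
    ∃ δ > 0, ∃ κ > 0, ∀ x : Fin 3 → ℝ, κ * (∑ j, x j ^ 2) ^ 2 ≤
      (α + 2) * (∑ j, x j * ∑ k, b j k * x k) ^ 2
      - (∑ j, x j ^ 2) * (∑ j, (∑ k, b j k * x k) ^ 2)
      - (l3 + δ) * (∑ j, x j ^ 2) * (∑ j, x j * ∑ k, b j k * x k) := by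
  have hl := h.pos
  have h3 := h.le
  set d := (1 + α) * l1 - l3 with hd
  have hdpos : 0 < d := by linarith
  refine ⟨d / 2, by positivity, d / 2 * l1, by positivity, fun x => ?_⟩
  have e1 := h.low x
  have e2 := h.mid x
  have hr : 0 ≤ ∑ j, x j ^ 2 := sum_nonneg fun _ _ => sq_nonneg _
  generalize (∑ j, x j ^ 2) = r at *
  generalize (∑ j, x j * ∑ k, b j k * x k) = q at *
  generalize (∑ j, (∑ k, b j k * x k) ^ 2) = z at *
  have hq : 0 ≤ q := le_trans (by positivity) e1
  have hz : r * z ≤ r * ((l1 + l3) * q - l1 * l3 * r) := mul_le_mul_of_nonneg_left e2 hr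
  obtain ⟨p, hp, rfl⟩ : ∃ p, 0 ≤ p ∧ q = l1 * r + p := ⟨q - l1 * r, by linarith, by ring⟩
  have hl3 : l3 = (1 + α) * l1 - d := by rw [hd]; ring
  clear_value d
  subst hl3
  nlinarith [mul_nonneg hp hr, mul_nonneg (mul_nonneg hp hr) hl.le, mul_nonneg hp hp,
    mul_nonneg hα.le (mul_nonneg hp hp), mul_nonneg (mul_nonneg hp hr) (mul_nonneg hα.le hl.le),
    mul_nonneg (mul_nonneg hp hr) hdpos.le,
        mul_nonneg (mul_nonneg hr hr) (mul_nonneg hdpos.le hl.le)]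

end

section

/-- The divergence-form operator `∑ ∂_j (b_jk ∂_k v)`. -/
def divOp (b : Fin 3 → Fin 3 → E3 → ℝ) (v : E3 → ℝ) (x : E3) : ℝ :=
  ∑ j, pd j (fun y => ∑ k, b j k y * pd k v y) x

/-- The skew part `2 X·∇v + h v` of the conjugated operator. -/
def skewOp (X : Fin 3 → E3 → ℝ) (h v : E3 → ℝ) (x : E3) : ℝ :=
  2 * (∑ i, X i x * pd i v x) + h x * v x

/-- The integrand of the commutator form. -/
def commForm (b : Fin 3 → Fin 3 → E3 → ℝ) (X : Fin 3 → E3 → ℝ) (q g h v : E3 → ℝ) (x : E3) : ℝ :=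
  (∑ j, ∑ k, (2 * (∑ i, b i j x * pd i (X k) x) + g x * b j k x
      - ∑ l, X l x * pd l (b j k) x) * pd j v x * pd k v x)
    + (∑ j, ∑ k, b j k x * pd k v x * pd j h x) * v x
    + ((∑ l, X l x * pd l q x) - q x * g x) * v x ^ 2

section carleman
variable {O : Set E3} {b : Fin 3 → Fin 3 → E3 → ℝ} {X : Fin 3 → E3 → ℝ} {q g h v u : E3 → ℝ}

lemma divOp_eq (hO : IsOpen O) (hb : ∀ j k, Sm O (b j k)) (hv : Sm O v) {x : E3} (hx : x ∈ O) :
    divOp b v x = ∑ j, ∑ k, (pd j (b j k) x * pd k v x + b j k x * pd j (pd k v) x) := by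
  unfold divOp
  refine sum_congr rfl fun j _ => ?_
  exact (PdOn.sum hO (s := Finset.univ) fun k _ =>
    ((hb j k).pdOn j).mul hO ((hv.pd hO k).pdOn j)).2 x hx

set_option maxHeartbeats 2000000 in
lemma commForm_pointwise (hO : IsOpen O) (hb : ∀ j k, Sm O (b j k))
    (hsym : ∀ j k, ∀ x ∈ O, b j k x = b k j x) (hX : ∀ i, Sm O (X i)) (hq : Sm O q)
    (hh : Sm O h) (hdiv : ∀ x ∈ O, h x = (∑ i, pd i (X i) x) + g x)
    (hv : Sm O v) {x : E3} (hx : x ∈ O) :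
    commForm b X q g h v x = - ((divOp b v x + q x * v x) * skewOp X h v x) +
      ∑ i, pd i (fun y => (∑ k, b i k y * pd k v y) * skewOp X h v y
        - X i y * (∑ j, ∑ k, b j k y * (pd j v y * pd k v y)) + q y * X i y * (v y * v y)) x := by
  have hvi : ∀ i, Sm O (pd i v) := fun i => hv.pd hO i
  have hM : ∀ i, PdOn O i (skewOp X h v) _ := fun i =>
    ((PdOn.sum hO (s := Finset.univ) fun l _ =>
      ((hX l).pdOn i).mul hO ((hvi l).pdOn i)).const_mul hO 2).add hO
      ((hh.pdOn i).mul hO (hv.pdOn i))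
  have hH := fun i => ((((PdOn.sum hO (s := Finset.univ) fun k _ =>
      ((hb i k).pdOn i).mul hO ((hvi k).pdOn i)).mul hO (hM i)).sub hO
      (((hX i).pdOn i).mul hO (PdOn.sum hO (s := Finset.univ) fun j _ =>
        PdOn.sum hO (s := Finset.univ) fun k _ => ((hb j k).pdOn i).mul hO
          (((hvi j).pdOn i).mul hO ((hvi k).pdOn i))))).add hO
      (((hq.pdOn i).mul hO ((hX i).pdOn i)).mul hO ((hv.pdOn i).mul hO (hv.pdOn i)))).2 x hx
  rw [sum_congr rfl fun i _ => hH i, divOp_eq hO hb hv hx]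
  have c1 : ∀ i j, pd i (pd j v) x = pd j (pd i v) x := fun i j => pd_comm hO hv hx i j
  have c2 : ∀ i j l, pd l (b i j) x = pd l (b j i) x := fun i j l =>
    pd_congr hO (fun y hy => hsym i j y hy) l hx
  unfold commForm skewOp
  beta_reduce
  rw [hdiv x hx]
  simp only [Fin.sum_univ_three]
  rw [c1 1 0, c1 2 0, c1 2 1, hsym 1 0 x hx, hsym 2 0 x hx, hsym 2 1 x hx]
  simp only [c2 1 0, c2 2 0, c2 2 1]
  ring

lemma TF.divOp (hO : IsOpen O) (hb : ∀ j k, Sm O (b j k)) (hv : TF O v) : TF O (divOp b v) :=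
  TF.sum fun j _ => (TF.sum fun k _ => TF.smul hO (hb j k) (hv.pd k)).pd j

lemma TF.skewOp (hO : IsOpen O) (hX : ∀ i, Sm O (X i)) (hh : Sm O h) (hv : TF O v) :
    TF O (skewOp X h v) :=
  ((TF.sum fun i _ => TF.smul hO (hX i) (hv.pd i)).const_mul 2).add (hv.smul hO hh)

lemma TF.commForm (hO : IsOpen O) (hb : ∀ j k, Sm O (b j k)) (hX : ∀ i, Sm O (X i)) (hq : Sm O q)
    (hg : Sm O g) (hh : Sm O h) (hv : TF O v) : TF O (commForm b X q g h v) := by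
  have e : _root_.commForm b X q g h v = fun x =>
      (∑ j, ∑ k, (2 * (∑ i, b i j x * _root_.pd i (X k) x) + g x * b j k x
      - ∑ l, X l x * _root_.pd l (b j k) x) * (_root_.pd j v x * _root_.pd k v x))
    + (∑ j, ∑ k, (b j k x * _root_.pd j h x) * (_root_.pd k v x * v x))
    + ((∑ l, X l x * _root_.pd l q x) - q x * g x) * v x ^ 2 := by
    funext x
    unfold _root_.commForm
    simp only [sum_mul, mul_assoc, add_left_inj, add_right_inj]
    refine sum_congr rfl fun j _ => sum_congr rfl fun k _ => by ring
  rw [e]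
  refine TF.add (TF.add (TF.sum fun j _ => TF.sum fun k _ => TF.smul hO ?_
      ((hv.pd j).mul (hv.pd k)))
    (TF.sum fun j _ => TF.sum fun k _ => TF.smul hO ((hb j k).mul (hh.pd hO j)) ((hv.pd k).mul hv)))
    (TF.smul hO ?_ hv.sq)
  · exact (((Sm.const 2).mul (Sm.sum fun i _ => (hb i j).mul ((hX k).pd hO i))).add
      (hg.mul (hb j k))).sub (Sm.sum fun l _ => (hX l).mul ((hb j k).pd hO l))
  · exact (Sm.sum fun l _ => (hX l).mul (hq.pd hO l)).sub (hq.mul hg)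

lemma integral_commForm (hO : IsOpen O) (hb : ∀ j k, Sm O (b j k))
    (hsym : ∀ j k, ∀ x ∈ O, b j k x = b k j x) (hX : ∀ i, Sm O (X i)) (hq : Sm O q)
    (hh : Sm O h) (hdiv : ∀ x ∈ O, h x = (∑ i, pd i (X i) x) + g x) (hv : TF O v) :
    ∫ x, commForm b X q g h v x =
      ∫ x, - ((divOp b v x + q x * v x) * skewOp X h v x) := by
  have hM := hv.skewOp hO hX hh
  have hH : ∀ i, TF O (fun y => (∑ k, b i k y * pd k v y) * skewOp X h v y
        - X i y * (∑ j, ∑ k, b j k y * (pd j v y * pd k v y)) + q y * X i y * (v y * v y)) := by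
    intro i
    refine (TF.sub' ((TF.sum fun k _ => TF.smul hO (hb i k) (hv.pd k)).mul hM)
      (TF.smul hO (hX i) (TF.sum fun j _ => TF.sum fun k _ =>
        TF.smul hO (hb j k) ((hv.pd j).mul (hv.pd k))))).add
        (TF.smul hO (hq.mul (hX i)) (hv.mul hv))
  have hG : TF O (fun x => - ((divOp b v x + q x * v x) * skewOp X h v x)) :=
    (((hv.divOp hO hb).add (hv.smul hO hq)).mul hM).neg
  refine integral_eq_of_divergence hG hH fun x => ?_
  by_cases hx : x ∈ O
  · exact commForm_pointwise hO hb hsym hX hq hh hdiv (hv.sm O) hx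
  · rw [hG.zero_of_notMem hx, sum_eq_zero fun i _ => ((hH i).pd i).zero_of_notMem hx]
    have h0 := hv.zero_of_notMem hx
    have h1 : ∀ i, pd i v x = 0 := fun i => (hv.pd i).zero_of_notMem hx
    simp [commForm, h0, h1]

lemma conjugation (hO : IsOpen O) (hb : ∀ j k, Sm O (b j k))
    (hsym : ∀ j k, ∀ x ∈ O, b j k x = b k j x) {φ : E3 → ℝ} (hφ : Sm O φ) (hu : Sm O u)
    {x : E3} (hx : x ∈ O) :
    Real.exp (φ x) * op2 b u x =
      divOp b (fun y => Real.exp (φ y) * u y) x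
      + (∑ i, ∑ k, b i k x * pd k φ x * pd i φ x) * (Real.exp (φ x) * u x)
      - (2 * (∑ i, (∑ k, b i k x * pd k φ x) * pd i (fun y => Real.exp (φ y) * u y) x)
        + (∑ i, pd i (fun y => ∑ k, b i k y * pd k φ y) x) * (Real.exp (φ x) * u x))
      - (∑ k, (∑ j, pd j (b j k) x) * pd k (fun y => Real.exp (φ y) * u y) x)
      + (∑ k, (∑ j, pd j (b j k) x) * pd k φ x) * (Real.exp (φ x) * u x) := by
  have he : ∀ i, PdOn O i (fun y => Real.exp (φ y)) (fun y => Real.exp (φ y) * pd i φ y) :=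
    fun i => (hφ.pdOn i).comp hO (φ := Real.exp) (φ' := Real.exp) (s := Set.univ)
      (fun y _ => ⟨Real.contDiff_exp.contDiffAt, Real.hasDerivAt_exp y⟩) (fun _ _ => trivial)
  have hv : ∀ i, PdOn O i (fun y => Real.exp (φ y) * u y) _ := fun i => (he i).mul hO (hu.pdOn i)
  have hvv : ∀ i j, PdOn O j (fun y => Real.exp (φ y) * pd i φ y * u y + Real.exp (φ y) * pd i u y)
      _ := fun i j => (((he j).mul hO ((hφ.pd hO i).pdOn j)).mul hO (hu.pdOn j)).add hO
        ((he j).mul hO ((hu.pd hO i).pdOn j))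
  have hX : ∀ i, PdOn O i (fun y => ∑ k, b i k y * pd k φ y) _ := fun i =>
    PdOn.sum hO fun k _ => ((hb i k).pdOn i).mul hO ((hφ.pd hO k).pdOn i)
  rw [divOp_eq hO hb (hv 0).1 hx]
  have e2 : ∀ i j, pd j (pd i (fun y => Real.exp (φ y) * u y)) x = _ := fun i j =>
    (pd_congr hO (fun y hy => (hv i).2 y hy) j hx).trans ((hvv i j).2 x hx)
  simp only [e2, (hv _).2 x hx, (hX _).2 x hx]
  have c1 : ∀ i j, pd i (pd j u) x = pd j (pd i u) x := fun i j => pd_comm hO hu hx i j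
  have c3 : ∀ i j, pd i (pd j φ) x = pd j (pd i φ) x := fun i j => pd_comm hO hφ hx i j
  have c2 : ∀ i j l, pd l (b i j) x = pd l (b j i) x := fun i j l =>
    pd_congr hO (fun y hy => hsym i j y hy) l hx
  unfold op2
  generalize Real.exp (φ x) = E
  simp only [Fin.sum_univ_three]
  rw [c1 1 0, c1 2 0, c1 2 1, c3 1 0, c3 2 0, c3 2 1, hsym 1 0 x hx, hsym 2 0 x hx, hsym 2 1 x hx]
  simp only [c2 1 0, c2 2 0, c2 2 1]
  ring

end carleman

end

section

lemma Sy.cast {R p q : ℝ} {f : E3 → ℝ} (h : p = q) (hf : Sy R p f) : Sy R q f := h ▸ hf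

/-- `f` is a symbol of order `p` with principal part `f₀`. -/
def SyE (R p : ℝ) (f f0 : E3 → ℝ) : Prop := Sy R p f0 ∧ Sy R (p + 1) (fun x => f x - f0 x)

section principal
variable {R p q : ℝ} {f f0 g g0 : E3 → ℝ}

lemma SyE.left (hR : R ≤ 1) (h : SyE R p f f0) : Sy R p f :=
  (h.1.add (h.2.mono hR (by linarith : p ≤ p + 1))).congr fun x _ => by ring

lemma SyE.refl (h : Sy R p f) : SyE R p f f := ⟨h, Sy.zero.congr fun x _ => by simp⟩

lemma SyE.of_lower (h : Sy R (p + 1) f) : SyE R p f (fun _ => 0) :=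
  ⟨Sy.zero, h.congr fun x _ => by simp⟩

lemma SyE.cast (h : p = q) (hf : SyE R p f f0) : SyE R q f f0 := h ▸ hf

lemma SyE.add (h : SyE R p f f0) (h' : SyE R p g g0) :
    SyE R p (fun x => f x + g x) (fun x => f0 x + g0 x) :=
  ⟨h.1.add h'.1, (h.2.add h'.2).congr fun x _ => by ring⟩

lemma SyE.sub (h : SyE R p f f0) (h' : SyE R p g g0) :
    SyE R p (fun x => f x - g x) (fun x => f0 x - g0 x) :=
  ⟨h.1.sub h'.1, (h.2.sub h'.2).congr fun x _ => by ring⟩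

lemma SyE.const_mul (h : SyE R p f f0) (c : ℝ) :
    SyE R p (fun x => c * f x) (fun x => c * f0 x) :=
  ⟨h.1.const_mul c, (h.2.const_mul c).congr fun x _ => by ring⟩

lemma SyE.sum {ι : Type*} {s : Finset ι} {F F0 : ι → E3 → ℝ} (h : ∀ j ∈ s, SyE R p (F j) (F0 j)) :
    SyE R p (fun x => ∑ j ∈ s, F j x) (fun x => ∑ j ∈ s, F0 j x) :=
  ⟨Sy.sum fun j hj => (h j hj).1, (Sy.sum fun j hj => (h j hj).2).congr fun x _ => by
    rw [sum_sub_distrib]⟩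

lemma SyE.mul (hR : R ≤ 1) (h : SyE R p f f0) (h' : SyE R q g g0) :
    SyE R (p + q) (fun x => f x * g x) (fun x => f0 x * g0 x) :=
  ⟨h.1.mul h'.1, (((h.left hR).mul h'.2).cast (by ring : p + (q + 1) = p + q + 1) |>.add
    ((h.2.mul h'.1).cast (by ring))).congr fun x _ => by ring⟩

lemma SyE.pd (hR : R ≤ 1) (h : SyE R p f f0) (i : Fin 3) :
    SyE R (p - 1) (pd i f) (pd i f0) := by
  refine ⟨h.1.pd i, ((h.2.pd i).cast (by ring : p + 1 - 1 = p - 1 + 1)).congr fun x hx => ?_⟩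
  exact (PdOn.sub (isOpen_pb R) ((h.left hR).1.pdOn i) (h.1.1.pdOn i)).2 x hx |>.symm

/-- A symbol differs from its principal part by an arbitrarily small multiple near the origin. -/
lemma SyE.close (h : SyE R p f f0) {ε : ℝ} (hε : 0 < ε) :
    ∃ r > 0, ∀ x ∈ pb R, ‖x‖ < r → |f x - f0 x| ≤ ε * ‖x‖ ^ p := by
  obtain ⟨C, hC0, hC⟩ := h.2.bound
  refine ⟨ε / (C + 1), by positivity, fun x hx hr => (hC x hx).trans ?_⟩
  have hx0 := norm_pos_of_mem_pb hx
  rw [Real.rpow_add hx0, Real.rpow_one]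
  have : C * ‖x‖ ≤ ε := by
    rw [lt_div_iff₀ (by positivity)] at hr
    nlinarith
  have h2 : 0 ≤ ‖x‖ ^ p := by positivity
  nlinarith

end principal

/-- The radial weight `r ^ (-α)`. -/
def wt (α : ℝ) (x : E3) : ℝ := ‖x‖ ^ (-α)

/-- The field `b ∇ r ^ (-α)`. -/
def wtX (b : Fin 3 → Fin 3 → E3 → ℝ) (α : ℝ) (i : Fin 3) (x : E3) : ℝ :=
  ∑ k, b i k x * pd k (wt α) x

/-- The symbol `b(∇ r ^ (-α), ∇ r ^ (-α))`. -/
def wtQ (b : Fin 3 → Fin 3 → E3 → ℝ) (α : ℝ) (x : E3) : ℝ :=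
  ∑ i, ∑ k, b i k x * pd k (wt α) x * pd i (wt α) x

section weight
variable {R α : ℝ} {b : Fin 3 → Fin 3 → E3 → ℝ}

lemma pdOn_wt (R α : ℝ) (i : Fin 3) :
    PdOn (pb R) i (wt α) (fun x => -α * (x i * ‖x‖ ^ (-α - 2))) := PdOn.norm_rpow R (-α) i

lemma pdOn_pd_wt (R α : ℝ) (i j : Fin 3) :
    PdOn (pb R) j (pd i (wt α)) (fun x => -α * ((if i = j then 1 else 0) * ‖x‖ ^ (-α - 2)
      + x i * ((-α - 2) * (x j * ‖x‖ ^ (-α - 2 - 2))))) := by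
  have hO := isOpen_pb R
  have h := ((PdOn.coord (O := pb R) (i := j) i).mul hO (PdOn.norm_rpow R (-α - 2) j)).const_mul hO
    (-α)
  exact ⟨(pdOn_wt R α i).1.pd hO i, fun x hx =>
    (pd_congr hO (pdOn_wt R α i).2 j hx).trans (h.2 x hx)⟩

lemma Sy.wt (hR : R ≤ 1) (α : ℝ) : Sy R (-α) (wt α) := Sy.norm_rpow hR (-α)

lemma Sy.pd_wt (hR : R ≤ 1) (α : ℝ) (i : Fin 3) : Sy R (-α - 1) (_root_.pd i (_root_.wt α)) :=
  (Sy.wt hR α).pd i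

lemma SyE.coef {O : Set E3} (hO : IsOpen O) (hb : ∀ j k, Sm O (b j k))
    (hR : closedBall 0 R ⊆ O) (hR1 : R ≤ 1) (j k : Fin 3) :
    SyE R 0 (b j k) (fun _ => b j k 0) :=
  ⟨Sy.const hR1 _, (Sy.of_smooth_zero hO ((hb j k).sub (Sm.const (b j k 0))) hR hR1
    (by simp)).cast (by ring)⟩

lemma SyE.wtX (hR : R ≤ 1) (hb : ∀ j k, SyE R 0 (b j k) (fun _ => b j k 0)) (i : Fin 3) :
    SyE R (-α - 1) (wtX b α i) (wtX (fun j k _ => b j k 0) α i) :=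
  SyE.sum fun k _ => ((hb i k).mul hR (SyE.refl (Sy.pd_wt hR α k))).cast (by ring)

lemma SyE.wtQ (hR : R ≤ 1) (hb : ∀ j k, SyE R 0 (b j k) (fun _ => b j k 0)) :
    SyE R (-2 * α - 2) (wtQ b α) (wtQ (fun j k _ => b j k 0) α) :=
  SyE.sum fun i _ => SyE.sum fun k _ => (((hb i k).mul hR (SyE.refl (Sy.pd_wt hR α k))).mul hR
    (SyE.refl (Sy.pd_wt hR α i))).cast (by ring)

lemma pd_wtX_const (b0 : Fin 3 → Fin 3 → ℝ) (i l : Fin 3) {x : E3} (hx : x ∈ pb R) :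
    pd l (wtX (fun j k _ => b0 j k) α i) x = ∑ k, b0 i k * pd l (pd k (wt α)) x :=
  (PdOn.sum (isOpen_pb R) (s := Finset.univ) fun k _ =>
    ((pdOn_pd_wt R α k l).1.pdOn l).const_mul (isOpen_pb R) (b0 i k)).2 x hx

lemma pd_wtQ_const (b0 : Fin 3 → Fin 3 → ℝ) (l : Fin 3) {x : E3} (hx : x ∈ pb R) :
    pd l (wtQ (fun j k _ => b0 j k) α) x = ∑ i, ∑ k, (b0 i k * pd l (pd k (wt α)) x * pd i (wt α) x
      + b0 i k * pd k (wt α) x * pd l (pd i (wt α)) x) :=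
  (PdOn.sum (isOpen_pb R) (s := Finset.univ) fun i _ => PdOn.sum (isOpen_pb R) (s := Finset.univ)
    fun k _ => (((pdOn_pd_wt R α k l).1.pdOn l).const_mul (isOpen_pb R) (b0 i k)).mul (isOpen_pb R)
      ((pdOn_pd_wt R α i l).1.pdOn l)).2 x hx

end weight

end

section

section principalForm
variable {R α l1 l3 δ κ : ℝ} {b0 : Fin 3 → Fin 3 → ℝ}

lemma principal_gradient_form (h : Gap b0 l1 l3) (hα : 0 < α) (hδ : 0 < δ) {x : E3} (hx : x ∈ pb R)
    (p : Fin 3 → ℝ) :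
    2 * δ * α * l1 * ‖x‖ ^ (-α - 2) * ∑ i, p i ^ 2 ≤
      ∑ j, ∑ k, (2 * (∑ i, b0 i j * pd i (wtX (fun j k _ => b0 j k) α k) x)
        + (2 * (l3 + δ) * α * ‖x‖ ^ (-α - 2)) * b0 j k) * p j * p k := by
  have hx0 := norm_pos_of_mem_pb hx
  simp only [pd_wtX_const b0 _ _ hx, (pdOn_pd_wt R α _ _).2 x hx]
  have hρ : 0 ≤ ‖x‖ ^ (-α - 2) := by positivity
  have hσ : 0 ≤ ‖x‖ ^ (-α - 2 - 2) := by positivity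
  generalize ‖x‖ ^ (-α - 2) = ρ at *
  generalize ‖x‖ ^ (-α - 2 - 2) = σ at *
  have e1 := h.low p
  have e2 := h.up p
  have key : ∑ j, ∑ k, (2 * (∑ i, b0 i j * ∑ m, b0 k m * (-α * ((if m = i then 1 else 0) * ρ
      + x m * ((-α - 2) * (x i * σ))))) + (2 * (l3 + δ) * α * ρ) * b0 j k) * p j * p k =
      -2 * α * ρ * ∑ j, (∑ k, b0 j k * p k) ^ 2
      + 2 * α * (α + 2) * σ * (∑ j, x j * ∑ k, b0 j k * p k) ^ 2
      + 2 * (l3 + δ) * α * ρ * ∑ j, p j * ∑ k, b0 j k * p k := by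
    simp only [Fin.sum_univ_three, h.sym 1 0, h.sym 2 0, h.sym 2 1]
    simp only [Fin.isValue, if_true, if_false, show (0 : Fin 3) ≠ 1 by decide,
      show (0 : Fin 3) ≠ 2 by decide, show (1 : Fin 3) ≠ 0 by decide,
      show (1 : Fin 3) ≠ 2 by decide, show (2 : Fin 3) ≠ 0 by decide,
      show (2 : Fin 3) ≠ 1 by decide]
    ring
  rw [key]
  generalize (∑ j, (∑ k, b0 j k * p k) ^ 2) = Y at *
  generalize (∑ j, p j * ∑ k, b0 j k * p k) = B at *
  generalize (∑ i, p i ^ 2) = P at *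
  have h1 : 0 ≤ 2 * α * (α + 2) * σ * (∑ j, x j * ∑ k, b0 j k * p k) ^ 2 := by positivity
  have h2 := mul_le_mul_of_nonneg_left e2 (by positivity : 0 ≤ 2 * α * ρ)
  have h3 := mul_le_mul_of_nonneg_left e1 (by positivity : 0 ≤ 2 * δ * α * ρ)
  nlinarith

lemma principal_zero_form (h : Gap b0 l1 l3) (hα : 0 < α)
    (hps : ∀ x : Fin 3 → ℝ, κ * (∑ j, x j ^ 2) ^ 2 ≤
      (α + 2) * (∑ j, x j * ∑ k, b0 j k * x k) ^ 2
      - (∑ j, x j ^ 2) * (∑ j, (∑ k, b0 j k * x k) ^ 2)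
      - (l3 + δ) * (∑ j, x j ^ 2) * (∑ j, x j * ∑ k, b0 j k * x k))
    {x : E3} (hx : x ∈ pb R) :
    2 * α ^ 3 * κ * ‖x‖ ^ (-3 * α - 4) ≤
      (∑ l, wtX (fun j k _ => b0 j k) α l x * pd l (wtQ (fun j k _ => b0 j k) α) x)
        - wtQ (fun j k _ => b0 j k) α x * (2 * (l3 + δ) * α * ‖x‖ ^ (-α - 2)) := by
  have hx0 := norm_pos_of_mem_pb hx
  simp only [pd_wtQ_const b0 _ hx, wtQ, wtX, (pdOn_pd_wt R α _ _).2 x hx, (pdOn_wt R α _).2 x hx]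
  have hs : ‖x‖ ^ (-α - 2) = (∑ j, x j ^ 2) * ‖x‖ ^ (-α - 2 - 2) := by
    rw [← norm_sq_E3, ← Real.rpow_two, ← Real.rpow_add hx0]; congr 1; ring
  have hs3 : ‖x‖ ^ (-3 * α - 4) = (∑ j, x j ^ 2) ^ 2 * (‖x‖ ^ (-α - 2)) ^ 2 *
      ‖x‖ ^ (-α - 2 - 2) := by
    rw [← norm_sq_E3, ← pow_mul, ← Real.rpow_natCast, ← Real.rpow_natCast, ← Real.rpow_mul hx0.le,
      ← Real.rpow_add hx0, ← Real.rpow_add hx0]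
    congr 1; push_cast; ring
  rw [hs3]
  have hσ : 0 ≤ ‖x‖ ^ (-α - 2 - 2) := by positivity
  have hρ : 0 ≤ ‖x‖ ^ (-α - 2) := by positivity
  generalize ‖x‖ ^ (-α - 2) = ρ at *
  generalize ‖x‖ ^ (-α - 2 - 2) = σ at *
  have key : (∑ l, (∑ k, b0 l k * (-α * (x k * ρ))) *
      ∑ i, ∑ k, (b0 i k * (-α * ((if k = l then 1 else 0) * ρ + x k * ((-α - 2) * (x l * σ)))) *
          (-α * (x i * ρ)) + b0 i k * (-α * (x k * ρ)) *
          (-α * ((if i = l then 1 else 0) * ρ + x i * ((-α - 2) * (x l * σ)))))) -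
      (∑ i, ∑ k, b0 i k * (-α * (x k * ρ)) * (-α * (x i * ρ))) * (2 * (l3 + δ) * α * ρ) =
      2 * α ^ 3 * ρ ^ 2 * ((α + 2) * σ * (∑ j, x j * ∑ k, b0 j k * x k) ^ 2
      - ρ * (∑ j, (∑ k, b0 j k * x k) ^ 2)
      - (l3 + δ) * ρ * (∑ j, x j * ∑ k, b0 j k * x k)) := by
    simp only [Fin.sum_univ_three, h.sym 1 0, h.sym 2 0, h.sym 2 1]
    simp only [Fin.isValue, if_true, if_false, show (0 : Fin 3) ≠ 1 by decide,
      show (0 : Fin 3) ≠ 2 by decide, show (1 : Fin 3) ≠ 0 by decide,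
      show (1 : Fin 3) ≠ 2 by decide, show (2 : Fin 3) ≠ 0 by decide,
      show (2 : Fin 3) ≠ 1 by decide]
    ring
  rw [key]
  have := mul_le_mul_of_nonneg_left (hps x) (by positivity : 0 ≤ 2 * α ^ 3 * ρ ^ 2 * σ)
  rw [hs] at this ⊢
  refine le_trans (le_of_eq ?_) (this.trans (le_of_eq ?_)) <;> ring

end principalForm

end

section

/-- Admissible second-order coefficients: smooth and symmetric near the origin, elliptic at the
origin, and with the eigenvalue gap `α` there. -/
structure Adm (O : Set E3) (b : Fin 3 → Fin 3 → E3 → ℝ) (α : ℝ) : Prop where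
  isOpen : IsOpen O
  zero_mem : (0 : E3) ∈ O
  smooth : ∀ j k, Sm O (b j k)
  sym : ∀ j k, ∀ x ∈ O, b j k x = b k j x
  ell : ∃ c0 > 0, ∀ ξ : Fin 3 → ℝ, c0 * ∑ i, ξ i ^ 2 ≤ ∑ j, ∑ k, b j k 0 * ξ j * ξ k
  eig : EigCond b α

/-- Pointwise bounds for the commutator coefficients on the punctured ball of radius `R`. -/
structure CommBounds (b : Fin 3 → Fin 3 → E3 → ℝ) (α G c K R : ℝ) : Prop where
  grad : ∀ x ∈ pb R, ∀ p : Fin 3 → ℝ, c * ‖x‖ ^ (-α - 2) * ∑ i, p i ^ 2 ≤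
    ∑ j, ∑ k, (2 * (∑ i, b i j x * pd i (wtX b α k) x) + (G * ‖x‖ ^ (-α - 2)) * b j k x
      - ∑ l, wtX b α l x * pd l (b j k) x) * p j * p k
  zero : ∀ x ∈ pb R, c * ‖x‖ ^ (-3 * α - 4) ≤
    (∑ l, wtX b α l x * pd l (wtQ b α) x) - wtQ b α x * (G * ‖x‖ ^ (-α - 2))
  mixed : ∀ x ∈ pb R, ∀ k, |∑ j, b j k x * pd j (fun y => (∑ i, pd i (wtX b α i) y)
    + G * ‖y‖ ^ (-α - 2)) x| ≤ K * ‖x‖ ^ (-α - 3)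
  drift : ∀ x ∈ pb R, ∀ k, |∑ j, pd j (b j k) x| ≤ K
  drift_wt : ∀ x ∈ pb R, |∑ k, (∑ j, pd j (b j k) x) * pd k (wt α) x| ≤ K * ‖x‖ ^ (-α - 1)
  wt_grad : ∀ x ∈ pb R, ∀ k, |pd k (wt α) x| ≤ K * ‖x‖ ^ (-α - 1)

lemma Adm.exists_commBounds {O : Set E3} {b : Fin 3 → Fin 3 → E3 → ℝ} {α : ℝ} (hb : Adm O b α)
    (hα : 0 < α) :
    ∃ R > 0, R ≤ 1 ∧ closedBall 0 R ⊆ O ∧ ∃ G ≥ 0, ∃ c > 0, ∃ K ≥ 0, CommBounds b α G c K R := by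
  obtain ⟨c0, hc0, hell⟩ := hb.ell
  obtain ⟨l1, l3, hg, hgap⟩ := exists_gap (fun j k => hb.sym j k 0 hb.zero_mem) hc0 hell hb.eig
  obtain ⟨δ, hδ, κ, hκ, hps⟩ := hg.pseudoconvex hα hgap
  obtain ⟨R0, hR0, hR0O⟩ := Metric.nhds_basis_closedBall.mem_iff.1 (hb.isOpen.mem_nhds hb.zero_mem)
  set R1 := min R0 1 with hR1
  have hR1pos : 0 < R1 := lt_min hR0 one_pos
  have hR11 : R1 ≤ 1 := min_le_right _ _
  have hR1O : closedBall 0 R1 ⊆ O := (closedBall_subset_closedBall (min_le_left _ _)).trans hR0O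
  have hl1 := hg.pos
  have hl3 : 0 < l3 := hl1.trans_le hg.le
  set G := 2 * (l3 + δ) * α with hG
  have hcoef := fun j k => SyE.coef hb.isOpen hb.smooth hR1O hR11 j k
  have hX : ∀ i, SyE R1 (-α - 1) (wtX b α i) _ := fun i => SyE.wtX hR11 hcoef i
  have hQ : SyE R1 (-2 * α - 2) (wtQ b α) _ := SyE.wtQ hR11 hcoef
  have hgs : Sy R1 (-α - 2) (fun x => G * ‖x‖ ^ (-α - 2)) := (Sy.norm_rpow hR11 _).const_mul G
  have hdb : ∀ j k l, Sy R1 0 (pd l (b j k)) := fun j k l =>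
    Sy.of_smooth hb.isOpen ((hb.smooth j k).pd hb.isOpen l) hR1O hR11
  have hA : ∀ j k, SyE R1 (-α - 2) (fun x => (2 * (∑ i, b i j x * pd i (wtX b α k) x)
      + (G * ‖x‖ ^ (-α - 2)) * b j k x - ∑ l, wtX b α l x * pd l (b j k) x)) _ := fun j k =>
    (((SyE.sum fun i _ => ((hcoef i j).mul hR11 ((hX k).pd hR11 i)).cast
        (by ring : (0 : ℝ) + (-α - 1 - 1) = -α - 2)).const_mul 2).add
      (((SyE.refl hgs).mul hR11 (hcoef j k)).cast (by ring))).sub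
      (SyE.of_lower (Sy.sum fun l _ => (((hX l).left hR11).mul (hdb j k l)).cast (by ring)))
  have hZ : SyE R1 (-3 * α - 4) (fun x => (∑ l, wtX b α l x * pd l (wtQ b α) x)
      - wtQ b α x * (G * ‖x‖ ^ (-α - 2))) _ :=
    (SyE.sum fun l _ => ((hX l).mul hR11 (hQ.pd hR11 l)).cast
      (by ring : -α - 1 + (-2 * α - 2 - 1) = -3 * α - 4)).sub
      ((hQ.mul hR11 (SyE.refl hgs)).cast (by ring))
  have hH : Sy R1 (-α - 2) (fun y => (∑ i, pd i (wtX b α i) y) + G * ‖y‖ ^ (-α - 2)) :=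
    (Sy.sum fun i _ => (((hX i).left hR11).pd i).cast (by ring)).add hgs
  have hmix : ∀ k, Sy R1 (-α - 3) (fun x => ∑ j, b j k x * pd j (fun y =>
      (∑ i, pd i (wtX b α i) y) + G * ‖y‖ ^ (-α - 2)) x) := fun k =>
    Sy.sum fun j _ => (((hcoef j k).left hR11).mul (hH.pd j)).cast (by ring)
  have hdr : ∀ k, Sy R1 0 (fun x => ∑ j, pd j (b j k) x) := fun k => Sy.sum fun j _ => hdb j k j
  have hdw : Sy R1 (-α - 1) (fun x => ∑ k, (∑ j, pd j (b j k) x) * pd k (wt α) x) :=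
    Sy.sum fun k _ => ((hdr k).mul (Sy.pd_wt hR11 α k)).cast (by ring)
  set d := 2 * δ * α * l1 with hd
  have hdpos : 0 < d := by positivity
  set e := 2 * α ^ 3 * κ with he
  have hepos : 0 < e := by positivity
  choose r1 hr1 hr1' using fun jk : Fin 3 × Fin 3 => (hA jk.1 jk.2).close
    (by positivity : 0 < d / 18)
  obtain ⟨r2, hr2, hr2'⟩ := hZ.close (by positivity : 0 < e / 2)
  choose K1 hK1 hK1' using fun k => (hmix k).bound
  choose K2 hK2 hK2' using fun k => (hdr k).bound
  obtain ⟨K3, hK3, hK3'⟩ := hdw.bound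
  choose K4 hK4 hK4' using fun k => (Sy.pd_wt hR11 α k).bound
  obtain ⟨m, -, hm⟩ := exists_min_image (Finset.univ : Finset (Fin 3 × Fin 3)) r1
    ⟨(0, 0), mem_univ _⟩
  set R := min R1 (min (r1 m) r2) with hR
  have hRR1 : R ≤ R1 := min_le_left _ _
  have hsub : pb R ⊆ pb R1 := pb_mono hRR1
  set K := (∑ k, K1 k) + (∑ k, K2 k) + K3 + ∑ k, K4 k with hK
  have s1 : 0 ≤ ∑ k, K1 k := sum_nonneg fun k _ => hK1 k
  have s2 : 0 ≤ ∑ k, K2 k := sum_nonneg fun k _ => hK2 k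
  have s4 : 0 ≤ ∑ k, K4 k := sum_nonneg fun k _ => hK4 k
  have t1 : ∀ k, K1 k ≤ K := fun k => by
    have := single_le_sum (f := K1) (fun k _ => hK1 k) (mem_univ k)
    linarith
  have t2 : ∀ k, K2 k ≤ K := fun k => by
    have := single_le_sum (f := K2) (fun k _ => hK2 k) (mem_univ k)
    linarith
  have t4 : ∀ k, K4 k ≤ K := fun k => by
    have := single_le_sum (f := K4) (fun k _ => hK4 k) (mem_univ k)
    linarith
  refine ⟨R, lt_min hR1pos (lt_min (hr1 m) hr2), hRR1.trans hR11,
    (closedBall_subset_closedBall hRR1).trans hR1O, G, by positivity, min (d / 2) (e / 2),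
    by positivity, K, by positivity, ?_⟩
  constructor
  · intro x hx p
    have hx0 := norm_pos_of_mem_pb hx
    have hmain := principal_gradient_form hg hα hδ hx p
    have hcl : ∀ j k, _ := fun j k => hr1' (j, k) x (hsub hx) (hx.2.trans_le
      ((min_le_right _ _).trans ((min_le_left _ _).trans (hm (j, k) (mem_univ _)))))
    simp only [sub_zero] at hcl
    have hρ : 0 < ‖x‖ ^ (-α - 2) := by positivity
    generalize ‖x‖ ^ (-α - 2) = ρ at *
    have key : ∀ A A0 : Fin 3 → Fin 3 → ℝ, (∀ j k, |A j k - A0 j k| ≤ d / 18 * ρ) →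
        d * ρ * ∑ i, p i ^ 2 ≤ ∑ j, ∑ k, A0 j k * p j * p k →
        d / 2 * ρ * ∑ i, p i ^ 2 ≤ ∑ j, ∑ k, A j k * p j * p k := by
      intro A A0 hAA h0
      have h2 : ∀ j k, A0 j k * p j * p k - d / 18 * ρ * ((p j ^ 2 + p k ^ 2) / 2) ≤
          A j k * p j * p k := by
        intro j k
        have h3 := abs_le.1 (hAA j k)
        have h4 : |(A0 j k - A j k) * (p j * p k)| ≤ d / 18 * ρ * ((p j ^ 2 + p k ^ 2) / 2) := by
          rw [abs_mul]
          refine mul_le_mul (abs_sub_comm (A j k) _ ▸ hAA j k) ?_ (abs_nonneg _) (by positivity)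
          rw [abs_le]; constructor <;> nlinarith [sq_nonneg (p j + p k), sq_nonneg (p j - p k)]
        have h5 := (abs_le.1 h4).2
        nlinarith
      have h6 := sum_le_sum fun (j : Fin 3) (_ : j ∈ Finset.univ) =>
        sum_le_sum fun (k : Fin 3) (_ : k ∈ Finset.univ) => h2 j k
      refine le_trans ?_ h6
      simp only [sum_sub_distrib]
      have h7 : ∑ j : Fin 3, ∑ k : Fin 3, d / 18 * ρ * ((p j ^ 2 + p k ^ 2) / 2) =
          d / 6 * ρ * ∑ i, p i ^ 2 := by
        simp only [Fin.sum_univ_three]; ring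
      rw [h7]
      have h8 : 0 ≤ d * ρ * ∑ i, p i ^ 2 :=
        mul_nonneg (by positivity) (sum_nonneg fun _ _ => sq_nonneg _)
      nlinarith
    refine le_trans ?_ (key _ _ hcl hmain)
    refine mul_le_mul_of_nonneg_right (mul_le_mul_of_nonneg_right (min_le_left _ _) hρ.le)
      (sum_nonneg fun _ _ => sq_nonneg _)
  · intro x hx
    have hx0 := norm_pos_of_mem_pb hx
    have hmain := principal_zero_form hg hα hps hx
    have hcl := hr2' x (hsub hx) (hx.2.trans_le ((min_le_right _ _).trans (min_le_right _ _)))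
    have h3 := (abs_le.1 hcl).1
    have hρ : 0 < ‖x‖ ^ (-3 * α - 4) := by positivity
    have h4 : min (d / 2) (e / 2) * ‖x‖ ^ (-3 * α - 4) ≤ e / 2 * ‖x‖ ^ (-3 * α - 4) :=
      mul_le_mul_of_nonneg_right (min_le_right _ _) hρ.le
    rw [← he, ← hG] at hmain
    linarith
  · intro x hx k
    exact (hK1' k x (hsub hx)).trans (mul_le_mul_of_nonneg_right (t1 k) (by positivity))
  · intro x hx k
    have := hK2' k x (hsub hx)
    rw [Real.rpow_zero, mul_one] at this
    exact this.trans (t2 k)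
  · intro x hx
    exact (hK3' x (hsub hx)).trans (mul_le_mul_of_nonneg_right (by linarith) (by positivity))
  · intro x hx k
    exact (hK4' k x (hsub hx)).trans (mul_le_mul_of_nonneg_right (t4 k) (by positivity))

end

section

/-- The exponential Carleman weight. -/
def ew (α τ : ℝ) (x : E3) : ℝ := Real.exp (τ * wt α x)

/-- The left-hand density in the second-order Carleman estimate. -/
def cden (α τ : ℝ) (v : E3 → ℝ) (x : E3) : ℝ :=
  τ * ‖x‖ ^ (-α - 2) * gsq v x + τ ^ 3 * ‖x‖ ^ (-3 * α - 4) * v x ^ 2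

lemma Sm.norm_rpow (R p : ℝ) : Sm (pb R) (fun x => ‖x‖ ^ p) := (PdOn.norm_rpow R p 0).1

lemma pdOn_ew (R α τ : ℝ) (i : Fin 3) :
    PdOn (pb R) i (ew α τ) (fun x => ew α τ x * (τ * pd i (wt α) x)) :=
  (((pdOn_wt R α i).1.pdOn i).const_mul (isOpen_pb R) τ).comp (isOpen_pb R) (φ := Real.exp)
    (φ' := Real.exp) (s := Set.univ)
    (fun y _ => ⟨Real.contDiff_exp.contDiffAt, Real.hasDerivAt_exp y⟩) (fun _ _ => trivial)

lemma ew_pos (α τ : ℝ) (x : E3) : 0 < ew α τ x := Real.exp_pos _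

lemma TF.cden {R α τ : ℝ} {v : E3 → ℝ} (hv : TF (pb R) v) : TF (pb R) (cden α τ v) :=
  (hv.gsq.smul (isOpen_pb R) ((Sm.const τ).mul (Sm.norm_rpow R _))).add
    (hv.sq.smul (isOpen_pb R) ((Sm.const (τ ^ 3)).mul (Sm.norm_rpow R _)))

lemma Sm.wtX {O : Set E3} {R : ℝ} {b : Fin 3 → Fin 3 → E3 → ℝ} (hb : ∀ j k, Sm O (b j k))
    (h : pb R ⊆ O) (α : ℝ) (i : Fin 3) : Sm (pb R) (wtX b α i) :=
  Sm.sum fun k _ => ((hb i k).mono h).mul ((pdOn_wt R α k).1.pd (isOpen_pb R) k)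

lemma Sm.wtQ {O : Set E3} {R : ℝ} {b : Fin 3 → Fin 3 → E3 → ℝ} (hb : ∀ j k, Sm O (b j k))
    (h : pb R ⊆ O) (α : ℝ) : Sm (pb R) (wtQ b α) :=
  Sm.sum fun i _ => Sm.sum fun k _ =>
      (((hb i k).mono h).mul ((pdOn_wt R α k).1.pd (isOpen_pb R) k)).mul
    ((pdOn_wt R α i).1.pd (isOpen_pb R) i)

lemma rpow_le_rpow_of_unit {r p q : ℝ} (h0 : 0 < r) (h1 : r ≤ 1) (h : q ≤ p) : r ^ p ≤ r ^ q :=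
  Real.rpow_le_rpow_of_exponent_ge h0 h1 h

lemma abs_mul_le_of_sq_le {c K a z m : ℝ} (hc : 0 < c) (ha : 0 ≤ a) (hz : 0 ≤ z)
    (h : m ^ 2 ≤ K ^ 2 * (a * z)) (p v : ℝ) :
    |p * m * v| ≤ c / 2 * a * p ^ 2 + K ^ 2 / (2 * c) * z * v ^ 2 := by
  have hp : 0 ≤ c / 2 * a * p ^ 2 := by positivity
  have hv : 0 ≤ K ^ 2 / (2 * c) * z * v ^ 2 := by positivity
  refine abs_le_of_sq_le_sq ?_ (by positivity)
  have h1 : (p * m * v) ^ 2 ≤ K ^ 2 * (a * z) * (p ^ 2 * v ^ 2) := by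
    have := mul_le_mul_of_nonneg_right h (by positivity : 0 ≤ p ^ 2 * v ^ 2)
    linarith [this, (by ring : (p * m * v) ^ 2 = m ^ 2 * (p ^ 2 * v ^ 2))]
  have h2 : 4 * (c / 2 * a * p ^ 2) * (K ^ 2 / (2 * c) * z * v ^ 2) =
      K ^ 2 * (a * z) * (p ^ 2 * v ^ 2) := by field_simp; ring
  nlinarith [sq_nonneg (c / 2 * a * p ^ 2 - K ^ 2 / (2 * c) * z * v ^ 2)]

section
variable {b : Fin 3 → Fin 3 → E3 → ℝ} {O : Set E3} {α G c K R τ : ℝ} {v : E3 → ℝ}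

lemma CommBounds.commForm_ge (h : CommBounds b α G c K R) (hb : ∀ j k, Sm O (b j k))
    (hRO : pb R ⊆ O) (hR1 : R ≤ 1) (hα : 0 < α) (hc : 0 < c) (hτ1 : 1 ≤ τ)
    (hτ : 3 * K ^ 2 / c ^ 2 ≤ τ) {x : E3} (hx : x ∈ pb R) :
    c / 2 * cden α τ v x ≤ commForm b (fun i y => τ * wtX b α i y) (fun y => τ ^ 2 * wtQ b α y)
      (fun y => τ * (G * ‖y‖ ^ (-α - 2)))
      (fun y => τ * ((∑ i, pd i (wtX b α i) y) + G * ‖y‖ ^ (-α - 2))) v x := by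
  have hO := isOpen_pb R
  have hx0 := norm_pos_of_mem_pb hx
  have hX := fun i => Sm.wtX hb hRO α i
  have d1 : ∀ i k, pd i (fun y => τ * wtX b α k y) x = τ * pd i (wtX b α k) x := fun i k =>
    (((hX k).pdOn i).const_mul hO τ).2 x hx
  have d2 : ∀ i, pd i (fun y => τ ^ 2 * wtQ b α y) x = τ ^ 2 * pd i (wtQ b α) x := fun i =>
    (((Sm.wtQ hb hRO α).pdOn i).const_mul hO _).2 x hx
  have hH : Sm (pb R) (fun y => (∑ i, pd i (wtX b α i) y) + G * ‖y‖ ^ (-α - 2)) :=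
    (Sm.sum fun i _ => (hX i).pd hO i).add ((Sm.const G).mul (Sm.norm_rpow R _))
  have d3 : ∀ i, pd i (fun y => τ * ((∑ i, pd i (wtX b α i) y) + G * ‖y‖ ^ (-α - 2))) x =
      τ * pd i (fun y => (∑ i, pd i (wtX b α i) y) + G * ‖y‖ ^ (-α - 2)) x := fun i =>
    ((hH.pdOn i).const_mul hO _).2 x hx
  have h1 := h.grad x hx (fun i => pd i v x)
  have h2 := h.zero x hx
  have h3 := h.mixed x hx
  unfold commForm cden gsq
  simp only [d1, d2, d3]
  generalize (fun y => (∑ i, pd i (wtX b α i) y) + G * ‖y‖ ^ (-α - 2)) = H at *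
  have e : (∑ j, ∑ k, (2 * ∑ i, b i j x * (τ * pd i (wtX b α k) x) +
      τ * (G * ‖x‖ ^ (-α - 2)) * b j k x
        - ∑ l, τ * wtX b α l x * pd l (b j k) x) * pd j v x * pd k v x) +
      (∑ j, ∑ k, b j k x * pd k v x * (τ * pd j H x)) * v x +
      ((∑ l, τ * wtX b α l x * (τ ^ 2 * pd l (wtQ b α) x)) -
        τ ^ 2 * wtQ b α x * (τ * (G * ‖x‖ ^ (-α - 2)))) * v x ^ 2 =
      τ * (∑ j, ∑ k, (2 * (∑ i, b i j x * pd i (wtX b α k) x) + (G * ‖x‖ ^ (-α - 2)) * b j k x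
        - ∑ l, wtX b α l x * pd l (b j k) x) * pd j v x * pd k v x)
      + τ * (∑ k, pd k v x * (∑ j, b j k x * pd j H x) * v x)
      + τ ^ 3 * ((∑ l, wtX b α l x * pd l (wtQ b α) x) - wtQ b α x * (G * ‖x‖ ^ (-α - 2))) *
        v x ^ 2 := by
    simp only [Fin.sum_univ_three]; ring
  rw [e]
  have hz : 0 < ‖x‖ ^ (-3 * α - 4) := by positivity
  have ha : 0 < ‖x‖ ^ (-α - 2) := by positivity
  have h4 : ∀ k, |pd k v x * (∑ j, b j k x * pd j H x) * v x| ≤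
      c / 2 * ‖x‖ ^ (-α - 2) * pd k v x ^ 2 + K ^ 2 / (2 * c) * ‖x‖ ^ (-3 * α - 4) * v x ^ 2 := by
    intro k
    refine abs_mul_le_of_sq_le hc ha.le hz.le ?_ _ _
    calc (∑ j, b j k x * pd j H x) ^ 2 = |∑ j, b j k x * pd j H x| ^ 2 := (sq_abs _).symm
      _ ≤ (K * ‖x‖ ^ (-α - 3)) ^ 2 := by gcongr; exact h3 k
      _ = K ^ 2 * ‖x‖ ^ (-2 * α - 6) := by
          rw [mul_pow, ← Real.rpow_natCast (‖x‖ ^ (-α - 3)), ← Real.rpow_mul hx0.le]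
          congr 2; push_cast; ring
      _ ≤ K ^ 2 * (‖x‖ ^ (-α - 2) * ‖x‖ ^ (-3 * α - 4)) := by
          rw [← Real.rpow_add hx0]
          refine mul_le_mul_of_nonneg_left ?_ (sq_nonneg K)
          exact rpow_le_rpow_of_unit hx0 (hx.2.le.trans hR1) (by linarith)
  have h5 : -(c / 2 * ‖x‖ ^ (-α - 2) * (∑ k, pd k v x ^ 2)
      + 3 * (K ^ 2 / (2 * c) * ‖x‖ ^ (-3 * α - 4) * v x ^ 2)) ≤
      ∑ k, pd k v x * (∑ j, b j k x * pd j H x) * v x := by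
    have h6 := sum_le_sum fun (k : Fin 3) (_ : k ∈ Finset.univ) => (abs_le.1 (h4 k)).1
    refine le_trans (le_of_eq ?_) h6
    simp only [Fin.sum_univ_three]; ring
  have hV : 0 ≤ v x ^ 2 := sq_nonneg _
  generalize ∑ k, pd k v x * (∑ j, b j k x * pd j H x) * v x = M at *
  generalize ∑ j, ∑ k, (2 * (∑ i, b i j x * pd i (wtX b α k) x) + (G * ‖x‖ ^ (-α - 2)) * b j k x
        - ∑ l, wtX b α l x * pd l (b j k) x) * pd j v x * pd k v x = A at *
  generalize (∑ l, wtX b α l x * pd l (wtQ b α) x) - wtQ b α x * (G * ‖x‖ ^ (-α - 2)) = Z at *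
  generalize ‖x‖ ^ (-α - 2) = a at *
  generalize ‖x‖ ^ (-3 * α - 4) = z at *
  generalize (∑ k, pd k v x ^ 2) = P at *
  generalize v x ^ 2 = V at *
  have g1 := mul_le_mul_of_nonneg_left h1 (by linarith : 0 ≤ τ)
  have g2 := mul_le_mul_of_nonneg_right (mul_le_mul_of_nonneg_left h2 (by positivity : 0 ≤ τ ^ 3))
      hV
  have g5 := mul_le_mul_of_nonneg_left h5 (by linarith : 0 ≤ τ)
  have g6 : τ * (3 * (K ^ 2 / (2 * c) * z * V)) ≤ c / 2 * (τ ^ 3 * z * V) := by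
    have : 3 * K ^ 2 ≤ τ ^ 2 * c ^ 2 := by
      rw [div_le_iff₀ (by positivity)] at hτ
      nlinarith [mul_le_mul_of_nonneg_right (by nlinarith : τ ≤ τ ^ 2) (sq_nonneg c)]
    have e1 : c / 2 * (τ ^ 3 * z * V) - τ * (3 * (K ^ 2 / (2 * c) * z * V)) =
      (τ ^ 2 * c ^ 2 - 3 * K ^ 2) * (τ * z * V / (2 * c)) := by field_simp
    have : 0 ≤ (τ ^ 2 * c ^ 2 - 3 * K ^ 2) * (τ * z * V / (2 * c)) :=
      mul_nonneg (by linarith) (by positivity)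
    linarith
  nlinarith

end

end

section

section
variable {b : Fin 3 → Fin 3 → E3 → ℝ} {O : Set E3} {α G c K R τ : ℝ} {u v : E3 → ℝ}

lemma sq_error_le {τ G K c a z v B β g : ℝ} (hc : 0 < c) (hτ1 : 1 ≤ τ)
    (h1 : 6 * (G ^ 2 + K ^ 2) / c ≤ τ) (h2 : 18 * K ^ 2 / c ≤ τ) (ha : 1 ≤ a) (haz : a ^ 2 ≤ z)
    (hB : B ^ 2 ≤ K ^ 2 * z) (hβ : β ^ 2 ≤ 3 * (K ^ 2 * g)) (hg : 0 ≤ g) :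
    (τ * (G * a) * v - β + τ * B * v) ^ 2 ≤ c / 2 * (τ * a * g + τ ^ 3 * z * v ^ 2) := by
  rw [div_le_iff₀ hc] at h1 h2
  have e1 : (τ * (G * a) * v - β + τ * B * v) ^ 2 ≤
      3 * ((τ * (G * a) * v) ^ 2 + β ^ 2 + (τ * B * v) ^ 2) := by
    nlinarith [sq_nonneg (τ * (G * a) * v + β), sq_nonneg (τ * (G * a) * v - τ * B * v),
      sq_nonneg (β + τ * B * v)]
  have e2 : (τ * (G * a) * v) ^ 2 ≤ G ^ 2 * (z * (τ ^ 2 * v ^ 2)) := by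
    have := mul_le_mul_of_nonneg_left haz (by positivity : 0 ≤ G ^ 2 * (τ ^ 2 * v ^ 2))
    linarith
  have e3 : (τ * B * v) ^ 2 ≤ K ^ 2 * (z * (τ ^ 2 * v ^ 2)) := by
    have := mul_le_mul_of_nonneg_left hB (by positivity : 0 ≤ (τ ^ 2 * v ^ 2))
    linarith
  have hz : 0 ≤ z := (sq_nonneg a).trans haz
  have e4 := mul_le_mul_of_nonneg_right h1 (by positivity : 0 ≤ z * (τ ^ 2 * v ^ 2))
  have e5 : 18 * (K ^ 2 * g) ≤ c * (τ * a * g) := by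
    have := mul_le_mul_of_nonneg_right h2 hg
    have h6 := mul_le_mul_of_nonneg_left ha (by positivity : 0 ≤ τ * c * g)
    linarith
  linarith

lemma sub_error_le {A S M E X : ℝ} (h : A = S - M + E) (hE : E ^ 2 ≤ X) :
    2 * -(S * M) - X ≤ A ^ 2 := by
  subst h
  nlinarith [sq_nonneg (S + E), sq_nonneg (M - E)]

/-- The Carleman estimate for the conjugated function `v = e^φ u`. -/
lemma CommBounds.integral_cden_le (h : CommBounds b α G c K R) (hb : ∀ j k, Sm O (b j k))
    (hsym : ∀ j k, ∀ x ∈ O, b j k x = b k j x)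
    (hRO : pb R ⊆ O) (hR1 : R ≤ 1) (hα : 0 < α) (hc : 0 < c) (hτ1 : 1 ≤ τ)
    (hτ : 3 * K ^ 2 / c ^ 2 ≤ τ) (h1 : 6 * (G ^ 2 + K ^ 2) / c ≤ τ) (h2 : 18 * K ^ 2 / c ≤ τ)
    (hu : TF (pb R) u) :
    c / 2 * ∫ x, cden α τ (fun y => ew α τ y * u y) x ≤ ∫ x, (ew α τ x * op2 b u x) ^ 2 := by
  have hO := isOpen_pb R
  have hew : Sm (pb R) (ew α τ) := (pdOn_ew R α τ 0).1
  have hbR := fun j k => (hb j k).mono hRO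
  have hsymR := fun j k x (hx : x ∈ pb R) => hsym j k x (hRO hx)
  have hv : TF (pb R) (fun y => ew α τ y * u y) := hu.smul hO hew
  have hX : ∀ i, Sm (pb R) (fun y => τ * wtX b α i y) := fun i =>
    (Sm.const τ).mul (Sm.wtX hb hRO α i)
  have hq : Sm (pb R) (fun y => τ ^ 2 * wtQ b α y) := (Sm.const _).mul (Sm.wtQ hb hRO α)
  have hg : Sm (pb R) (fun y => τ * (G * ‖y‖ ^ (-α - 2))) :=
    (Sm.const _).mul ((Sm.const G).mul (Sm.norm_rpow R _))
  have hh : Sm (pb R) (fun y => τ * ((∑ i, pd i (wtX b α i) y) + G * ‖y‖ ^ (-α - 2))) :=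
    (Sm.const _).mul ((Sm.sum fun i _ => (Sm.wtX hb hRO α i).pd hO i).add
      ((Sm.const G).mul (Sm.norm_rpow R _)))
  have dX : ∀ i, ∀ x ∈ pb R, pd i (fun y => τ * wtX b α i y) x = τ * pd i (wtX b α i) x :=
    fun i x hx => (((Sm.wtX hb hRO α i).pdOn i).const_mul hO τ).2 x hx
  have hI := integral_commForm hO hbR hsymR hX hq hh (g := fun y => τ * (G * ‖y‖ ^ (-α - 2)))
    (fun x hx => by simp only [dX _ x hx, ← mul_sum]; ring) hv
  have hC := TF.commForm hO hbR hX hq hg hh hv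
  have hS := ((hv.divOp hO hbR).add (hv.smul hO hq)).mul (hv.skewOp hO hX hh)
  have hP : TF (pb R) (fun x => (ew α τ x * op2 b u x) ^ 2) := ((hu.op2 hO hbR).smul hO hew).sq
  have hden := hv.cden (α := α) (τ := τ)
  have m1 : c / 2 * ∫ x, cden α τ (fun y => ew α τ y * u y) x ≤
      ∫ x, commForm b (fun i y => τ * wtX b α i y) (fun y => τ ^ 2 * wtQ b α y)
      (fun y => τ * (G * ‖y‖ ^ (-α - 2)))
      (fun y => τ * ((∑ i, pd i (wtX b α i) y) + G * ‖y‖ ^ (-α - 2))) (fun y => ew α τ y * u y)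
          x := by
    rw [← integral_const_mul]
    refine TF.integral_mono (hden.const_mul _) hC fun x => ?_
    by_cases hx : x ∈ pb R
    · exact h.commForm_ge hb hRO hR1 hα hc hτ1 hτ hx
    · rw [hC.zero_of_notMem hx, hden.zero_of_notMem hx, mul_zero]
  have m2 : ∫ x, (2 * -((divOp b (fun y => ew α τ y * u y) x + τ ^ 2 * wtQ b α x *
      (ew α τ x * u x)) * skewOp (fun i y => τ * wtX b α i y)
      (fun y => τ * ((∑ i, pd i (wtX b α i) y) + G * ‖y‖ ^ (-α - 2))) (fun y => ew α τ y * u y) x)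
      - c / 2 * cden α τ (fun y => ew α τ y * u y) x) ≤ ∫ x, (ew α τ x * op2 b u x) ^ 2 := by
    refine TF.integral_mono (TF.sub' (hS.neg.const_mul 2) (hden.const_mul _)) hP fun x => ?_
    by_cases hx : x ∈ pb R
    · have hx0 := norm_pos_of_mem_pb hx
      have hx1 := hx.2.le.trans hR1
      have hwt : Sm (pb R) (wt α) := (pdOn_wt R α 0).1
      have dφ : ∀ k, ∀ x ∈ pb R, pd k (fun y => τ * wt α y) x = τ * pd k (wt α) x :=
        fun k x hx => ((hwt.pdOn k).const_mul hO τ).2 x hx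
      have hconj := conjugation hO hbR hsymR ((Sm.const τ).mul hwt) (hu.sm _) hx
      have d2 : ∀ i, pd i (fun y => ∑ k, b i k y * pd k (fun y => τ * wt α y) y) x =
          τ * pd i (wtX b α i) x := fun i => by
        rw [← dX i x hx]
        refine pd_congr hO (fun y hy => ?_) i hx
        simp only [dφ _ y hy, wtX, mul_sum]
        exact sum_congr rfl fun k _ => by ring
      simp only [d2, dφ _ x hx] at hconj
      have hE := sq_error_le (v := ew α τ x * u x)
        (B := ∑ k, (∑ j, pd j (b j k) x) * pd k (wt α) x)
        (β := ∑ k, (∑ j, pd j (b j k) x) * pd k (fun y => ew α τ y * u y) x)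
        (g := gsq (fun y => ew α τ y * u y) x) (a := ‖x‖ ^ (-α - 2)) (z := ‖x‖ ^ (-3 * α - 4))
        hc hτ1 h1 h2 (Real.one_le_rpow_of_pos_of_le_one_of_nonpos hx0 hx1 (by linarith))
        (by rw [← Real.rpow_natCast, ← Real.rpow_mul hx0.le]
            exact rpow_le_rpow_of_unit hx0 hx1 (by push_cast; linarith))
        (by rw [← sq_abs]
            calc _ ≤ (K * ‖x‖ ^ (-α - 1)) ^ 2 := by gcongr; exact h.drift_wt x hx
              _ = K ^ 2 * ‖x‖ ^ (-2 * α - 2) := by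
                  rw [mul_pow, ← Real.rpow_natCast (‖x‖ ^ (-α - 1)), ← Real.rpow_mul hx0.le]
                  congr 2; push_cast; ring
              _ ≤ _ := mul_le_mul_of_nonneg_left
                  (rpow_le_rpow_of_unit hx0 hx1 (by linarith)) (sq_nonneg K))
        (by refine (sq_sum_le_card_mul_sum_sq).trans ?_
            simp only [card_univ, Fintype.card_fin, Nat.cast_ofNat]
            unfold gsq
            rw [mul_sum (f := fun i => pd i (fun y => ew α τ y * u y) x ^ 2)]
            refine mul_le_mul_of_nonneg_left (sum_le_sum fun k _ => ?_) (by norm_num)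
            rw [mul_pow]
            refine mul_le_mul_of_nonneg_right ?_ (sq_nonneg _)
            rw [← sq_abs]
            exact pow_le_pow_left₀ (abs_nonneg _) (h.drift x hx k) 2)
        (gsq_nonneg _ _)
      have e : ew α τ x * op2 b u x = (divOp b (fun y => ew α τ y * u y) x + τ ^ 2 * wtQ b α x *
          (ew α τ x * u x)) - skewOp (fun i y => τ * wtX b α i y)
          (fun y => τ * ((∑ i, pd i (wtX b α i) y) + G * ‖y‖ ^ (-α - 2)))
          (fun y => ew α τ y * u y) x
          + (τ * (G * ‖x‖ ^ (-α - 2)) * (ew α τ x * u x)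
          - (∑ k, (∑ j, pd j (b j k) x) * pd k (fun y => ew α τ y * u y) x)
          + τ * (∑ k, (∑ j, pd j (b j k) x) * pd k (wt α) x) * (ew α τ x * u x)) := by
        unfold skewOp
        unfold ew
        rw [hconj]
        unfold wtQ wtX
        simp only [Fin.sum_univ_three]
        ring
      exact sub_error_le e hE
    · have := hS.zero_of_notMem hx
      rw [this, hP.zero_of_notMem hx, hden.zero_of_notMem hx]; simp
  rw [integral_sub (hS.neg.const_mul 2).integrable (hden.const_mul _).integrable,
    integral_const_mul, integral_const_mul, ← hI] at m2
  linarith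

end

end

section

/-- `m` is a positive multiplier whose logarithmic derivatives are controlled by `θ`. -/
structure Mlt (R : ℝ) (m θ : E3 → ℝ) : Prop where
  sm : Sm (pb R) m
  pos : ∀ x ∈ pb R, 0 < m x
  nonneg : ∀ x ∈ pb R, 0 ≤ θ x
  one : ∀ x ∈ pb R, ∀ k, |pd k m x| ≤ θ x * m x
  two : ∀ x ∈ pb R, ∀ j k, |pd j (pd k m) x| ≤ θ x ^ 2 * m x

section
variable {R : ℝ} {m m' θ θ' u : E3 → ℝ} {b : Fin 3 → Fin 3 → E3 → ℝ} {B : ℝ} {x : E3}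

lemma Mlt.mono (h : Mlt R m θ) (hθ : ∀ x ∈ pb R, θ x ≤ θ' x) : Mlt R m θ' where
  sm := h.sm
  pos := h.pos
  nonneg x hx := (h.nonneg x hx).trans (hθ x hx)
  one x hx k := (h.one x hx k).trans (mul_le_mul_of_nonneg_right (hθ x hx) (h.pos x hx).le)
  two x hx j k := (h.two x hx j k).trans (mul_le_mul_of_nonneg_right
    (pow_le_pow_left₀ (h.nonneg x hx) (hθ x hx) 2) (h.pos x hx).le)

lemma pd_pd_mul {O : Set E3} (hO : IsOpen O) (hm : Sm O m) (hu : Sm O u) (hx : x ∈ O)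
    (j k : Fin 3) :
    pd j (pd k (fun y => m y * u y)) x = pd j (pd k m) x * u x + pd k m x * pd j u x
      + (pd j m x * pd k u x + m x * pd j (pd k u) x) := by
  have h1 := fun k => (hm.pdOn k).mul hO (hu.pdOn k)
  refine (pd_congr hO (fun y hy => (h1 k).2 y hy) j hx).trans ?_
  exact ((((hm.pd hO k).pdOn j).mul hO (hu.pdOn j)).add hO
    ((hm.pdOn j).mul hO ((hu.pd hO k).pdOn j))).2 x hx

lemma Mlt.mul (h : Mlt R m θ) (h' : Mlt R m' θ') :
    Mlt R (fun x => m x * m' x) (fun x => θ x + θ' x) where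
  sm := h.sm.mul h'.sm
  pos x hx := mul_pos (h.pos x hx) (h'.pos x hx)
  nonneg x hx := add_nonneg (h.nonneg x hx) (h'.nonneg x hx)
  one x hx k := by
    rw [((h.sm.pdOn k).mul (isOpen_pb R) (h'.sm.pdOn k)).2 x hx]
    refine (abs_add_le _ _).trans ?_
    rw [abs_mul, abs_mul, abs_of_pos (h.pos x hx), abs_of_pos (h'.pos x hx)]
    have := mul_le_mul_of_nonneg_right (h.one x hx k) (h'.pos x hx).le
    have := mul_le_mul_of_nonneg_left (h'.one x hx k) (h.pos x hx).le
    linarith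
  two x hx j k := by
    rw [pd_pd_mul (isOpen_pb R) h.sm h'.sm hx]
    have p := h.pos x hx
    have p' := h'.pos x hx
    have a1 : |pd j (pd k m) x * m' x| ≤ θ x ^ 2 * m x * m' x := by
      rw [abs_mul, abs_of_pos p']; exact mul_le_mul_of_nonneg_right (h.two x hx j k) p'.le
    have a2 : |m x * pd j (pd k m') x| ≤ m x * (θ' x ^ 2 * m' x) := by
      rw [abs_mul, abs_of_pos p]; exact mul_le_mul_of_nonneg_left (h'.two x hx j k) p.le
    have a3 : ∀ j k, |pd k m x * pd j m' x| ≤ (θ x * m x) * (θ' x * m' x) := fun j k => by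
      rw [abs_mul]
      exact mul_le_mul (h.one x hx k) (h'.one x hx j) (abs_nonneg _)
        (mul_nonneg (h.nonneg x hx) p.le)
    have b1 := abs_add_le (pd j (pd k m) x * m' x + pd k m x * pd j m' x)
      (pd j m x * pd k m' x + m x * pd j (pd k m') x)
    have b2 := abs_add_le (pd j (pd k m) x * m' x) (pd k m x * pd j m' x)
    have b3 := abs_add_le (pd j m x * pd k m' x) (m x * pd j (pd k m') x)
    nlinarith [a3 j k, a3 k j]

lemma Mlt.norm_rpow (hR : R ≤ 1) (q : ℝ) : ∃ L ≥ 0,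
    Mlt R (fun x => ‖x‖ ^ q) (fun x => L * ‖x‖ ^ (-1 : ℝ)) := by
  have hs := Sy.norm_rpow hR q
  choose C1 hC1 hC1' using fun k => (hs.pd k).bound
  choose C2 hC2 hC2' using fun jk : Fin 3 × Fin 3 => ((hs.pd jk.2).pd jk.1).bound
  have i1 : ∀ k, C1 k ≤ ∑ k, C1 k := fun k => single_le_sum (fun i _ => hC1 i) (mem_univ k)
  have i2 : ∀ k, C2 k ≤ ∑ k, C2 k := fun k => single_le_sum (fun i _ => hC2 i) (mem_univ k)
  have n1 : 0 ≤ ∑ k, C1 k := sum_nonneg fun i _ => hC1 i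
  have n2 : 0 ≤ ∑ k, C2 k := sum_nonneg fun i _ => hC2 i
  refine ⟨1 + ∑ k, C1 k + ∑ k, C2 k, by positivity, hs.1, fun x hx => ?_, fun x hx => ?_,
    fun x hx k => ?_, fun x hx j k => ?_⟩
  · have := norm_pos_of_mem_pb hx; positivity
  · have := norm_pos_of_mem_pb hx; positivity
  · have h0 := norm_pos_of_mem_pb hx
    refine (hC1' k x hx).trans ?_
    rw [mul_assoc, ← Real.rpow_add h0, show (-1 : ℝ) + q = q - 1 by ring]
    refine mul_le_mul_of_nonneg_right ?_ (by positivity)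
    linarith [i1 k]
  · have h0 := norm_pos_of_mem_pb hx
    refine (hC2' (j, k) x hx).trans ?_
    rw [mul_pow, mul_assoc, ← Real.rpow_natCast (‖x‖ ^ (-1 : ℝ)), ← Real.rpow_mul h0.le,
      ← Real.rpow_add h0]
    rw [show (-1 : ℝ) * ((2 : ℕ) : ℝ) + q = q - 1 - 1 by push_cast; ring]
    refine mul_le_mul_of_nonneg_right ?_ (by positivity)
    nlinarith [i2 (j, k)]

lemma Mlt.ew {α : ℝ} (hR : R ≤ 1) (hα : 0 < α) :
    ∃ L ≥ 0, ∀ τ ≥ 1, Mlt R (ew α τ) (fun x => τ * (L * ‖x‖ ^ (-α - 1))) := by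
  choose C1 hC1 hC1' using fun k => (Sy.pd_wt hR α k).bound
  choose C2 hC2 hC2' using fun jk : Fin 3 × Fin 3 => ((Sy.pd_wt hR α jk.2).pd jk.1).bound
  have i1 : ∀ k, C1 k ≤ ∑ k, C1 k := fun k => single_le_sum (fun i _ => hC1 i) (mem_univ k)
  have i2 : ∀ k, C2 k ≤ ∑ k, C2 k := fun k => single_le_sum (fun i _ => hC2 i) (mem_univ k)
  have n1 : 0 ≤ ∑ k, C1 k := sum_nonneg fun i _ => hC1 i
  have n2 : 0 ≤ ∑ k, C2 k := sum_nonneg fun i _ => hC2 i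
  set S1 := ∑ k, C1 k
  set S2 := ∑ k, C2 k
  have hO := isOpen_pb R
  refine ⟨1 + S1 + S2, by positivity, fun τ hτ => ⟨(pdOn_ew R α τ 0).1, fun x _ => ew_pos _ _ _,
    fun x hx => ?_, fun x hx k => ?_, fun x hx j k => ?_⟩⟩
  · have := norm_pos_of_mem_pb hx; positivity
  · have h0 := norm_pos_of_mem_pb hx
    rw [(pdOn_ew R α τ k).2 x hx, abs_mul, abs_of_pos (ew_pos _ _ _), mul_comm, abs_mul,
      abs_of_nonneg (by linarith : 0 ≤ τ)]
    refine mul_le_mul_of_nonneg_right (mul_le_mul_of_nonneg_left ((hC1' k x hx).trans ?_)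
      (by linarith)) (ew_pos _ _ _).le
    refine mul_le_mul_of_nonneg_right ?_ (by positivity)
    linarith [i1 k]
  · have h0 := norm_pos_of_mem_pb hx
    have hwt : Sm (pb R) (pd k (wt α)) := (pdOn_wt R α 0).1.pd hO k
    have e : pd j (pd k (_root_.ew α τ)) x = _ :=
      (pd_congr hO (fun y hy => (pdOn_ew R α τ k).2 y hy) j hx).trans
        (((pdOn_ew R α τ j).mul hO ((hwt.pdOn j).const_mul hO τ)).2 x hx)
    have hz : (‖x‖ ^ (-α - 1)) ^ 2 = ‖x‖ ^ (-2 * α - 2) := by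
      rw [← Real.rpow_natCast, ← Real.rpow_mul h0.le]; congr 1; push_cast; ring
    have a1 : ∀ k, |pd k (wt α) x| ≤ S1 * ‖x‖ ^ (-α - 1) := fun k =>
      (hC1' k x hx).trans (mul_le_mul_of_nonneg_right (i1 k) (by positivity))
    have a2 : |pd j (pd k (wt α)) x| ≤ S2 * ‖x‖ ^ (-2 * α - 2) :=
      (hC2' (j, k) x hx).trans (mul_le_mul (i2 (j, k))
        (rpow_le_rpow_of_unit h0 (hx.2.le.trans hR) (by linarith)) (by positivity) n2)
    have a3 : |pd j (wt α) x * pd k (wt α) x| ≤ S1 ^ 2 * ‖x‖ ^ (-2 * α - 2) := by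
      rw [abs_mul, ← hz, ← mul_pow, pow_two]
      exact mul_le_mul (a1 j) (a1 k) (abs_nonneg _) (by positivity)
    have e' : pd j (pd k (_root_.ew α τ)) x = (τ ^ 2 * (pd j (wt α) x * pd k (wt α) x)
        + τ * pd j (pd k (wt α)) x) * _root_.ew α τ x := by rw [e]; ring
    rw [e', abs_mul, abs_of_pos (ew_pos _ _ _)]
    refine mul_le_mul_of_nonneg_right ?_ (ew_pos _ _ _).le
    refine (abs_add_le _ _).trans ?_
    rw [abs_mul, abs_mul τ, abs_of_nonneg (by linarith : 0 ≤ τ), abs_of_nonneg (sq_nonneg τ),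
      mul_pow, mul_pow, hz]
    have hzp : 0 ≤ ‖x‖ ^ (-2 * α - 2) := by positivity
    generalize ‖x‖ ^ (-2 * α - 2) = z at *
    have b1 := mul_le_mul_of_nonneg_left a3 (sq_nonneg τ)
    have b2 := mul_le_mul_of_nonneg_left a2 (by linarith : 0 ≤ τ)
    have b3 : τ * (S2 * z) ≤ τ ^ 2 * (S2 * z) :=
      mul_le_mul_of_nonneg_right (by nlinarith) (by positivity)
    have b4 : S1 ^ 2 + S2 ≤ (1 + S1 + S2) ^ 2 := by nlinarith
    have b5 := mul_le_mul_of_nonneg_left b4 (by positivity : 0 ≤ τ ^ 2 * z)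
    linarith

end

end

section

section pointwise
variable {R : ℝ} {m θ u : E3 → ℝ} {b : Fin 3 → Fin 3 → E3 → ℝ} {B : ℝ} {x : E3}

lemma Mlt.gsq_le (h : Mlt R m θ) (hu : Sm (pb R) u) (hx : x ∈ pb R) :
    m x ^ 2 * gsq u x ≤ 2 * gsq (fun y => m y * u y) x + 6 * (θ x ^ 2 * (m x ^ 2 * u x ^ 2)) := by
  have e : ∀ k, m x ^ 2 * pd k u x ^ 2 ≤ 2 * pd k (fun y => m y * u y) x ^ 2
      + 2 * (θ x ^ 2 * (m x ^ 2 * u x ^ 2)) := by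
    intro k
    rw [((h.sm.pdOn k).mul (isOpen_pb R) (hu.pdOn k)).2 x hx]
    have h1 : pd k m x ^ 2 ≤ (θ x * m x) ^ 2 := by
      rw [← sq_abs]; exact pow_le_pow_left₀ (abs_nonneg _) (h.one x hx k) 2
    have h2 := mul_le_mul_of_nonneg_right h1 (sq_nonneg (u x))
    nlinarith [sq_nonneg (2 * (pd k m x * u x) + m x * pd k u x)]
  unfold gsq
  simp only [Fin.sum_univ_three] at *
  linarith [e 0, e 1, e 2]

lemma Mlt.err_sq_le (h : Mlt R m θ) (hx : x ∈ pb R) (j k : Fin 3) :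
    (pd j (pd k m) x * u x + pd k m x * pd j u x + pd j m x * pd k u x) ^ 2 ≤
    3 * (m x ^ 2 * (θ x ^ 4 * u x ^ 2 + θ x ^ 2 * pd j u x ^ 2 + θ x ^ 2 * pd k u x ^ 2)) := by
  have h1 : ∀ k, pd k m x ^ 2 ≤ (θ x * m x) ^ 2 := fun k => by
    rw [← sq_abs]; exact pow_le_pow_left₀ (abs_nonneg _) (h.one x hx k) 2
  have h2 : pd j (pd k m) x ^ 2 ≤ (θ x ^ 2 * m x) ^ 2 := by
    rw [← sq_abs]; exact pow_le_pow_left₀ (abs_nonneg _) (h.two x hx j k) 2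
  have a1 := mul_le_mul_of_nonneg_right h2 (sq_nonneg (u x))
  have a2 := mul_le_mul_of_nonneg_right (h1 k) (sq_nonneg (pd j u x))
  have a3 := mul_le_mul_of_nonneg_right (h1 j) (sq_nonneg (pd k u x))
  have e : ∀ p q r : ℝ, (p + q + r) ^ 2 ≤ 3 * (p ^ 2 + q ^ 2 + r ^ 2) := fun p q r => by
    nlinarith [sq_nonneg (p - q), sq_nonneg (p - r), sq_nonneg (q - r)]
  refine (e _ _ _).trans ?_
  nlinarith

lemma sum_pair_eq (a c : ℝ) (u : E3 → ℝ) :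
    ∑ j, ∑ k, (a + c * pd j u x ^ 2 + c * pd k u x ^ 2) = 9 * a + 6 * (c * gsq u x) := by
  unfold gsq
  simp only [Fin.sum_univ_three]; ring

lemma Mlt.op2_le (h : Mlt R m θ) (hu : Sm (pb R) u) (hB : ∀ j k, ∀ x ∈ pb R, |b j k x| ≤ B)
    (hx : x ∈ pb R) :
    op2 b (fun y => m y * u y) x ^ 2 ≤ 2 * (m x ^ 2 * op2 b u x ^ 2)
      + 486 * B ^ 2 * (m x ^ 2 * (θ x ^ 4 * u x ^ 2 + θ x ^ 2 * gsq u x)) := by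
  set D : Fin 3 → Fin 3 → ℝ := fun j k =>
    pd j (pd k m) x * u x + pd k m x * pd j u x + pd j m x * pd k u x with hD
  have e : op2 b (fun y => m y * u y) x = m x * op2 b u x + ∑ j, ∑ k, b j k x * D j k := by
    unfold op2
    rw [mul_sum, ← sum_add_distrib]
    refine sum_congr rfl fun j _ => ?_
    rw [mul_sum, ← sum_add_distrib]
    refine sum_congr rfl fun k _ => ?_
    rw [pd_pd_mul (isOpen_pb R) h.sm hu hx, hD]
    ring
  have a2 : ∀ j k, (b j k x * D j k) ^ 2 ≤ B ^ 2 * (3 * (m x ^ 2 *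
      (θ x ^ 4 * u x ^ 2 + θ x ^ 2 * pd j u x ^ 2 + θ x ^ 2 * pd k u x ^ 2))) := fun j k => by
    rw [mul_pow, ← sq_abs (b j k x)]
    exact mul_le_mul (pow_le_pow_left₀ (abs_nonneg _) (hB j k x hx) 2) (h.err_sq_le hx j k)
      (sq_nonneg _) (sq_nonneg _)
  have a1 : (∑ j, ∑ k, b j k x * D j k) ^ 2 ≤ 9 * ∑ j, ∑ k, (b j k x * D j k) ^ 2 := by
    have c1 := sq_sum_le_card_mul_sum_sq (s := Finset.univ)
      (f := fun j : Fin 3 => ∑ k, b j k x * D j k)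
    have c2 := sum_le_sum fun (j : Fin 3) (_ : j ∈ Finset.univ) =>
      sq_sum_le_card_mul_sum_sq (s := Finset.univ) (f := fun k : Fin 3 => b j k x * D j k)
    simp only [card_univ, Fintype.card_fin, Nat.cast_ofNat, ← mul_sum] at c1 c2
    linarith
  have a3 := sum_le_sum fun (j : Fin 3) (_ : j ∈ Finset.univ) =>
    sum_le_sum fun (k : Fin 3) (_ : k ∈ Finset.univ) => a2 j k
  simp only [← mul_sum, sum_pair_eq] at a3
  rw [e]
  have hg := gsq_nonneg u x
  have : 0 ≤ B ^ 2 * (m x ^ 2 * (θ x ^ 2 * gsq u x)) := by positivity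
  nlinarith [sq_nonneg (m x * op2 b u x - ∑ j, ∑ k, b j k x * D j k)]

lemma Mlt.hsq_le (h : Mlt R m θ) (hu : Sm (pb R) u) (hx : x ∈ pb R) :
    m x ^ 2 * hsq u x ≤ 2 * hsq (fun y => m y * u y) x
      + 54 * (m x ^ 2 * (θ x ^ 4 * u x ^ 2 + θ x ^ 2 * gsq u x)) := by
  have e : ∀ j k, m x ^ 2 * pd j (pd k u) x ^ 2 ≤ 2 * pd j (pd k (fun y => m y * u y)) x ^ 2 + 6 *
      (m x ^ 2 * (θ x ^ 4 * u x ^ 2 + θ x ^ 2 * pd j u x ^ 2 + θ x ^ 2 * pd k u x ^ 2)) := by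
    intro j k
    rw [pd_pd_mul (isOpen_pb R) h.sm hu hx]
    have := h.err_sq_le (u := u) hx j k
    nlinarith [sq_nonneg (2 * (pd j (pd k m) x * u x + pd k m x * pd j u x + pd j m x * pd k u x)
      + m x * pd j (pd k u) x)]
  have a3 := sum_le_sum fun (j : Fin 3) (_ : j ∈ Finset.univ) =>
    sum_le_sum fun (k : Fin 3) (_ : k ∈ Finset.univ) => e j k
  have e2 : ∀ v : E3 → ℝ, hsq v x = ∑ j, ∑ k, pd j (pd k v) x ^ 2 := fun v => by
    unfold hsq gsq; rw [sum_comm]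
  rw [e2, e2]
  have e3 := sum_pair_eq (x := x) (θ x ^ 4 * u x ^ 2) (θ x ^ 2) u
  have hg := gsq_nonneg u x
  have : 0 ≤ (m x ^ 2 * (θ x ^ 2 * gsq u x)) := by positivity
  have e4 := congrArg (fun t => m x ^ 2 * t) e3
  simp only [Fin.sum_univ_three] at a3 e4 ⊢
  linarith

end pointwise

/-- The weighted integral `∫ e^{2φ} f`. -/
def wint (α τ : ℝ) (f : E3 → ℝ) : ℝ := ∫ x, ew α τ x ^ 2 * f x

section
variable {R α τ : ℝ} {f g : E3 → ℝ}

lemma TF.ew_sq_mul (hf : TF (pb R) f) (α τ : ℝ) : TF (pb R) (fun x => ew α τ x ^ 2 * f x) :=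
  hf.smul (isOpen_pb R) ((pdOn_ew R α τ 0).1.pow 2)

lemma wint_mono (hf : TF (pb R) f) (hg : TF (pb R) g) (h : ∀ x ∈ pb R, f x ≤ g x) :
    wint α τ f ≤ wint α τ g := by
  refine TF.integral_mono (hf.ew_sq_mul α τ) (hg.ew_sq_mul α τ) fun x => ?_
  by_cases hx : x ∈ pb R
  · exact mul_le_mul_of_nonneg_left (h x hx) (sq_nonneg _)
  · rw [hf.zero_of_notMem hx, hg.zero_of_notMem hx]

lemma wint_add (hf : TF (pb R) f) (hg : TF (pb R) g) :
    wint α τ (fun x => f x + g x) = wint α τ f + wint α τ g := by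
  unfold wint
  rw [← integral_add (hf.ew_sq_mul α τ).integrable (hg.ew_sq_mul α τ).integrable]
  simp only [mul_add]

lemma wint_const_mul (c : ℝ) (f : E3 → ℝ) : wint α τ (fun x => c * f x) = c * wint α τ f := by
  unfold wint
  rw [← integral_const_mul]
  refine integral_congr_ae (Filter.Eventually.of_forall fun x => ?_)
  ring

lemma wint_nonneg (h : ∀ x, 0 ≤ f x) : 0 ≤ wint α τ f :=
  integral_nonneg fun x => mul_nonneg (sq_nonneg _) (h x)

lemma wint_sum {ι : Type*} {s : Finset ι} {F : ι → E3 → ℝ} (hF : ∀ i ∈ s, TF (pb R) (F i)) :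
    wint α τ (fun x => ∑ i ∈ s, F i x) = ∑ i ∈ s, wint α τ (F i) := by
  unfold wint
  rw [← integral_finsetSum _ fun i hi => ((hF i hi).ew_sq_mul α τ).integrable]
  simp only [mul_sum]

lemma TF.rpow_mul (hf : TF (pb R) f) (p : ℝ) : TF (pb R) (fun x => ‖x‖ ^ p * f x) :=
  hf.smul (isOpen_pb R) (Sm.norm_rpow R p)

end

lemma cden_nonneg {α τ : ℝ} (hτ : 0 ≤ τ) (u : E3 → ℝ) (x : E3) : 0 ≤ cden α τ u x := by
  have := gsq_nonneg u x
  unfold cden; positivity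

lemma Mlt.cden_le {R α τ κ : ℝ} {m θ u : E3 → ℝ} {x : E3} (h : Mlt R m θ) (hu : Sm (pb R) u)
    (hx : x ∈ pb R) (hτ : 0 ≤ τ)
    (hθ : ‖x‖ ^ (-α - 2) * θ x ^ 2 ≤ κ * (τ ^ 2 * ‖x‖ ^ (-3 * α - 4))) (hκ : 0 ≤ κ) :
    m x ^ 2 * cden α τ u x ≤ (2 + 6 * κ) * cden α τ (fun y => m y * u y) x := by
  have h0 := norm_pos_of_mem_pb hx
  have h1 := h.gsq_le hu hx
  have hg := gsq_nonneg (fun y => m y * u y) x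
  unfold cden
  have ha : 0 ≤ ‖x‖ ^ (-α - 2) := by positivity
  have hz : 0 ≤ ‖x‖ ^ (-3 * α - 4) := by positivity
  generalize ‖x‖ ^ (-α - 2) = a at *
  generalize ‖x‖ ^ (-3 * α - 4) = z at *
  generalize gsq (fun y => m y * u y) x = g at *
  have a1 := mul_le_mul_of_nonneg_left h1 (by positivity : 0 ≤ τ * a)
  have a2 := mul_le_mul_of_nonneg_left hθ (by positivity : 0 ≤ τ * (m x ^ 2 * u x ^ 2))
  have a3 : 0 ≤ κ * (τ * a * g) := by positivity
  have a4 : 0 ≤ τ ^ 3 * z * (m x ^ 2 * u x ^ 2) := by positivity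
  nlinarith

end

section

/-- A small ball is enough to bound the coefficients and to freeze them at the origin. -/
lemma exists_coef_bounds {O : Set E3} {b : Fin 3 → Fin 3 → E3 → ℝ} (hO : IsOpen O)
    (h0 : (0 : E3) ∈ O) (hb : ∀ j k, Sm O (b j k)) {ε : ℝ} (hε : 0 < ε) :
    ∃ R > 0, R ≤ 1 ∧ closedBall 0 R ⊆ O ∧ ∃ B ≥ 0, (∀ j k, ∀ x ∈ ball (0 : E3) R, |b j k x| ≤ B) ∧
      ∀ j k, ∀ x ∈ ball (0 : E3) R, |b j k x - b j k 0| ≤ ε := by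
  have h1 : ∀ j k, ∀ᶠ x in nhds (0 : E3), |b j k x - b j k 0| ≤ ε := fun j k => by
    have := ((hb j k).continuousOn.continuousAt (hO.mem_nhds h0))
    have h2 := this.eventually (Metric.closedBall_mem_nhds (b j k 0) hε)
    filter_upwards [h2] with x hx
    simpa [Real.dist_eq] using hx
  have h2 : ∀ᶠ x in nhds (0 : E3), (∀ j k, |b j k x - b j k 0| ≤ ε) ∧ x ∈ O :=
    (Filter.eventually_all.2 fun j => Filter.eventually_all.2 fun k => h1 j k).and (hO.mem_nhds h0)
  obtain ⟨R, hR, hRO⟩ := Metric.nhds_basis_closedBall.mem_iff.1 h2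
  have hsub : ∀ x ∈ ball (0 : E3) (min R 1), x ∈ closedBall (0 : E3) R := fun x hx =>
    ball_subset_closedBall (ball_subset_ball (min_le_left _ _) hx)
  refine ⟨min R 1, lt_min hR one_pos, min_le_right _ _, fun x hx =>
    (hRO (closedBall_subset_closedBall (min_le_left _ _) hx)).2, (∑ j, ∑ k, |b j k 0|) + ε,
    by positivity, fun j k x hx => ?_, fun j k x hx => (hRO (hsub x hx)).1 j k⟩
  have h3 := (hRO (hsub x hx)).1 j k
  have h4 : |b j k 0| ≤ ∑ j, ∑ k, |b j k 0| :=
    (single_le_sum (f := fun k => |b j k 0|) (fun _ _ => abs_nonneg _) (mem_univ k)).trans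
      (single_le_sum (f := fun j => ∑ k, |b j k 0|)
        (fun _ _ => sum_nonneg fun _ _ => abs_nonneg _) (mem_univ j))
  have h5 := abs_sub_abs_le_abs_sub (b j k x) (b j k 0)
  linarith

/-- The full left-hand density in the second-order Carleman estimate. -/
def fden (α τ : ℝ) (u : E3 → ℝ) (x : E3) : ℝ := τ⁻¹ * (‖x‖ ^ α * hsq u x) + cden α τ u x

lemma TF.fden {R α τ : ℝ} {u : E3 → ℝ} (hu : TF (pb R) u) : TF (pb R) (fden α τ u) :=
  ((hu.hsq.rpow_mul α).const_mul τ⁻¹).add hu.cden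

section
variable {b : Fin 3 → Fin 3 → E3 → ℝ} {O : Set E3} {α G c K R τ : ℝ}

lemma CommBounds.carleman_base (h : CommBounds b α G c K R) (hb : ∀ j k, Sm O (b j k))
    (hsym : ∀ j k, ∀ x ∈ O, b j k x = b k j x)
    (hRO : pb R ⊆ O) (hR1 : R ≤ 1) (hα : 0 < α) (hc : 0 < c) :
    ∃ C ≥ 0, ∃ τ0 ≥ 1, ∀ τ ≥ τ0, ∀ u, TF (pb R) u →
      wint α τ (cden α τ u) ≤ C * wint α τ (fun x => op2 b u x ^ 2) := by
  obtain ⟨L, hL, hmlt⟩ := Mlt.ew hR1 hα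
  refine ⟨(2 + 6 * L ^ 2) * (2 / c), by positivity,
    1 + 3 * K ^ 2 / c ^ 2 + 6 * (G ^ 2 + K ^ 2) / c + 18 * K ^ 2 / c,
    by rw [add_assoc, add_assoc]; exact le_add_of_nonneg_right (by positivity), fun τ hτ u hu => ?_⟩
  have p1 : 0 ≤ 3 * K ^ 2 / c ^ 2 := by positivity
  have p2 : 0 ≤ 6 * (G ^ 2 + K ^ 2) / c := by positivity
  have p3 : 0 ≤ 18 * K ^ 2 / c := by positivity
  have hτ1 : 1 ≤ τ := by linarith
  have h1 := h.integral_cden_le hb hsym hRO hR1 hα hc hτ1 (by linarith) (by linarith)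
    (by linarith) hu
  have hew : Sm (pb R) (ew α τ) := (pdOn_ew R α τ 0).1
  have hv : TF (pb R) (fun y => ew α τ y * u y) := hu.smul (isOpen_pb R) hew
  have h2 : wint α τ (cden α τ u) ≤ ∫ x,
      (2 + 6 * L ^ 2) * cden α τ (fun y => ew α τ y * u y) x := by
    refine TF.integral_mono (hu.cden.ew_sq_mul α τ) (hv.cden.const_mul _) fun x => ?_
    by_cases hx : x ∈ pb R
    · have h0 := norm_pos_of_mem_pb hx
      refine (hmlt τ hτ1).cden_le (hu.sm _) hx (by linarith) (le_of_eq ?_) (sq_nonneg L)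
      rw [mul_pow, mul_pow, ← Real.rpow_natCast (‖x‖ ^ (-α - 1)), ← Real.rpow_mul h0.le]
      rw [show -3 * α - 4 = (-α - 2) + (-α - 1) * ((2 : ℕ) : ℝ) by push_cast; ring,
        Real.rpow_add h0]
      ring
    · rw [hu.cden.zero_of_notMem hx, hv.cden.zero_of_notMem hx]; simp
  rw [integral_const_mul] at h2
  have h3 : ∫ x, (ew α τ x * op2 b u x) ^ 2 = wint α τ (fun x => op2 b u x ^ 2) := by
    unfold wint; simp only [mul_pow]
  rw [h3] at h1
  refine h2.trans ?_
  rw [mul_assoc]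
  refine mul_le_mul_of_nonneg_left ?_ (by positivity)
  rw [div_mul_eq_mul_div, le_div_iff₀ hc]
  linarith

/-- Adding a power weight to the Carleman estimate. -/
lemma carleman_weight {B C0 τ0 : ℝ} (hb : ∀ j k, Sm (pb R) (b j k)) (hR1 : R ≤ 1) (hα : 0 < α)
    (hB : ∀ j k, ∀ x ∈ pb R, |b j k x| ≤ B) (hC0 : 0 ≤ C0) (hτ0 : 1 ≤ τ0)
    (h : ∀ τ ≥ τ0, ∀ u, TF (pb R) u →
      wint α τ (cden α τ u) ≤ C0 * wint α τ (fun x => op2 b u x ^ 2)) (p : ℝ) :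
    ∃ C ≥ 0, ∃ τ1 ≥ 1, ∀ τ ≥ τ1, ∀ u, TF (pb R) u →
      wint α τ (fun x => ‖x‖ ^ p * cden α τ u x) ≤
        C * wint α τ (fun x => ‖x‖ ^ p * op2 b u x ^ 2) := by
  obtain ⟨L, hL, hm⟩ := Mlt.norm_rpow hR1 (p / 2)
  set D := 486 * B ^ 2 * (L ^ 4 + L ^ 2) with hD
  have hDn : 0 ≤ D := by positivity
  set K1 := 2 + 6 * L ^ 2 with hK1
  have hK1n : 0 ≤ K1 := by positivity
  refine ⟨4 * (K1 * C0), by positivity, τ0 + 2 * (K1 * C0 * D),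
    le_add_of_le_of_nonneg hτ0 (by positivity), fun τ hτ u hu => ?_⟩
  have hn : 0 ≤ K1 * C0 * D := by positivity
  have hττ0 : τ0 ≤ τ := by linarith
  have hτ1 : 1 ≤ τ := hτ0.trans hττ0
  have hO := isOpen_pb R
  have hv : TF (pb R) (fun x => ‖x‖ ^ (p / 2) * u x) := hu.rpow_mul _
  have sqm : ∀ x ∈ pb R, (‖x‖ ^ (p / 2)) ^ 2 = ‖x‖ ^ p := fun x hx => by
    rw [← Real.rpow_natCast, ← Real.rpow_mul (norm_nonneg x)]; congr 1; push_cast; ring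
  have hop := (hu.op2 hO hb).sq
  have a1 : wint α τ (fun x => ‖x‖ ^ p * cden α τ u x) ≤
      wint α τ (fun x => K1 * cden α τ (fun x => ‖x‖ ^ (p / 2) * u x) x) := by
    refine wint_mono (hu.cden.rpow_mul p) (hv.cden.const_mul _) fun x hx => ?_
    have h0 := norm_pos_of_mem_pb hx
    rw [← sqm x hx]
    refine hm.cden_le (hu.sm _) hx (by linarith) ?_ (sq_nonneg L)
    rw [mul_pow, ← Real.rpow_natCast (‖x‖ ^ (-1 : ℝ)), ← Real.rpow_mul h0.le]
    rw [mul_left_comm, ← Real.rpow_add h0]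
    refine mul_le_mul_of_nonneg_left ?_ (sq_nonneg L)
    refine (rpow_le_rpow_of_unit h0 (hx.2.le.trans hR1) ?_).trans
      (le_mul_of_one_le_left (by positivity) (one_le_pow₀ hτ1))
    push_cast; linarith
  have a2 := h τ hττ0 _ hv
  have a3 : wint α τ (fun x => op2 b (fun x => ‖x‖ ^ (p / 2) * u x) x ^ 2) ≤
      wint α τ (fun x => 2 * (‖x‖ ^ p * op2 b u x ^ 2) + D * τ⁻¹ * (‖x‖ ^ p * cden α τ u x)) := by
    refine wint_mono (hv.op2 hO hb).sq (((hop.rpow_mul p).const_mul 2).add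
      ((hu.cden.rpow_mul p).const_mul _)) fun x hx => ?_
    have h0 := norm_pos_of_mem_pb hx
    have hx1 := hx.2.le.trans hR1
    refine (hm.op2_le (hu.sm _) hB hx).trans ?_
    rw [sqm x hx]
    refine add_le_add le_rfl ?_
    suffices hs : (L * ‖x‖ ^ (-1 : ℝ)) ^ 4 * u x ^ 2 + (L * ‖x‖ ^ (-1 : ℝ)) ^ 2 * gsq u x ≤
        (L ^ 4 + L ^ 2) * (τ⁻¹ * cden α τ u x) by
      have := mul_le_mul_of_nonneg_left hs (by positivity : 0 ≤ 486 * B ^ 2 * ‖x‖ ^ p)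
      rw [hD]
      linarith
    have hg := gsq_nonneg u x
    have q1 : (‖x‖ ^ (-1 : ℝ)) ^ 2 ≤ ‖x‖ ^ (-α - 2) := by
      rw [← Real.rpow_natCast, ← Real.rpow_mul h0.le]
      exact rpow_le_rpow_of_unit h0 hx1 (by push_cast; linarith)
    have q2 : (‖x‖ ^ (-1 : ℝ)) ^ 4 ≤ ‖x‖ ^ (-3 * α - 4) := by
      rw [← Real.rpow_natCast, ← Real.rpow_mul h0.le]
      exact rpow_le_rpow_of_unit h0 hx1 (by push_cast; linarith)
    have e : τ⁻¹ * cden α τ u x = ‖x‖ ^ (-α - 2) * gsq u x +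
        τ ^ 2 * (‖x‖ ^ (-3 * α - 4) * u x ^ 2) := by
      unfold cden; field_simp
    rw [e, mul_pow, mul_pow]
    have r1 := mul_le_mul_of_nonneg_right q1 hg
    have r2 := mul_le_mul_of_nonneg_right q2 (sq_nonneg (u x))
    have r3 : ‖x‖ ^ (-3 * α - 4) * u x ^ 2 ≤ τ ^ 2 * (‖x‖ ^ (-3 * α - 4) * u x ^ 2) :=
      le_mul_of_one_le_left (by positivity) (one_le_pow₀ hτ1)
    have s1 := mul_le_mul_of_nonneg_left r1 (sq_nonneg L)
    have s2 := mul_le_mul_of_nonneg_left (r2.trans r3) (by positivity : 0 ≤ L ^ 4)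
    have t1 : 0 ≤ L ^ 4 * (‖x‖ ^ (-α - 2) * gsq u x) := by positivity
    have t2 : 0 ≤ L ^ 2 * (τ ^ 2 * (‖x‖ ^ (-3 * α - 4) * u x ^ 2)) := by positivity
    linarith
  rw [wint_const_mul] at a1
  rw [wint_add ((hop.rpow_mul p).const_mul 2) ((hu.cden.rpow_mul p).const_mul _), wint_const_mul,
    wint_const_mul] at a3
  have hX : 0 ≤ wint α τ (fun x => ‖x‖ ^ p * cden α τ u x) := wint_nonneg fun x =>
    mul_nonneg (by positivity) (cden_nonneg (by linarith) u x)
  generalize wint α τ (fun x => ‖x‖ ^ p * cden α τ u x) = X at *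
  generalize wint α τ (fun x => ‖x‖ ^ p * op2 b u x ^ 2) = Y at *
  have b1 := mul_le_mul_of_nonneg_left (a2.trans (mul_le_mul_of_nonneg_left a3 hC0)) hK1n
  have b2 : K1 * C0 * D * τ⁻¹ * X ≤ 1 / 2 * X := by
    refine mul_le_mul_of_nonneg_right ?_ hX
    rw [← div_eq_mul_inv, div_le_iff₀ (by linarith)]
    linarith
  linarith

end

end

section

section
variable {b : Fin 3 → Fin 3 → E3 → ℝ} {α R : ℝ}

/-- Adding second derivatives to the weighted Carleman estimate. -/
lemma carleman_hess {B c0 C1 τ1 p : ℝ} (hb : ∀ j k, Sm (pb R) (b j k)) (hR1 : R ≤ 1) (hα : 0 < α)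
    (hB : ∀ j k, ∀ x ∈ pb R, |b j k x| ≤ B) (hc0 : 0 < c0)
    (hell : ∀ ξ : Fin 3 → ℝ, c0 * ∑ i, ξ i ^ 2 ≤ ∑ j, ∑ k, b j k 0 * ξ j * ξ k)
    (hclose : ∀ j k, ∀ x ∈ pb R, |b j k x - b j k 0| ≤ c0 / 11) (hC1 : 0 ≤ C1) (hτ1 : 1 ≤ τ1)
    (h : ∀ τ ≥ τ1, ∀ u, TF (pb R) u → wint α τ (fun x => ‖x‖ ^ p * cden α τ u x) ≤
        C1 * wint α τ (fun x => ‖x‖ ^ p * op2 b u x ^ 2)) :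
    ∃ C ≥ 0, ∃ τ0 ≥ 1, ∀ τ ≥ τ0, ∀ u, TF (pb R) u →
      wint α τ (fun x => ‖x‖ ^ p * fden α τ u x) ≤
        C * wint α τ (fun x => ‖x‖ ^ p * op2 b u x ^ 2) := by
  obtain ⟨L1, hL1, hm1⟩ := Mlt.norm_rpow hR1 ((α + p) / 2)
  obtain ⟨L2, hL2, hm2⟩ := Mlt.ew (α := α) hR1 hα
  set L := L1 + L2 with hL
  have hLn : 0 ≤ L := by positivity
  set D := L ^ 4 + L ^ 2 with hD
  have hDn : 0 ≤ D := by positivity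
  set H := 12 / c0 ^ 2 with hH
  have hHn : 0 ≤ H := by positivity
  refine ⟨2 * H * (2 + 486 * B ^ 2 * D * C1) + 54 * D * C1 + C1, by positivity, τ1, hτ1,
    fun τ hτ u hu => ?_⟩
  have hτ1' : 1 ≤ τ := hτ1.trans hτ
  have hτ0 : 0 < τ := by linarith
  have hO := isOpen_pb R
  have hmm : Mlt R (fun x => ‖x‖ ^ ((α + p) / 2) * ew α τ x)
      (fun x => τ * (L * ‖x‖ ^ (-α - 1))) := by
    refine (hm1.mul (hm2 τ hτ1')).mono fun x hx => ?_
    have h0 := norm_pos_of_mem_pb hx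
    have h3 : ‖x‖ ^ (-1 : ℝ) ≤ ‖x‖ ^ (-α - 1) :=
      rpow_le_rpow_of_unit h0 (hx.2.le.trans hR1) (by linarith)
    have h4 : L1 * ‖x‖ ^ (-1 : ℝ) ≤ τ * (L1 * ‖x‖ ^ (-α - 1)) :=
      (mul_le_mul_of_nonneg_left h3 hL1).trans (le_mul_of_one_le_left (by positivity) hτ1')
    rw [hL]; linarith
  have hw : TF (pb R) (fun x => (‖x‖ ^ ((α + p) / 2) * ew α τ x) * u x) := hu.smul hO hmm.sm
  have msq : ∀ x ∈ pb R, (‖x‖ ^ ((α + p) / 2) * ew α τ x) ^ 2 =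
      ew α τ x ^ 2 * (‖x‖ ^ p * ‖x‖ ^ α) :=
    fun x hx => by
    rw [mul_pow, ← Real.rpow_natCast (‖x‖ ^ _), ← Real.rpow_mul (norm_nonneg x),
      ← Real.rpow_add (norm_pos_of_mem_pb hx), mul_comm]
    congr 2; push_cast; ring
  have err : ∀ x ∈ pb R, (‖x‖ ^ ((α + p) / 2) * ew α τ x) ^ 2 *
      ((τ * (L * ‖x‖ ^ (-α - 1))) ^ 4 * u x ^ 2 + (τ * (L * ‖x‖ ^ (-α - 1))) ^ 2 * gsq u x) ≤
      τ * D * (ew α τ x ^ 2 * (‖x‖ ^ p * cden α τ u x)) := fun x hx => by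
    have h0 := norm_pos_of_mem_pb hx
    rw [msq x hx]
    have e1 : ‖x‖ ^ α * (‖x‖ ^ (-α - 1)) ^ 4 = ‖x‖ ^ (-3 * α - 4) := by
      rw [← Real.rpow_natCast, ← Real.rpow_mul h0.le, ← Real.rpow_add h0]
      congr 1; push_cast; ring
    have e2 : ‖x‖ ^ α * (‖x‖ ^ (-α - 1)) ^ 2 = ‖x‖ ^ (-α - 2) := by
      rw [← Real.rpow_natCast, ← Real.rpow_mul h0.le, ← Real.rpow_add h0]
      congr 1; push_cast; ring
    have e3 : ew α τ x ^ 2 * (‖x‖ ^ p * ‖x‖ ^ α) *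
      ((τ * (L * ‖x‖ ^ (-α - 1))) ^ 4 * u x ^ 2 + (τ * (L * ‖x‖ ^ (-α - 1))) ^ 2 * gsq u x) =
      (ew α τ x ^ 2 * ‖x‖ ^ p) * (τ * (L ^ 4 * (τ ^ 3 * ‖x‖ ^ (-3 * α - 4) * u x ^ 2) +
        L ^ 2 * (τ * ‖x‖ ^ (-α - 2) * gsq u x))) := by
      rw [← e1, ← e2]; ring
    have e4 : τ * D * (ew α τ x ^ 2 * (‖x‖ ^ p * cden α τ u x)) =
      (ew α τ x ^ 2 * ‖x‖ ^ p) * (τ * (D * cden α τ u x)) := by ring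
    rw [e3, e4]
    refine mul_le_mul_of_nonneg_left (mul_le_mul_of_nonneg_left ?_ hτ0.le) (by positivity)
    have hg := gsq_nonneg u x
    have t1 : 0 ≤ L ^ 4 * (τ * ‖x‖ ^ (-α - 2) * gsq u x) := by positivity
    have t2 : 0 ≤ L ^ 2 * (τ ^ 3 * ‖x‖ ^ (-3 * α - 4) * u x ^ 2) := by positivity
    rw [hD, cden]
    linarith
  have I1 := integral_hsq_le_of_close hc0 hell hO hb hclose hw
  have hop := (hu.op2 hO hb).sq
  have hX := hu.cden (α := α) (τ := τ)
  have I2 : ∫ x, op2 b (fun x => (‖x‖ ^ ((α + p) / 2) * ew α τ x) * u x) x ^ 2 ≤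
      2 * wint α τ (fun x => ‖x‖ ^ p * op2 b u x ^ 2) +
      486 * B ^ 2 * (τ * D) * wint α τ (fun x => ‖x‖ ^ p * cden α τ u x) := by
    rw [← wint_const_mul, ← wint_const_mul, ← wint_add ((hop.rpow_mul p).const_mul _)
      ((hX.rpow_mul p).const_mul _)]
    refine TF.integral_mono (hw.op2 hO hb).sq ((((hop.rpow_mul p).const_mul _).add
      ((hX.rpow_mul p).const_mul _)).ew_sq_mul α τ) fun x => ?_
    by_cases hx : x ∈ pb R
    · refine (hmm.op2_le (hu.sm _) hB hx).trans ?_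
      have h1 := mul_le_mul_of_nonneg_left (err x hx) (by positivity : 0 ≤ 486 * B ^ 2)
      have h2 : (‖x‖ ^ ((α + p) / 2) * ew α τ x) ^ 2 * op2 b u x ^ 2 ≤
          ew α τ x ^ 2 * (‖x‖ ^ p * op2 b u x ^ 2) := by
        rw [msq x hx]
        have h3 : ‖x‖ ^ α ≤ 1 := Real.rpow_le_one (norm_nonneg x) (hx.2.le.trans hR1) hα.le
        have h4 := mul_le_mul_of_nonneg_left h3
          (by positivity : 0 ≤ ew α τ x ^ 2 * (‖x‖ ^ p * op2 b u x ^ 2))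
        linarith
      linarith
    · beta_reduce
      rw [(hw.op2 hO hb).zero_of_notMem hx, (hu.op2 hO hb).zero_of_notMem hx,
        hX.zero_of_notMem hx]
      norm_num
  have I3 : wint α τ (fun x => ‖x‖ ^ p * (‖x‖ ^ α * hsq u x)) ≤
      2 * (∫ x, hsq (fun x => (‖x‖ ^ ((α + p) / 2) * ew α τ x) * u x) x) +
      54 * (τ * D) * wint α τ (fun x => ‖x‖ ^ p * cden α τ u x) := by
    unfold wint
    rw [← integral_const_mul, ← integral_const_mul,
      ← integral_add (hw.hsq.const_mul 2).integrable
        (((hX.rpow_mul p).ew_sq_mul α τ).const_mul _).integrable]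
    refine TF.integral_mono (((hu.hsq.rpow_mul α).rpow_mul p).ew_sq_mul α τ)
      ((hw.hsq.const_mul 2).add (((hX.rpow_mul p).ew_sq_mul α τ).const_mul _)) fun x => ?_
    by_cases hx : x ∈ pb R
    · have h1 := hmm.hsq_le (hu.sm _) hx
      have h2 := err x hx
      rw [msq x hx] at h1 h2
      linarith
    · beta_reduce
      rw [hw.hsq.zero_of_notMem hx, hu.hsq.zero_of_notMem hx, hX.zero_of_notMem hx]
      norm_num
  have I4 := h τ hτ u hu
  have e : wint α τ (fun x => ‖x‖ ^ p * fden α τ u x) =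
      τ⁻¹ * wint α τ (fun x => ‖x‖ ^ p * (‖x‖ ^ α * hsq u x)) +
      wint α τ (fun x => ‖x‖ ^ p * cden α τ u x) := by
    rw [← wint_const_mul, ← wint_add (((hu.hsq.rpow_mul α).rpow_mul p).const_mul _)
      (hX.rpow_mul p)]
    congr 1; ext x; unfold fden; ring
  rw [e]
  have hY : 0 ≤ wint α τ (fun x => ‖x‖ ^ p * op2 b u x ^ 2) := wint_nonneg fun x => by positivity
  generalize wint α τ (fun x => ‖x‖ ^ p * cden α τ u x) = X at *
  generalize wint α τ (fun x => ‖x‖ ^ p * op2 b u x ^ 2) = Y at *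
  have hi1 : τ⁻¹ ≤ 1 := inv_le_one_of_one_le₀ hτ1'
  have I5 := I3.trans (add_le_add_left (mul_le_mul_of_nonneg_left
    (I1.trans (mul_le_mul_of_nonneg_left I2 hHn)) zero_le_two) _)
  have I6 := mul_le_mul_of_nonneg_left I5 (inv_nonneg.2 hτ0.le)
  have e2 : τ⁻¹ * (2 * (H * (2 * Y + 486 * B ^ 2 * (τ * D) * X)) + 54 * (τ * D) * X) =
      τ⁻¹ * (4 * H * Y) + (2 * H * (486 * B ^ 2 * D) + 54 * D) * X := by
    field_simp; ring
  rw [e2] at I6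
  have I7 : τ⁻¹ * (4 * H * Y) ≤ 4 * H * Y := mul_le_of_le_one_left (by positivity) hi1
  have I8 : (2 * H * (486 * B ^ 2 * D) + 54 * D) * X ≤
      (2 * H * (486 * B ^ 2 * D) + 54 * D) * (C1 * Y) :=
    mul_le_mul_of_nonneg_left I4 (by positivity)
  linarith

end

/-- The second-order Carleman estimate, with an arbitrary extra power weight. -/
lemma Adm.carleman {O : Set E3} {b : Fin 3 → Fin 3 → E3 → ℝ} {α : ℝ} (hb : Adm O b α)
    (hα : 0 < α) :
    ∃ R > 0, R ≤ 1 ∧ closedBall 0 R ⊆ O ∧ ∀ p : ℝ, ∃ C ≥ 0, ∃ τ0 ≥ 1, ∀ τ ≥ τ0, ∀ u, TF (pb R) u →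
      wint α τ (fun x => ‖x‖ ^ p * fden α τ u x) ≤
        C * wint α τ (fun x => ‖x‖ ^ p * op2 b u x ^ 2) := by
  obtain ⟨R1, hR1, hR11, hRO1, G, hG, c, hc, K, hK, hcb⟩ := hb.exists_commBounds hα
  obtain ⟨c0, hc0, hell⟩ := hb.ell
  obtain ⟨R2, hR2, hR21, hRO2, B, hB, hB1, hB2⟩ :=
      exists_coef_bounds hb.isOpen hb.zero_mem hb.smooth
    (by positivity : 0 < c0 / 11)
  have sub1 : pb (min R1 R2) ⊆ pb R1 := pb_mono (min_le_left _ _)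
  have sub2 : pb (min R1 R2) ⊆ ball 0 R2 := (pb_mono (min_le_right _ _)).trans (pb_subset_ball _)
  have sO1 : pb R1 ⊆ O := (pb_subset_ball _).trans (ball_subset_closedBall.trans hRO1)
  have hsm : ∀ j k, Sm (pb (min R1 R2)) (b j k) := fun j k => (hb.smooth j k).mono (sub1.trans sO1)
  have hm1 : min R1 R2 ≤ 1 := (min_le_left _ _).trans hR11
  refine ⟨min R1 R2, lt_min hR1 hR2, hm1,
    (closedBall_subset_closedBall (min_le_left _ _)).trans hRO1, fun p => ?_⟩
  obtain ⟨C0, hC0, τ0, hτ0, h0⟩ := hcb.carleman_base hb.smooth hb.sym sO1 hR11 hα hc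
  obtain ⟨C1, hC1, τ1, hτ1, h1⟩ := carleman_weight hsm hm1 hα
    (fun j k x hx => hB1 j k x (sub2 hx)) hC0 hτ0 (fun τ hτ u hu => h0 τ hτ u (hu.mono sub1)) p
  exact carleman_hess hsm hm1 hα (fun j k x hx => hB1 j k x (sub2 hx)) hc0 hell
    (fun j k x hx => hB2 j k x (sub2 hx)) hC1 hτ1 h1

end

section

section
variable {b : Fin 3 → Fin 3 → E3 → ℝ} {R : ℝ} {u : E3 → ℝ}

lemma sq_sum_sum_le {a d : Fin 3 → Fin 3 → ℝ} {B : ℝ} (ha : ∀ j k, |a j k| ≤ B) :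
    (∑ j, ∑ k, a j k * d j k) ^ 2 ≤ 9 * B ^ 2 * ∑ j, ∑ k, d j k ^ 2 := by
  have h1 : (∑ j, ∑ k, a j k * d j k) ^ 2 ≤ 9 * ∑ j, ∑ k, (a j k * d j k) ^ 2 := by
    have e := sq_sum_le_card_mul_sum_sq (s := (univ : Finset (Fin 3)))
      (f := fun j => ∑ k, a j k * d j k)
    have e2 : ∀ j ∈ (univ : Finset (Fin 3)), (∑ k, a j k * d j k) ^ 2 ≤ 3 * ∑ k,
        (a j k * d j k) ^ 2 :=
      fun j _ => by
      have := sq_sum_le_card_mul_sum_sq (s := (univ : Finset (Fin 3))) (f := fun k => a j k * d j k)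
      simpa using this
    have e3 := sum_le_sum e2
    rw [← mul_sum] at e3
    simp only [card_univ, Fintype.card_fin, Nat.cast_ofNat] at e
    linarith
  refine h1.trans ?_
  rw [mul_assoc]
  refine mul_le_mul_of_nonneg_left ?_ (by norm_num)
  rw [mul_sum]
  refine sum_le_sum fun j _ => ?_
  rw [mul_sum]
  refine sum_le_sum fun k _ => ?_
  rw [mul_pow]
  refine mul_le_mul_of_nonneg_right ?_ (sq_nonneg _)
  exact sq_le_sq' (by linarith [neg_abs_le (a j k), ha j k]) ((le_abs_self _).trans (ha j k))

/-- The commutator of `∂_i` with a second-order operator. -/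
lemma op2_pd_sq_le {O : Set E3} {B : ℝ} (hO : IsOpen O) (hb : ∀ j k, Sm O (b j k)) (hu : TF O u)
    (i : Fin 3) (hB : ∀ j k, ∀ x ∈ O, |pd i (b j k) x| ≤ B) {x : E3} (hx : x ∈ O) :
    op2 b (pd i u) x ^ 2 ≤ 2 * pd i (op2 b u) x ^ 2 + 18 * B ^ 2 * hsq u x := by
  have h1 : pd i (op2 b u) x = op2 b (pd i u) x +
      ∑ j, ∑ k, pd i (b j k) x * pd j (pd k u) x := by
    have := (PdOn.sum (s := univ) hO fun j _ => PdOn.sum (s := univ) hO fun k _ =>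
      ((hb j k).pdOn i).mul hO ((((hu.pd k).pd j).sm O).pdOn i)).2 x hx
    refine this.trans ?_
    unfold op2
    rw [← sum_add_distrib]
    refine sum_congr rfl fun j _ => ?_
    rw [← sum_add_distrib]
    refine sum_congr rfl fun k _ => ?_
    rw [(hu.pd k).comm i j, hu.comm i k]
    ring
  have h2 := sq_sum_sum_le (a := fun j k => pd i (b j k) x) (d := fun j k => pd j (pd k u) x)
    (B := B) (fun j k => hB j k x hx)
  have h3 : ∑ j, ∑ k, pd j (pd k u) x ^ 2 = hsq u x := by
    unfold hsq gsq; rw [sum_comm]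
  rw [h3] at h2
  set s := ∑ j, ∑ k, pd i (b j k) x * pd j (pd k u) x
  have h4 : op2 b (pd i u) x = pd i (op2 b u) x - s := by rw [h1]; ring
  rw [h4]
  nlinarith [sq_nonneg (pd i (op2 b u) x + s)]
end

section
variable {α τ : ℝ} {u : E3 → ℝ} {x : E3}

lemma cden_le_fden (hτ : 0 ≤ τ) : cden α τ u x ≤ fden α τ u x :=
  le_add_of_nonneg_left (mul_nonneg (inv_nonneg.2 hτ)
    (mul_nonneg (Real.rpow_nonneg (norm_nonneg x) _) (hsq_nonneg u x)))

/-- The sum of the squares of all derivatives of order at most three. -/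
def dsq (u : E3 → ℝ) (x : E3) : ℝ := tsq u x + hsq u x + gsq u x + u x ^ 2

lemma dsq_nonneg (u : E3 → ℝ) (x : E3) : 0 ≤ dsq u x := by
  have := tsq_nonneg u x; have := hsq_nonneg u x; have := gsq_nonneg u x
  unfold dsq; positivity

lemma TF.dsq {O : Set E3} (hu : TF O u) : TF O (dsq u) :=
  ((hu.tsq.add hu.hsq).add hu.gsq).add hu.sq

lemma hsq_le_fden (h0 : 0 < ‖x‖) (hτ : 1 ≤ τ) :
    τ ^ 2 * (‖x‖ ^ (-2 * α - 4) * hsq u x) ≤ τ ^ 3 * (‖x‖ ^ (-3 * α - 4) * fden α τ u x) := by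
  have hc := cden_nonneg (α := α) (by linarith : 0 ≤ τ) u x
  have e : τ ^ 3 * (‖x‖ ^ (-3 * α - 4) * fden α τ u x) =
      τ ^ 2 * ((‖x‖ ^ (-3 * α - 4) * ‖x‖ ^ α) * hsq u x) +
      τ ^ 3 * (‖x‖ ^ (-3 * α - 4) * cden α τ u x) := by
    unfold fden; field_simp
  rw [e, ← Real.rpow_add h0, show -3 * α - 4 + α = -2 * α - 4 by ring]
  exact le_add_of_nonneg_right (by positivity)

lemma dsq_le_fden (h0 : 0 < ‖x‖) (h1 : ‖x‖ ≤ 1) (hα : 0 < α) (hτ : 1 ≤ τ) :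
    ‖x‖ ^ (-2 : ℝ) * dsq u x ≤ ∑ i, τ * (‖x‖ ^ (-α - 2) * fden α τ (pd i u) x) +
      τ ^ 3 * (‖x‖ ^ (-3 * α - 4) * fden α τ u x) := by
  have hτ0 : 0 < τ := by linarith
  have a1 : ‖x‖ ^ (-2 : ℝ) * tsq u x ≤ ∑ i, τ * (‖x‖ ^ (-α - 2) * fden α τ (pd i u) x) := by
    unfold tsq
    rw [mul_sum]
    refine sum_le_sum fun i _ => ?_
    have hc := cden_nonneg (α := α) hτ0.le (pd i u) x
    have e : τ * (‖x‖ ^ (-α - 2) * fden α τ (pd i u) x) =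
      (‖x‖ ^ (-α - 2) * ‖x‖ ^ α) * hsq (pd i u) x +
      τ * (‖x‖ ^ (-α - 2) * cden α τ (pd i u) x) := by
      unfold fden; field_simp
    rw [e, ← Real.rpow_add h0, show -α - 2 + α = -2 by ring]
    exact le_add_of_nonneg_right (by positivity)
  have key : ∀ (q : ℝ) (n : ℕ), q ≤ -2 → ‖x‖ ^ (-2 : ℝ) ≤ τ ^ n * ‖x‖ ^ q := fun q n hq =>
    (rpow_le_rpow_of_unit h0 h1 hq).trans (le_mul_of_one_le_left (by positivity) (one_le_pow₀ hτ))
  have e : τ ^ 3 * (‖x‖ ^ (-3 * α - 4) * fden α τ u x) =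
      τ ^ 2 * (‖x‖ ^ (-3 * α - 4) * ‖x‖ ^ α) * hsq u x +
      (τ ^ 4 * (‖x‖ ^ (-3 * α - 4) * ‖x‖ ^ (-α - 2)) * gsq u x +
      τ ^ 6 * (‖x‖ ^ (-3 * α - 4) * ‖x‖ ^ (-3 * α - 4)) * u x ^ 2) := by
    unfold fden cden; field_simp
  have k1 := mul_le_mul_of_nonneg_right (key (-3 * α - 4 + α) 2 (by linarith)) (hsq_nonneg u x)
  have k2 := mul_le_mul_of_nonneg_right (key (-3 * α - 4 + (-α - 2)) 4 (by linarith))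
      (gsq_nonneg u x)
  have k3 := mul_le_mul_of_nonneg_right (key (-3 * α - 4 + (-3 * α - 4)) 6 (by linarith))
    (sq_nonneg (u x))
  rw [e, ← Real.rpow_add h0, ← Real.rpow_add h0, ← Real.rpow_add h0]
  unfold dsq
  linarith
end

section
variable {O : Set E3} {b1 b2 : Fin 3 → Fin 3 → E3 → ℝ} {α : ℝ}

/-- The Carleman estimate for the product of two second-order operators. -/
lemma carleman_product (h1 : Adm O b1 α) (h2 : Adm O b2 α) (hα : 0 < α) :
    ∃ R > 0, R ≤ 1 ∧ closedBall 0 R ⊆ O ∧ ∃ C ≥ 0, ∃ τ0 ≥ 1, ∀ τ ≥ τ0, ∀ r, 0 < r → r ≤ R →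
      ∀ u, TF (pb r) u → wint α τ (dsq u) ≤
        C * r ^ 2 * wint α τ (fun x => op2 b2 (op2 b1 u) x ^ 2) := by
  obtain ⟨R1, hR1, hR11, hRO1, hc1⟩ := h1.carleman hα
  obtain ⟨R2, hR2, hR21, hRO2, hc2⟩ := h2.carleman hα
  obtain ⟨Ca, hCa, τa, hτa, ha⟩ := hc2 0
  obtain ⟨Cb, hCb, τb, hτb, hb⟩ := hc1 (-3 * α - 4)
  obtain ⟨Cc, hCc, τc, hτc, hc⟩ := hc1 (-α - 2)
  have hbd : ∀ i j k, ∃ B ≥ 0, ∀ x ∈ closedBall (0 : E3) R1, |pd i (b1 j k) x| ≤ B :=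
      fun i j k => by
    obtain ⟨B, hB⟩ := (isCompact_closedBall (0 : E3) R1).exists_bound_of_continuousOn
      ((((h1.smooth j k).pd h1.isOpen i).mono hRO1).continuousOn)
    exact ⟨|B|, abs_nonneg _, fun x hx => (hB x hx).trans (le_abs_self B)⟩
  choose B hB0 hB using hbd
  set B' := ∑ i, ∑ j, ∑ k, B i j k with hB'
  have hBB : ∀ i j k, B i j k ≤ B' := fun i j k =>
    (single_le_sum (f := fun k => B i j k) (fun _ _ => hB0 _ _ _) (mem_univ k)).trans
      ((single_le_sum (f := fun j => ∑ k, B i j k)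
        (fun _ _ => sum_nonneg fun _ _ => hB0 _ _ _) (mem_univ j)).trans
      (single_le_sum (f := fun i => ∑ j, ∑ k, B i j k)
        (fun _ _ => sum_nonneg fun _ _ => sum_nonneg fun _ _ => hB0 _ _ _) (mem_univ i)))
  set M := Cb * Ca with hM
  have hMn : 0 ≤ M := by positivity
  refine ⟨min R1 R2, lt_min hR1 hR2, (min_le_left _ _).trans hR11,
    (closedBall_subset_closedBall (min_le_left _ _)).trans hRO1,
    Cc * (2 * Ca + 54 * B' ^ 2 * M) + M, by positivity, max τa (max τb τc),
    hτa.trans (le_max_left _ _), fun τ hτ r hr hrR u hu => ?_⟩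
  have hτa' : τa ≤ τ := (le_max_left _ _).trans hτ
  have hτb' : τb ≤ τ := (le_max_left _ _).trans ((le_max_right _ _).trans hτ)
  have hτc' : τc ≤ τ := (le_max_right _ _).trans ((le_max_right _ _).trans hτ)
  have hτ1 : 1 ≤ τ := hτa.trans hτa'
  have hτ0 : 0 < τ := by linarith
  have hr1 : r ≤ R1 := hrR.trans (min_le_left _ _)
  have hr2 : r ≤ R2 := hrR.trans (min_le_right _ _)
  have hO := isOpen_pb r
  have sO : pb r ⊆ O := (pb_mono hr1).trans ((pb_subset_ball _).trans
    (ball_subset_closedBall.trans hRO1))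
  have hs1 : ∀ j k, Sm (pb r) (b1 j k) := fun j k => (h1.smooth j k).mono sO
  have hs2 : ∀ j k, Sm (pb r) (b2 j k) := fun j k => (h2.smooth j k).mono sO
  have hA : TF (pb r) (op2 b1 u) := hu.op2 hO hs1
  have hAA : TF (pb r) (op2 b2 (op2 b1 u)) := hA.op2 hO hs2
  set Y := wint α τ (fun x => op2 b2 (op2 b1 u) x ^ 2) with hY
  have hYn : 0 ≤ Y := wint_nonneg fun x => by positivity
  have x1 : ∀ x ∈ pb r, ‖x‖ ≤ 1 := fun x hx => hx.2.le.trans (hr1.trans hR11)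
  -- the estimate for the second operator
  have s0 : wint α τ (cden α τ (op2 b1 u)) ≤ Ca * Y := by
    have := ha τ hτa' _ (hA.mono (pb_mono hr2))
    simp only [Real.rpow_zero, one_mul] at this
    exact (wint_mono hA.cden hA.fden fun x _ => cden_le_fden hτ0.le).trans this
  have s1 : τ ^ 3 * wint α τ (fun x => ‖x‖ ^ (-3 * α - 4) * op2 b1 u x ^ 2) ≤ Ca * Y := by
    rw [← wint_const_mul]
    refine (wint_mono ((hA.sq.rpow_mul _).const_mul _) hA.cden fun x hx => ?_).trans s0
    have := gsq_nonneg (op2 b1 u) x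
    unfold cden
    have t : 0 ≤ τ * ‖x‖ ^ (-α - 2) * gsq (op2 b1 u) x := by positivity
    linarith
  have s2 : τ * wint α τ (fun x => ‖x‖ ^ (-α - 2) * gsq (op2 b1 u) x) ≤ Ca * Y := by
    rw [← wint_const_mul]
    refine (wint_mono ((hA.gsq.rpow_mul _).const_mul _) hA.cden fun x hx => ?_).trans s0
    unfold cden
    have t : 0 ≤ τ ^ 3 * ‖x‖ ^ (-3 * α - 4) * op2 b1 u x ^ 2 := by positivity
    linarith
  -- the estimate for the first operator
  have s3 : τ ^ 3 * wint α τ (fun x => ‖x‖ ^ (-3 * α - 4) * fden α τ u x) ≤ M * Y := by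
    have e := mul_le_mul_of_nonneg_left (hb τ hτb' _ (hu.mono (pb_mono hr1)))
      (by positivity : 0 ≤ τ ^ 3)
    have e2 := mul_le_mul_of_nonneg_left s1 hCb
    rw [hM]
    linarith
  have s4 : τ * wint α τ (fun x => ‖x‖ ^ (-α - 2) * hsq u x) ≤ M * Y := by
    refine le_trans ?_ s3
    rw [← wint_const_mul, ← wint_const_mul]
    refine wint_mono ((hu.hsq.rpow_mul _).const_mul _) ((hu.fden.rpow_mul _).const_mul _)
      fun x hx => le_trans ?_ (hsq_le_fden (norm_pos_of_mem_pb hx) hτ1)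
    have h3 := rpow_le_rpow_of_unit (norm_pos_of_mem_pb hx) (x1 x hx)
      (by linarith : -2 * α - 4 ≤ -α - 2)
    have h4 : τ ≤ τ ^ 2 := by nlinarith
    exact mul_le_mul h4 (mul_le_mul_of_nonneg_right h3 (hsq_nonneg u x))
      (mul_nonneg (by positivity) (hsq_nonneg u x)) (by positivity)
  have s5 : ∀ i, τ * wint α τ (fun x => ‖x‖ ^ (-α - 2) * fden α τ (pd i u) x) ≤
      Cc * (2 * (τ * wint α τ (fun x => ‖x‖ ^ (-α - 2) * pd i (op2 b1 u) x ^ 2)) +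
        18 * B' ^ 2 * (M * Y)) := fun i => by
    have e := mul_le_mul_of_nonneg_left (hc τ hτc' _ ((hu.pd i).mono (pb_mono hr1))) hτ0.le
    have e1 : wint α τ (fun x => ‖x‖ ^ (-α - 2) * op2 b1 (pd i u) x ^ 2) ≤
        wint α τ (fun x => 2 * (‖x‖ ^ (-α - 2) * pd i (op2 b1 u) x ^ 2) +
          18 * B' ^ 2 * (‖x‖ ^ (-α - 2) * hsq u x)) := by
      refine wint_mono (((hu.pd i).op2 hO hs1).sq.rpow_mul _)
        ((((hA.pd i).sq.rpow_mul _).const_mul _).add ((hu.hsq.rpow_mul _).const_mul _))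
        fun x hx => ?_
      have := op2_pd_sq_le (B := B') hO hs1 hu i (fun j k y hy =>
        (hB i j k y (ball_subset_closedBall (pb_subset_ball _ (pb_mono hr1 hy)))).trans
          (hBB i j k)) hx
      have := mul_le_mul_of_nonneg_left this (by positivity : 0 ≤ ‖x‖ ^ (-α - 2))
      linarith
    rw [wint_add (((hA.pd i).sq.rpow_mul _).const_mul _) ((hu.hsq.rpow_mul _).const_mul _),
      wint_const_mul, wint_const_mul] at e1
    have e2 := mul_le_mul_of_nonneg_left e1 (by positivity : 0 ≤ τ * Cc)
    have e3 := mul_le_mul_of_nonneg_left s4 (by positivity : 0 ≤ Cc * (18 * B' ^ 2))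
    linarith
  have s6 : wint α τ (fun x => ‖x‖ ^ (-2 : ℝ) * dsq u x) ≤
      (Cc * (2 * Ca + 54 * B' ^ 2 * M) + M) * Y := by
    have e1 : wint α τ (fun x => ‖x‖ ^ (-2 : ℝ) * dsq u x) ≤
        ∑ i, τ * wint α τ (fun x => ‖x‖ ^ (-α - 2) * fden α τ (pd i u) x) +
        τ ^ 3 * wint α τ (fun x => ‖x‖ ^ (-3 * α - 4) * fden α τ u x) := by
      have hT : ∀ i ∈ (univ : Finset (Fin 3)),
          TF (pb r) (fun x => τ * (‖x‖ ^ (-α - 2) * fden α τ (pd i u) x)) :=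
        fun i _ => (((hu.pd i).fden.rpow_mul _).const_mul _)
      simp only [← wint_const_mul]
      rw [← wint_sum hT, ← wint_add (TF.sum hT) ((hu.fden.rpow_mul _).const_mul _)]
      exact wint_mono (hu.dsq.rpow_mul _) ((TF.sum hT).add ((hu.fden.rpow_mul _).const_mul _))
        fun x hx => dsq_le_fden (norm_pos_of_mem_pb hx) (x1 x hx) hα hτ1
    have e2 : ∑ i, τ * wint α τ (fun x => ‖x‖ ^ (-α - 2) * pd i (op2 b1 u) x ^ 2) ≤ Ca * Y := by
      rw [← mul_sum, ← wint_sum fun i _ => (hA.pd i).sq.rpow_mul _]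
      refine le_trans (le_of_eq ?_) s2
      simp only [gsq, mul_sum]
    have e3 := (sum_le_sum fun i (_ : i ∈ univ) => s5 i).trans_eq
      ((mul_sum _ _ _).symm.trans (congrArg (Cc * ·) sum_add_distrib))
    simp only [sum_const, card_univ, Fintype.card_fin, nsmul_eq_mul, Nat.cast_ofNat] at e3
    rw [← mul_sum univ _ (2 : ℝ)] at e3
    have e4 := mul_le_mul_of_nonneg_left e2 hCc
    linarith
  have s7 : wint α τ (dsq u) ≤ r ^ 2 * wint α τ (fun x => ‖x‖ ^ (-2 : ℝ) * dsq u x) := by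
    rw [← wint_const_mul]
    refine wint_mono hu.dsq ((hu.dsq.rpow_mul _).const_mul _) fun x hx => ?_
    have h0 := norm_pos_of_mem_pb hx
    rw [← mul_assoc]
    refine le_mul_of_one_le_left (dsq_nonneg u x) ?_
    rw [Real.rpow_neg h0.le, ← div_eq_mul_inv, Real.rpow_two, one_le_div (by positivity)]
    exact pow_le_pow_left₀ h0.le hx.2.le 2
  refine s7.trans ((mul_le_mul_of_nonneg_left s6 (sq_nonneg r)).trans (le_of_eq (by ring)))

end

end

section

/-- All ways of distributing the letters of a word over two subwords. -/
def splits : List (Fin 3) → List (List (Fin 3) × List (Fin 3))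
  | [] => [([], [])]
  | i :: w => (splits w).map (fun p => (i :: p.1, p.2)) ++ (splits w).map (fun p => (p.1, i :: p.2))

lemma length_of_mem_splits {w : List (Fin 3)} {p : List (Fin 3) × List (Fin 3)}
    (hp : p ∈ splits w) : p.1.length + p.2.length = w.length := by
  induction w generalizing p with
  | nil => simp only [splits, List.mem_singleton] at hp; simp [hp]
  | cons i w ih =>
    simp only [splits, List.mem_append, List.mem_map] at hp
    rcases hp with ⟨q, hq, rfl⟩ | ⟨q, hq, rfl⟩ <;> simp [← ih hq] <;> omega

lemma dw_mul {O : Set E3} {f g : E3 → ℝ} {x : E3} (hO : IsOpen O) (hf : Sm O f) (hg : Sm O g)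
    (hx : x ∈ O) (w : List (Fin 3)) :
    dw w (fun x => f x * g x) x = ((splits w).map fun p => dw p.1 f x * dw p.2 g x).sum := by
  induction w generalizing f g with
  | nil => simp [splits, dw_nil]
  | cons i w ih =>
    rw [dw_cons, dw_congr hO (((hf.pdOn i).mul hO (hg.pdOn i)).2) w hx,
      dw_add hO ((hf.pd hO i).mul hg) (hf.mul (hg.pd hO i)) hx, ih (hf.pd hO i) hg,
      ih hf (hg.pd hO i)]
    simp [splits, Function.comp_def, dw_cons]

lemma splits_sum_eq (w : List (Fin 3)) (G : List (Fin 3) × List (Fin 3) → ℝ) :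
    ((splits w).map G).sum = G ([], w) +
        ((splits w).map fun p => if p.1 = [] then 0 else G p).sum := by
  induction w generalizing G with
  | nil => simp [splits]
  | cons i w ih =>
    have h := ih fun p => G (p.1, i :: p.2)
    simp only [splits, List.map_append, List.map_map, Function.comp_def, List.sum_append,
      reduceCtorEq, if_false]
    rw [h]; ring

lemma splits_sum_length (w : List (Fin 3)) (F : ℕ → ℕ → ℝ) :
    ((splits w).map fun p => F p.1.length p.2.length).sum =
      ∑ p ∈ antidiagonal w.length, (w.length.choose p.1 : ℝ) * F p.1 p.2 := by
  induction w generalizing F with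
  | nil => simp [splits]
  | cons i w ih =>
    have h1 := ih fun a b => F (a + 1) b
    have h2 := ih fun a b => F a (b + 1)
    simp only [splits, List.map_append, List.map_map, Function.comp_def, List.sum_append,
      List.length_cons]
    rw [h1, h2, Finset.sum_antidiagonal_choose_succ_mul, add_comm]
    refine congrArg₂ _ rfl (sum_congr rfl fun p hp => ?_)
    rw [Nat.choose_symm_of_eq_add (HasAntidiagonal.mem_antidiagonal.1 hp).symm]

lemma list_sum_abs_le {ι : Type*} (l : List ι) (f : ι → ℝ) :
    |(l.map f).sum| ≤ (l.map fun p => |f p|).sum := by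
  induction l with
  | nil => simp
  | cons a l ih => simpa using (abs_add_le _ _).trans (add_le_add le_rfl ih)

lemma list_sum_le {ι : Type*} {l : List ι} {f g : ι → ℝ} (h : ∀ p ∈ l, f p ≤ g p) :
    (l.map f).sum ≤ (l.map g).sum := List.sum_le_sum h

section
variable {s : ℝ}

lemma choose_mul_factorial_rpow_le (hs : 1 ≤ s) (a b : ℕ) :
    ((a + b).choose a : ℝ) * ((a.factorial : ℝ) ^ s * (b.factorial : ℝ) ^ s) ≤
      ((a + b).factorial : ℝ) ^ s := by
  have h1 : ((a + b).choose a : ℝ) ≤ ((a + b).choose a : ℝ) ^ s := by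
    have : (1 : ℝ) ≤ (a + b).choose a := by
      exact_mod_cast Nat.choose_pos (Nat.le_add_right a b)
    calc ((a + b).choose a : ℝ) = ((a + b).choose a : ℝ) ^ (1 : ℝ) := (Real.rpow_one _).symm
      _ ≤ _ := Real.rpow_le_rpow_of_exponent_le this hs
  refine (mul_le_mul_of_nonneg_right h1 (by positivity)).trans (le_of_eq ?_)
  rw [← Real.mul_rpow (by positivity) (by positivity),
      ← Real.mul_rpow (by positivity) (by positivity)]
  congr 1
  have := Nat.choose_mul_factorial_mul_factorial (Nat.le_add_right a b)
  rw [Nat.add_sub_cancel_left, mul_assoc] at this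
  exact_mod_cast this

lemma factorial_rpow_mono (hs : 1 ≤ s) {a b : ℕ} (h : a ≤ b) :
    (a.factorial : ℝ) ^ s ≤ (b.factorial : ℝ) ^ s :=
  Real.rpow_le_rpow (by positivity) (by exact_mod_cast Nat.factorial_le h) (by linarith)

/-- Gevrey bounds with explicit constants, for all words. -/
structure Gv (s : ℝ) (O : Set E3) (c A : ℝ) (f : E3 → ℝ) : Prop where
  sm : Sm O f
  c_nonneg : 0 ≤ c
  A_nonneg : 0 ≤ A
  bound : ∀ w, ∀ x ∈ O, |dw w f x| ≤ c * A ^ w.length * (w.length.factorial : ℝ) ^ s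

/-- Gevrey bounds for all words, with unspecified constants. -/
def GevB (s : ℝ) (O : Set E3) (f : E3 → ℝ) : Prop := ∃ c A, Gv s O c A f

variable {O : Set E3} {f g : E3 → ℝ} {c A c' A' : ℝ}

lemma Gv.mono (h : Gv s O c A f) (hc : c ≤ c') (hA : A ≤ A') : Gv s O c' A' f where
  sm := h.sm
  c_nonneg := h.c_nonneg.trans hc
  A_nonneg := h.A_nonneg.trans hA
  bound w x hx := (h.bound w x hx).trans (mul_le_mul_of_nonneg_right
    (mul_le_mul hc (pow_le_pow_left₀ h.A_nonneg hA _) (pow_nonneg h.A_nonneg _)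
      (h.c_nonneg.trans hc)) (by positivity))

lemma Gv.abs_le (h : Gv s O c A f) {x : E3} (hx : x ∈ O) : |f x| ≤ c := by
  simpa [dw_nil] using h.bound [] x hx

lemma GevB.sm (h : GevB s O f) : Sm O f := h.choose_spec.choose_spec.sm

lemma GevB.add (hO : IsOpen O) (hf : GevB s O f) (hg : GevB s O g) :
    GevB s O (fun x => f x + g x) := by
  obtain ⟨c, A, hf⟩ := hf
  obtain ⟨c', A', hg⟩ := hg
  refine ⟨c + c', max A A', hf.sm.add hg.sm, add_nonneg hf.c_nonneg hg.c_nonneg,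
    hf.A_nonneg.trans (le_max_left _ _), fun w x hx => ?_⟩
  rw [dw_add hO hf.sm hg.sm hx]
  have h1 := (hf.mono le_rfl (le_max_left A A')).bound w x hx
  have h2 := (hg.mono le_rfl (le_max_right A A')).bound w x hx
  have := abs_add_le (dw w f x) (dw w g x)
  linarith

lemma GevB.mul (hO : IsOpen O) (hs : 1 ≤ s) (hf : GevB s O f) (hg : GevB s O g) :
    GevB s O (fun x => f x * g x) := by
  obtain ⟨c, A, hf⟩ := hf
  obtain ⟨c', A', hg⟩ := hg
  have := hf.c_nonneg; have := hg.c_nonneg; have := hf.A_nonneg; have := hg.A_nonneg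
  refine ⟨c * c', A + A', hf.sm.mul hg.sm, by positivity, by positivity, fun w x hx => ?_⟩
  rw [dw_mul hO hf.sm hg.sm hx]
  set F : ℕ → ℕ → ℝ := fun a b => (c * A ^ a * (a.factorial : ℝ) ^ s) *
    (c' * A' ^ b * (b.factorial : ℝ) ^ s) with hF
  have h1 : ((splits w).map fun p => |dw p.1 f x * dw p.2 g x|).sum ≤
      ((splits w).map fun p => F p.1.length p.2.length).sum := list_sum_le fun p _ => by
    rw [abs_mul]
    exact mul_le_mul (hf.bound _ x hx) (hg.bound _ x hx) (abs_nonneg _) (by positivity)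
  refine (list_sum_abs_le _ _).trans (h1.trans ?_)
  rw [splits_sum_length]
  have h2 : ∀ p ∈ antidiagonal w.length, (w.length.choose p.1 : ℝ) * F p.1 p.2 ≤
      c * c' * (w.length.factorial : ℝ) ^ s * (A ^ p.1 * A' ^ p.2 * (w.length.choose p.1 : ℝ)) := by
    intro p hp
    rw [HasAntidiagonal.mem_antidiagonal] at hp
    have h3 := choose_mul_factorial_rpow_le hs p.1 p.2
    rw [hp] at h3
    have h4 : (1 : ℝ) ≤ w.length.choose p.1 := by
      exact_mod_cast Nat.choose_pos (by omega)
    calc (w.length.choose p.1 : ℝ) * F p.1 p.2 = (c * c' * A ^ p.1 * A' ^ p.2) *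
        ((w.length.choose p.1 : ℝ) * ((p.1.factorial : ℝ) ^ s * (p.2.factorial : ℝ) ^ s)) := by
          rw [hF]; ring
      _ ≤ (c * c' * A ^ p.1 * A' ^ p.2) * (w.length.factorial : ℝ) ^ s :=
          mul_le_mul_of_nonneg_left h3 (by positivity)
      _ ≤ (c * c' * A ^ p.1 * A' ^ p.2) * (w.length.factorial : ℝ) ^ s * w.length.choose p.1 :=
          le_mul_of_one_le_right (by positivity) h4
      _ = _ := by ring
  refine (sum_le_sum h2).trans (le_of_eq ?_)
  rw [← mul_sum, (Commute.all A A').add_pow']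
  simp only [nsmul_eq_mul]
  rw [mul_right_comm]
  congr 1
  congr 1
  exact sum_congr rfl fun p _ => by ring

lemma GevB.pd (hO : IsOpen O) (hs : 1 ≤ s) (hf : GevB s O f) (i : Fin 3) : GevB s O (pd i f) := by
  obtain ⟨c, A, hf⟩ := hf
  have := hf.c_nonneg; have := hf.A_nonneg
  refine ⟨c * A, A * 2 ^ s, hf.sm.pd hO i, by positivity, by positivity, fun w x hx => ?_⟩
  rw [← dw_cons]
  refine (hf.bound _ x hx).trans ?_
  rw [List.length_cons, Nat.factorial_succ, Nat.cast_mul,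
      Real.mul_rpow (by positivity) (by positivity)]
  have h1 : ((w.length + 1 : ℕ) : ℝ) ^ s ≤ (2 ^ s) ^ w.length := by
    rw [← Real.rpow_natCast, ← Real.rpow_mul (by norm_num), mul_comm, Real.rpow_mul (by norm_num)]
    refine Real.rpow_le_rpow (by positivity) ?_ (by linarith)
    rw [Real.rpow_natCast]
    exact_mod_cast Nat.lt_two_pow_self
  calc c * A ^ (w.length + 1) * (((w.length + 1 : ℕ) : ℝ) ^ s * (w.length.factorial : ℝ) ^ s)
      = (c * A ^ (w.length + 1) * (w.length.factorial : ℝ) ^ s) * ((w.length + 1 : ℕ) : ℝ) ^ s := by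
        ring
    _ ≤ (c * A ^ (w.length + 1) * (w.length.factorial : ℝ) ^ s) * (2 ^ s) ^ w.length :=
        mul_le_mul_of_nonneg_left h1 (by positivity)
    _ = _ := by rw [mul_pow]; ring

lemma GevB.const (a : ℝ) : GevB s O (fun _ => a) :=
  ⟨|a|, 0, Sm.const a, abs_nonneg a, le_rfl, fun w x _ => by
    rcases eq_or_ne w [] with rfl | hw
    · simp [dw_nil]
    · rw [dw_const a w hw, abs_zero]; positivity⟩

end

section
variable {s : ℝ} {O : Set E3} {n : ℕ} {T T' : (E3 → ℝ) → E3 → ℝ}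

/-- `T` is a linear differential operator of order at most `n` with Gevrey coefficients. -/
def IsDO (s : ℝ) (O : Set E3) (n : ℕ) (T : (E3 → ℝ) → E3 → ℝ) : Prop :=
  ∃ l : List ((E3 → ℝ) × List (Fin 3)), (∀ p ∈ l, GevB s O p.1 ∧ p.2.length ≤ n) ∧
    ∀ f, Sm O f → ∀ x ∈ O, T f x = (l.map fun p => p.1 x * dw p.2 f x).sum

lemma IsDO.id : IsDO s O 0 (fun f => f) :=
  ⟨[(fun _ => 1, [])], by simp [GevB.const], fun f _ x _ => by simp [dw_nil]⟩

lemma IsDO.zero : IsDO s O n (fun _ _ => 0) := ⟨[], by simp, by simp⟩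

lemma IsDO.add (h : IsDO s O n T) (h' : IsDO s O n T') :
    IsDO s O n (fun f x => T f x + T' f x) := by
  obtain ⟨l, hl, h⟩ := h
  obtain ⟨l', hl', h'⟩ := h'
  refine ⟨l ++ l', fun p hp => ?_, fun f hf x hx => ?_⟩
  · rcases List.mem_append.1 hp with hp | hp
    exacts [hl p hp, hl' p hp]
  · beta_reduce
    rw [h f hf x hx, h' f hf x hx]; simp

lemma IsDO.sum {ι : Type*} {t : Finset ι} {F : ι → (E3 → ℝ) → E3 → ℝ}
    (h : ∀ i ∈ t, IsDO s O n (F i)) : IsDO s O n (fun f x => ∑ i ∈ t, F i f x) := by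
  classical
  induction t using Finset.induction_on with
  | empty => simpa using IsDO.zero
  | insert a t ha ih =>
    simp only [sum_insert ha]
    exact (h a (mem_insert_self a t)).add (ih fun i hi => h i (mem_insert_of_mem hi))

lemma IsDO.coef_mul (hO : IsOpen O) (hs : 1 ≤ s) {a : E3 → ℝ} (ha : GevB s O a) (h : IsDO s O n T) :
    IsDO s O n (fun f x => a x * T f x) := by
  obtain ⟨l, hl, h⟩ := h
  refine ⟨l.map fun p => (fun x => a x * p.1 x, p.2), fun p hp => ?_, fun f hf x hx => ?_⟩
  · obtain ⟨q, hq, rfl⟩ := List.mem_map.1 hp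
    exact ⟨ha.mul hO hs (hl q hq).1, (hl q hq).2⟩
  · beta_reduce
    rw [h f hf x hx, ← List.sum_map_mul_left]
    simp [Function.comp_def, mul_assoc]

lemma PdOn.list_sum (hO : IsOpen O) {ι : Type*} (l : List ι) {F F' : ι → E3 → ℝ} {i : Fin 3}
    (h : ∀ j ∈ l, PdOn O i (F j) (F' j)) :
    PdOn O i (fun x => (l.map fun j => F j x).sum) (fun x => (l.map fun j => F' j x).sum) := by
  induction l with
  | nil => simpa using PdOn.const 0
  | cons a l ih =>
    simp only [List.map_cons, List.sum_cons]
    exact (h a (by simp)).add hO (ih fun j hj => h j (by simp [hj]))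

lemma IsDO.pd (hO : IsOpen O) (hs : 1 ≤ s) (h : IsDO s O n T) (i : Fin 3) :
    IsDO s O (n + 1) (fun f => pd i (T f)) := by
  obtain ⟨l, hl, h⟩ := h
  refine ⟨(l.map fun p => (_root_.pd i p.1, p.2)) ++ (l.map fun p => (p.1, p.2 ++ [i])),
    fun p hp => ?_, fun f hf x hx => ?_⟩
  · rcases List.mem_append.1 hp with hp | hp
    · obtain ⟨q, hq, rfl⟩ := List.mem_map.1 hp
      exact ⟨(hl q hq).1.pd hO hs i, (hl q hq).2.trans (Nat.le_succ n)⟩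
    · obtain ⟨q, hq, rfl⟩ := List.mem_map.1 hp
      exact ⟨(hl q hq).1, by simpa using (hl q hq).2⟩
  · beta_reduce
    rw [pd_congr hO (fun y hy => h f hf y hy) i hx]
    have := (PdOn.list_sum hO l (F := fun p x => p.1 x * dw p.2 f x) (i := i)
      (fun p hp => ((hl p hp).1.sm.pdOn i).mul hO ((hf.dw hO p.2).pdOn i))).2 x hx
    rw [this, List.map_append, List.sum_append, List.map_map, List.map_map]
    beta_reduce
    rw [List.sum_map_add]
    simp [Function.comp_def, dw_append, dw_cons, dw_nil]

lemma IsDO.op2 (hO : IsOpen O) (hs : 1 ≤ s) {b : Fin 3 → Fin 3 → E3 → ℝ}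
    (hb : ∀ j k, GevB s O (b j k)) (h : IsDO s O n T) : IsDO s O (n + 2) (fun f => op2 b (T f)) :=
  IsDO.sum fun j _ => IsDO.sum fun k _ => IsDO.coef_mul hO hs (hb j k) ((h.pd hO hs k).pd hO hs j)

end

end

section

section
variable {O : Set E3} {f g u : E3 → ℝ} {a b c : ℝ}

lemma TF.memLp (hf : TF O f) : MemLp f 2 volume :=
  hf.smooth.continuous.memLp_of_hasCompactSupport hf.cpt

lemma TF.lpNorm_sq (hf : TF O f) : lpNorm f 2 volume ^ 2 = ∫ x, f x ^ 2 := by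
  rw [lpNorm_eq_integral_norm_rpow_toReal (by norm_num) (by norm_num)
    hf.memLp.aestronglyMeasurable]
  have h : (∫ x, ‖f x‖ ^ (2 : ENNReal).toReal) = ∫ x, f x ^ 2 :=
    integral_congr_ae (Filter.Eventually.of_forall fun x => by
      simp)
  rw [h, ← Real.rpow_natCast, ← Real.rpow_mul (integral_nonneg fun _ => sq_nonneg _)]
  norm_num

/-- `f` is a test function on `O` with `L²` norm at most `a`. -/
structure NB (O : Set E3) (f : E3 → ℝ) (a : ℝ) : Prop where
  tf : TF O f
  le : lpNorm f 2 volume ≤ a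

lemma NB.nonneg (h : NB O f a) : 0 ≤ a := lpNorm_nonneg.trans h.le

lemma NB.integral_le (h : NB O f a) : ∫ x, f x ^ 2 ≤ a ^ 2 := by
  rw [← h.tf.lpNorm_sq]
  exact pow_le_pow_left₀ lpNorm_nonneg h.le 2

lemma TF.nb (hf : TF O f) (ha : 0 ≤ a) (h : ∫ x, f x ^ 2 ≤ a ^ 2) : NB O f a :=
  ⟨hf, by rw [← hf.lpNorm_sq] at h; exact le_of_sq_le_sq h ha⟩

lemma TF.nb_lpNorm (hf : TF O f) : NB O f (lpNorm f 2 volume) := ⟨hf, le_rfl⟩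

lemma NB.mono (h : NB O f a) (hab : a ≤ b) : NB O f b := ⟨h.tf, h.le.trans hab⟩

lemma NB.zero : NB O (fun _ => 0) 0 := ⟨TF.zero, by simp⟩

lemma NB.add (hf : NB O f a) (hg : NB O g b) : NB O (fun x => f x + g x) (a + b) :=
  ⟨hf.tf.add hg.tf, (lpNorm_add_le (g := g) hf.tf.memLp (by norm_num)).trans
    (add_le_add hf.le hg.le)⟩

lemma NB.neg (hf : NB O f a) : NB O (fun x => - f x) a :=
  ⟨hf.tf.neg, by simpa using hf.le⟩

lemma NB.sub (hf : NB O f a) (hg : NB O g b) : NB O (fun x => f x - g x) (a + b) := by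
  simpa only [sub_eq_add_neg] using hf.add hg.neg

lemma NB.sum {ι : Type*} {t : Finset ι} {F : ι → E3 → ℝ} {A : ι → ℝ}
    (h : ∀ i ∈ t, NB O (F i) (A i)) : NB O (fun x => ∑ i ∈ t, F i x) (∑ i ∈ t, A i) := by
  classical
  induction t using Finset.induction_on with
  | empty => simpa using NB.zero
  | insert i t hi ih =>
    simp only [sum_insert hi]
    exact (h i (mem_insert_self _ _)).add (ih fun j hj => h j (mem_insert_of_mem hj))

lemma NB.list_sum {ι : Type*} {l : List ι} {F : ι → E3 → ℝ} {A : ι → ℝ}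
    (h : ∀ i ∈ l, NB O (F i) (A i)) :
    NB O (fun x => (l.map fun i => F i x).sum) (l.map A).sum := by
  induction l with
  | nil => simpa using NB.zero
  | cons i l ih =>
    simp only [List.map_cons, List.sum_cons]
    exact (h i (by simp)).add (ih fun j hj => h j (by simp [hj]))

lemma NB.dom (hg : NB O g a) (hf : TF O f) (hc : 0 ≤ c) (h : ∀ x, |f x| ≤ c * |g x|) :
    NB O f (c * a) := by
  refine hf.nb (mul_nonneg hc hg.nonneg) ?_
  calc ∫ x, f x ^ 2 ≤ ∫ x, c ^ 2 * g x ^ 2 := by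
        refine hf.sq.integral_mono (hg.tf.sq.const_mul _) fun x => ?_
        have := pow_le_pow_left₀ (abs_nonneg _) (h x) 2
        rwa [mul_pow, sq_abs, sq_abs] at this
    _ ≤ _ := by
        rw [integral_const_mul, mul_pow]
        exact mul_le_mul_of_nonneg_left hg.integral_le (sq_nonneg _)

lemma NB.congr (hf : NB O f a) (h : ∀ x, g x = f x) : NB O g a := by
  rwa [show g = f from funext h]

end

section
variable {O : Set E3} {b : Fin 3 → Fin 3 → E3 → ℝ} {u : E3 → ℝ} {B : ℝ}

lemma op2_sq_le {x : E3} (hB : ∀ j k, |b j k x| ≤ B) : op2 b u x ^ 2 ≤ 9 * B ^ 2 * hsq u x := by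
  refine (sq_sum_sum_le hB).trans (le_of_eq ?_)
  rw [sum_comm]
  rfl

lemma pd_op2 (hO : IsOpen O) (hb : ∀ j k, Sm O (b j k)) (hu : TF O u) (i : Fin 3) {x : E3}
    (hx : x ∈ O) :
    pd i (op2 b u) x = op2 b (pd i u) x + op2 (fun j k => pd i (b j k)) u x := by
  have h : PdOn O i (op2 b u) (fun x => ∑ j, ∑ k, (pd i (b j k) x * pd j (pd k u) x +
      b j k x * pd i (pd j (pd k u)) x)) :=
    PdOn.sum hO fun j _ => PdOn.sum hO fun k _ =>
      ((hb j k).pdOn i).mul hO ((((hu.pd k).pd j).sm O).pdOn i)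
  rw [h.2 x hx]
  unfold op2
  rw [← sum_add_distrib]
  refine sum_congr rfl fun j _ => ?_
  rw [← sum_add_distrib]
  refine sum_congr rfl fun k _ => ?_
  rw [(hu.pd k).comm i j, hu.comm i k]
  ring

lemma hsq_pd_le (u : E3 → ℝ) (i : Fin 3) (x : E3) : hsq (pd i u) x ≤ tsq u x :=
  single_le_sum (f := fun i => hsq (pd i u) x) (fun _ _ => hsq_nonneg _ _) (mem_univ i)

lemma pd_pd_sq_le (u : E3 → ℝ) (i j : Fin 3) (x : E3) : pd i (pd j u) x ^ 2 ≤ hsq u x := by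
  have h1 : pd i (pd j u) x ^ 2 ≤ gsq (pd j u) x :=
    single_le_sum (f := fun i => pd i (pd j u) x ^ 2) (fun _ _ => sq_nonneg _) (mem_univ i)
  exact h1.trans
    (single_le_sum (f := fun j => gsq (pd j u) x) (fun _ _ => gsq_nonneg _ _) (mem_univ j))

lemma op2_pd_pd_sq_le (hO : IsOpen O) (hb : ∀ j k, Sm O (b j k)) (hu : TF O u) (i j : Fin 3)
    (hB1 : ∀ i j k, ∀ x ∈ O, |pd i (b j k) x| ≤ B)
    (hB2 : ∀ i i' j k, ∀ x ∈ O, |pd i (pd i' (b j k)) x| ≤ B) (x : E3) :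
    op2 b (pd i (pd j u)) x ^ 2 ≤ 6 * hsq (op2 b u) x + 72 * B ^ 2 * dsq u x := by
  by_cases hx : x ∈ O
  swap
  · rw [(((hu.pd j).pd i).op2 hO hb).zero_of_notMem hx]
    have := hsq_nonneg (op2 b u) x
    have := dsq_nonneg u x
    rw [zero_pow two_ne_zero]
    positivity
  have h1 := op2_pd_sq_le hO hb (hu.pd j) i (hB1 i) hx
  have hb' : ∀ l k, Sm O (pd j (b l k)) := fun l k => (hb l k).pd hO j
  have h2 : pd i (op2 b (pd j u)) x = pd i (pd j (op2 b u)) x -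
      (op2 (fun l k => pd j (b l k)) (pd i u) x +
        op2 (fun l k => pd i (pd j (b l k))) u x) := by
    rw [← pd_op2 hO hb' hu i hx]
    have := PdOn.sub hO (((hu.op2 hO hb).pd j).sm O |>.pdOn i) ((hu.op2 hO hb').sm O |>.pdOn i)
    refine Eq.trans ?_ (this.2 x hx)
    exact pd_congr hO (fun y hy => by rw [pd_op2 hO hb hu j hy]; ring) i hx
  have h3 : op2 (fun l k => pd j (b l k)) (pd i u) x ^ 2 ≤ 9 * B ^ 2 * hsq (pd i u) x :=
    op2_sq_le fun l k => hB1 j l k x hx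
  have h4 : op2 (fun l k => pd i (pd j (b l k))) u x ^ 2 ≤ 9 * B ^ 2 * hsq u x :=
    op2_sq_le fun l k => hB2 i j l k x hx
  have h5 := pd_pd_sq_le (op2 b u) i j x
  have h6 := mul_le_mul_of_nonneg_left (hsq_pd_le u i x) (sq_nonneg B)
  have h6' := mul_le_mul_of_nonneg_left (hsq_pd_le u j x) (sq_nonneg B)
  have h7 : B ^ 2 * (tsq u x + hsq u x) ≤ B ^ 2 * dsq u x := by
    refine mul_le_mul_of_nonneg_left ?_ (sq_nonneg B)
    have := gsq_nonneg u x
    have := sq_nonneg (u x)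
    unfold dsq; linarith
  have h8 := mul_nonneg (sq_nonneg B) (hsq_nonneg u x)
  have h9 : ∀ p q r : ℝ, (p - (q + r)) ^ 2 ≤ 3 * (p ^ 2 + q ^ 2 + r ^ 2) := fun p q r => by
    nlinarith [sq_nonneg (p + q), sq_nonneg (p + r), sq_nonneg (q - r)]
  rw [h2] at h1
  have h10 := h9 (pd i (pd j (op2 b u)) x) (op2 (fun l k => pd j (b l k)) (pd i u) x)
    (op2 (fun l k => pd i (pd j (b l k))) u x)
  linarith

lemma integral_dsq_le {a : ℝ} (hu : TF O u)
    (h : ∀ v : List (Fin 3), v.length ≤ 3 → NB O (dw v u) a) :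
    ∫ x, dsq u x ≤ 40 * a ^ 2 := by
  have e0 := (h [] (by simp)).integral_le
  have i1 : ∀ v, TF O v → ∫ x, gsq v x = ∑ i, ∫ x, pd i v x ^ 2 := fun v hv =>
    integral_finsetSum _ fun i _ => (hv.pd i).sq.integrable
  have i2 : ∀ v, TF O v → ∫ x, hsq v x = ∑ i, ∫ x, gsq (pd i v) x := fun v hv =>
    integral_finsetSum _ fun i _ => (hv.pd i).gsq.integrable
  have i3 : ∀ v, TF O v → ∫ x, tsq v x = ∑ i, ∫ x, hsq (pd i v) x := fun v hv =>
    integral_finsetSum _ fun i _ => (hv.pd i).hsq.integrable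
  have e1 : ∫ x, gsq u x ≤ 3 * a ^ 2 := by
    rw [i1 u hu]
    calc _ ≤ ∑ i : Fin 3, a ^ 2 := sum_le_sum fun i _ => (h [i] (by simp)).integral_le
      _ = _ := by simp
  have e2 : ∫ x, hsq u x ≤ 9 * a ^ 2 := by
    rw [i2 u hu]
    calc _ ≤ ∑ i : Fin 3, ∑ j : Fin 3, a ^ 2 := sum_le_sum fun i _ => by
          rw [i1 _ (hu.pd i)]
          exact sum_le_sum fun j _ => (h [i, j] (by simp)).integral_le
      _ = _ := by simp; ring
  have e3 : ∫ x, tsq u x ≤ 27 * a ^ 2 := by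
    rw [i3 u hu]
    calc _ ≤ ∑ i : Fin 3, ∑ j : Fin 3, ∑ k : Fin 3, a ^ 2 := sum_le_sum fun i _ => by
          rw [i2 _ (hu.pd i)]
          refine sum_le_sum fun j _ => ?_
          rw [i1 _ ((hu.pd i).pd j)]
          exact sum_le_sum fun k _ => (h [i, j, k] (by simp)).integral_le
      _ = _ := by simp; ring
  have e : ∫ x, dsq u x = (∫ x, tsq u x) + (∫ x, hsq u x) + (∫ x, gsq u x) + ∫ x, u x ^ 2 := by
    unfold dsq
    rw [integral_add (hu.tsq.add hu.hsq |>.add hu.gsq).integrable hu.sq.integrable,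
      integral_add (hu.tsq.add hu.hsq).integrable hu.gsq.integrable,
      integral_add hu.tsq.integrable hu.hsq.integrable]
  rw [e]
  have : dw [] u = u := rfl
  rw [this] at e0
  linarith

lemma elliptic_fourth {b1 b2 : Fin 3 → Fin 3 → E3 → ℝ} {c1 c2 : ℝ} (hc1 : 0 < c1) (hc2 : 0 < c2)
    (hell1 : ∀ ξ : Fin 3 → ℝ, c1 * ∑ i, ξ i ^ 2 ≤ ∑ j, ∑ k, b1 j k 0 * ξ j * ξ k)
    (hell2 : ∀ ξ : Fin 3 → ℝ, c2 * ∑ i, ξ i ^ 2 ≤ ∑ j, ∑ k, b2 j k 0 * ξ j * ξ k)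
    (hO : IsOpen O) (hb1 : ∀ j k, Sm O (b1 j k)) (hb2 : ∀ j k, Sm O (b2 j k))
    (hclose1 : ∀ j k, ∀ x ∈ O, |b1 j k x - b1 j k 0| ≤ c1 / 11)
    (hclose2 : ∀ j k, ∀ x ∈ O, |b2 j k x - b2 j k 0| ≤ c2 / 11)
    (hB1 : ∀ i j k, ∀ x ∈ O, |pd i (b1 j k) x| ≤ B)
    (hB2 : ∀ i i' j k, ∀ x ∈ O, |pd i (pd i' (b1 j k)) x| ≤ B) :
    ∃ C ≥ 0, ∀ g, TF O g → ∀ a, NB O (op2 b2 (op2 b1 g)) a →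
      (∀ v : List (Fin 3), v.length ≤ 3 → NB O (dw v g) a) →
      ∀ u : List (Fin 3), u.length = 4 → NB O (dw u g) (C * a) := by
  set H1 := 12 / c1 ^ 2
  set H2 := 12 / c2 ^ 2
  have hH1 : 0 ≤ H1 := by positivity
  have hH2 : 0 ≤ H2 := by positivity
  set D := H1 * (6 * H2 + 2880 * B ^ 2)
  have hD : 0 ≤ D := by positivity
  refine ⟨√D, Real.sqrt_nonneg _, fun g hg a hL hlow u hu => ?_⟩
  obtain ⟨p, q, r, t, rfl⟩ : ∃ p q r t, u = [p, q, r, t] := by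
    match u, hu with
    | [p, q, r, t], _ => exact ⟨p, q, r, t, rfl⟩
  have hA := hg.op2 hO hb1
  have hw := (hg.pd p).pd q
  refine (hg.dw _).nb (mul_nonneg (Real.sqrt_nonneg _) hL.nonneg) ?_
  rw [mul_pow, Real.sq_sqrt hD]
  have e1 := integral_hsq_le_of_close hc2 hell2 hO hb2 hclose2 hA
  have e2 := integral_hsq_le_of_close hc1 hell1 hO hb1 hclose1 hw
  have e3 : ∫ x, op2 b1 (pd q (pd p g)) x ^ 2 ≤
      6 * (∫ x, hsq (op2 b1 g) x) + 72 * B ^ 2 * ∫ x, dsq g x := by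
    rw [← integral_const_mul, ← integral_const_mul,
      ← integral_add (hA.hsq.const_mul _).integrable (hg.dsq.const_mul _).integrable]
    exact (hw.op2 hO hb1).sq.integral_mono ((hA.hsq.const_mul _).add (hg.dsq.const_mul _))
      fun x => op2_pd_pd_sq_le hO hb1 hg q p hB1 hB2 x
  have e4 := integral_dsq_le hg hlow
  have e5 := hL.integral_le
  have e6 : ∫ x, dw [p, q, r, t] g x ^ 2 ≤ ∫ x, hsq (pd q (pd p g)) x :=
    (hg.dw _).sq.integral_mono hw.hsq fun x => pd_pd_sq_le _ t r x
  calc _ ≤ H1 * ∫ x, op2 b1 (pd q (pd p g)) x ^ 2 := e6.trans e2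
    _ ≤ H1 * (6 * (H2 * a ^ 2) + 72 * B ^ 2 * (40 * a ^ 2)) := by
        refine mul_le_mul_of_nonneg_left (e3.trans ?_) hH1
        have := e1.trans (mul_le_mul_of_nonneg_left e5 hH2)
        have := mul_le_mul_of_nonneg_left e4 (by positivity : 0 ≤ 72 * B ^ 2)
        linarith
    _ = _ := by ring

end

end

section

lemma exists_uniform_bound {ι : Type*} {S : Set ι} (hS : S.Finite) {P : ι → ℝ → Prop}
    (hP : ∀ i D D', D ≤ D' → P i D → P i D') (h : ∀ i ∈ S, ∃ D, P i D) (D0 : ℝ) :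
    ∃ D ≥ D0, ∀ i ∈ S, P i D := by
  induction S, hS using Set.Finite.induction_on with
  | empty => exact ⟨D0, le_rfl, by simp⟩
  | @insert i S _ _ ih =>
    obtain ⟨D, hD, h1⟩ := ih fun j hj => h j (Set.mem_insert_of_mem _ hj)
    obtain ⟨D', h2⟩ := h i (Set.mem_insert _ _)
    refine ⟨max D D', hD.trans (le_max_left _ _), fun j hj => ?_⟩
    rcases hj with rfl | hj
    · exact hP _ _ _ (le_max_right _ _) h2
    · exact hP _ _ _ (le_max_left _ _) (h1 j hj)

section
variable {O : Set E3} {χ f u : E3 → ℝ}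

lemma TF.exists_bound (hu : TF O u) : ∃ D, ∀ x, |u x| ≤ D :=
  hu.cpt.exists_bound_of_continuous hu.smooth.continuous

lemma TF.exists_dw_bound (hu : TF O u) (L : ℕ) :
    ∃ D ≥ 0, ∀ v : List (Fin 3), v.length ≤ L → ∀ x, |_root_.dw v u x| ≤ D :=
  exists_uniform_bound (List.finite_length_le (Fin 3) L)
    (P := fun v D => ∀ x, |_root_.dw v u x| ≤ D)
    (fun _ _ _ h h' x => (h' x).trans h) (fun v _ => (hu.dw v).exists_bound) 0

lemma TF.pow_succ (hu : TF O u) (n : ℕ) : TF O (fun x => u x ^ (n + 1)) := by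
  induction n with
  | zero => simpa using hu
  | succ n ih => simpa only [_root_.pow_succ _ (n + 1)] using ih.mul hu

lemma TF.mul_sm (hO : IsOpen O) (hu : TF O u) (hf : Sm O f) : TF O (fun x => u x * f x) := by
  simpa only [mul_comm] using hu.smul hO hf

lemma length_splits (w : List (Fin 3)) : (splits w).length = 2 ^ w.length := by
  induction w with
  | nil => rfl
  | cons i w ih => simp [splits, ih, pow_succ]; ring

lemma pow_dw_bound (hχ : TF O χ) (h0 : ∀ x, 0 ≤ χ x) (h1 : ∀ x, χ x ≤ 1) (L : ℕ) :
    ∃ D ≥ 1, ∀ v : List (Fin 3), v.length ≤ L → ∀ (n : ℕ) (x : E3),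
      |dw v (fun y => χ y ^ n) x| ≤ D * (n : ℝ) ^ v.length * χ x ^ (n - v.length) := by
  induction L with
  | zero =>
    refine ⟨1, le_rfl, fun v hv n x => ?_⟩
    obtain rfl : v = [] := List.eq_nil_of_length_eq_zero (by omega)
    simp [dw_nil, abs_of_nonneg (h0 x)]
  | succ L ih =>
    obtain ⟨D, hD, hb⟩ := ih
    obtain ⟨B, hB, hχB⟩ := hχ.exists_dw_bound (L + 1)
    have hD0 : 0 ≤ D := by linarith
    have hLB : 0 ≤ 2 ^ L * B := mul_nonneg (by positivity) hB
    have hD1 : 1 ≤ D * (1 + 2 ^ L * B) := by nlinarith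
    refine ⟨D * (1 + 2 ^ L * B), hD1, fun v hv n x => ?_⟩
    match v, n with
    | [], n =>
      simp only [dw_nil, List.length_nil, pow_zero, mul_one, Nat.sub_zero,
        abs_of_nonneg (pow_nonneg (h0 x) n)]
      exact le_mul_of_one_le_left (pow_nonneg (h0 x) n) hD1
    | i :: v, 0 =>
      simp only [pow_zero]
      rw [dw_const _ _ (by simp)]
      simp
    | i :: v, n + 1 =>
      have hv' : v.length ≤ L := by simpa using hv
      have e : dw (i :: v) (fun y => χ y ^ (n + 1)) x =
          dw v (fun y => (n + 1 : ℝ) * (χ y ^ n * pd i χ y)) x := by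
        rw [dw_cons]
        refine dw_congr isOpen_univ (fun y _ => ?_) v (Set.mem_univ x)
        have := (((hχ.sm Set.univ).pdOn i).comp isOpen_univ (φ := fun t => t ^ (n + 1))
          (φ' := fun t => (n + 1 : ℝ) * t ^ n) (s := Set.univ)
          (fun y _ => ⟨(contDiff_id.pow (n + 1)).contDiffAt, by
            simpa using hasDerivAt_pow (n + 1) y⟩) (fun _ _ => Set.mem_univ _)).2 y (Set.mem_univ y)
        rw [this]; ring
      have s1 : Sm Set.univ (fun y => χ y ^ n) := (hχ.sm Set.univ).pow n
      have s2 : Sm Set.univ (pd i χ) := (hχ.pd i).sm _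
      rw [e, dw_const_mul isOpen_univ (s1.mul s2) (Set.mem_univ x),
        dw_mul isOpen_univ s1 s2 (Set.mem_univ x), abs_mul, abs_of_nonneg (by positivity)]
      have key : ∀ p ∈ splits v, |dw p.1 (fun y => χ y ^ n) x * dw p.2 (pd i χ) x| ≤
          D * ((n + 1 : ℕ) : ℝ) ^ v.length * χ x ^ (n - v.length) * B := by
        intro p hp
        have hl := length_of_mem_splits hp
        rw [abs_mul]
        refine mul_le_mul ?_ (hχB (i :: p.2) (by simp; omega) x) (abs_nonneg _)
          (mul_nonneg (mul_nonneg hD0 (by positivity)) (pow_nonneg (h0 x) _))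
        refine (hb p.1 (by omega) n x).trans ?_
        refine mul_le_mul (mul_le_mul_of_nonneg_left ?_ hD0)
          (pow_le_pow_of_le_one (h0 x) (h1 x) (by omega)) (pow_nonneg (h0 x) _)
          (mul_nonneg hD0 (by positivity))
        calc (n : ℝ) ^ p.1.length ≤ ((n + 1 : ℕ) : ℝ) ^ p.1.length :=
              pow_le_pow_left₀ (by positivity) (by push_cast; linarith) _
          _ ≤ _ := pow_le_pow_right₀ (by push_cast; linarith [(Nat.cast_nonneg n : (0:ℝ) ≤ n)])
              (by omega)
      have hsum : |((splits v).map fun p => dw p.1 (fun y => χ y ^ n) x * dw p.2 (pd i χ) x).sum| ≤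
          2 ^ L * (D * ((n + 1 : ℕ) : ℝ) ^ v.length * χ x ^ (n - v.length) * B) := by
        refine (list_sum_abs_le _ _).trans ((list_sum_le key).trans ?_)
        rw [List.map_const', List.sum_replicate, length_splits, nsmul_eq_mul]
        push_cast
        refine mul_le_mul_of_nonneg_right (pow_le_pow_right₀ (by norm_num) hv')
          (mul_nonneg (mul_nonneg (mul_nonneg hD0 (by positivity)) (pow_nonneg (h0 x) _)) hB)
      refine (mul_le_mul_of_nonneg_left hsum (by positivity)).trans ?_
      have hX : 0 ≤ D * ((n + 1 : ℕ) : ℝ) ^ (v.length + 1) * χ x ^ (n - v.length) :=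
        mul_nonneg (mul_nonneg hD0 (by positivity)) (pow_nonneg (h0 x) _)
      rw [List.length_cons, Nat.add_sub_add_right]
      calc _ = 2 ^ L * B * (D * ((n + 1 : ℕ) : ℝ) ^ (v.length + 1) * χ x ^ (n - v.length)) := by
            push_cast; ring
        _ ≤ (1 + 2 ^ L * B) * (D * ((n + 1 : ℕ) : ℝ) ^ (v.length + 1) * χ x ^ (n - v.length)) :=
            mul_le_mul_of_nonneg_right (by linarith) hX
        _ = _ := by ring

end

lemma succ_pow_mul_factorial_rpow_le {s : ℝ} (hs : 1 ≤ s) {k p m : ℕ} (hp : p ≤ 4)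
    (hm : p + m ≤ k) :
    ((k + 1 : ℕ) : ℝ) ^ p * (m.factorial : ℝ) ^ s ≤ 5 ^ 4 * (k.factorial : ℝ) ^ s := by
  have h1 : (m.factorial : ℝ) ^ s ≤ ((k - p).factorial : ℝ) ^ s :=
    factorial_rpow_mono hs (by omega)
  have hN : (k + 1) ^ p * (k - p).factorial ≤ 5 ^ p * k.factorial := by
    rw [← Nat.factorial_mul_descFactorial (show p ≤ k by omega)]
    have : (k + 1) ^ p ≤ 5 ^ p * k.descFactorial p :=
      calc (k + 1) ^ p ≤ (5 * (k + 1 - p)) ^ p := Nat.pow_le_pow_left (by omega) p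
        _ = 5 ^ p * (k + 1 - p) ^ p := mul_pow _ _ _
        _ ≤ _ := Nat.mul_le_mul_left _ (Nat.pow_sub_le_descFactorial k p)
    nlinarith [Nat.factorial_pos (k - p)]
  have hN' : ((k + 1 : ℕ) : ℝ) ^ p * ((k - p).factorial : ℝ) ≤ 5 ^ 4 * (k.factorial : ℝ) := by
    calc ((k + 1 : ℕ) : ℝ) ^ p * ((k - p).factorial : ℝ) ≤ 5 ^ p * (k.factorial : ℝ) := by
          exact_mod_cast hN
      _ ≤ _ := mul_le_mul_of_nonneg_right (pow_le_pow_right₀ (by norm_num) hp) (by positivity)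
  have split : ∀ n : ℕ, (n.factorial : ℝ) ^ s = (n.factorial : ℝ) * (n.factorial : ℝ) ^ (s - 1) :=
    fun n => by
      have : (0 : ℝ) < n.factorial := by exact_mod_cast n.factorial_pos
      rw [← Real.rpow_one_add' this.le (by linarith)]
      congr 1; ring
  calc _ ≤ ((k + 1 : ℕ) : ℝ) ^ p * ((k - p).factorial : ℝ) ^ s :=
        mul_le_mul_of_nonneg_left h1 (by positivity)
    _ = (((k + 1 : ℕ) : ℝ) ^ p * ((k - p).factorial : ℝ)) * ((k - p).factorial : ℝ) ^ (s - 1) := by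
        rw [split (k - p)]; ring
    _ ≤ (5 ^ 4 * (k.factorial : ℝ)) * (k.factorial : ℝ) ^ (s - 1) := by
        refine mul_le_mul hN' (Real.rpow_le_rpow (by positivity) ?_ (by linarith)) (by positivity)
          (by positivity)
        exact_mod_cast Nat.factorial_le (Nat.sub_le k p)
    _ = _ := by rw [split k]; ring

end

section

section
variable {O : Set E3} {f g u : E3 → ℝ} {a b c : ℝ}

lemma NB.congr_on (hf : NB O f a) (hg : TF O g) (h : ∀ x ∈ O, g x = f x) : NB O g a := by
  refine hf.congr fun x => ?_
  by_cases hx : x ∈ O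
  · exact h x hx
  · rw [hg.zero_of_notMem hx, hf.tf.zero_of_notMem hx]

lemma NB.list_sum_const {ι : Type*} {l : List ι} {F : ι → E3 → ℝ}
    (h : ∀ i ∈ l, NB O (F i) a) : NB O (fun x => (l.map fun i => F i x).sum) (l.length * a) := by
  have := NB.list_sum h
  rwa [List.map_const', List.sum_replicate, nsmul_eq_mul] at this

lemma Sm.list_sum {ι : Type*} {l : List ι} {F : ι → E3 → ℝ} (h : ∀ i ∈ l, Sm O (F i)) :
    Sm O (fun x => (l.map fun i => F i x).sum) := by
  induction l with
  | nil => simpa using Sm.const 0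
  | cons i l ih =>
    simp only [List.map_cons, List.sum_cons]
    exact (h i (by simp)).add (ih fun j hj => h j (by simp [hj]))

lemma dw_list_sum (hO : IsOpen O) {ι : Type*} {l : List ι} {F : ι → E3 → ℝ}
    (h : ∀ i ∈ l, Sm O (F i)) (w : List (Fin 3)) {x : E3} (hx : x ∈ O) :
    dw w (fun x => (l.map fun i => F i x).sum) x = (l.map fun i => dw w (F i) x).sum := by
  induction l with
  | nil =>
    simp only [List.map_nil, List.sum_nil]
    cases w with
    | nil => rfl
    | cons i w => rw [dw_const _ _ (by simp)]
  | cons i l ih =>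
    simp only [List.map_cons, List.sum_cons]
    rw [dw_add hO (h i (by simp)) (Sm.list_sum fun j hj => h j (by simp [hj])) hx,
      ih fun j hj => h j (by simp [hj])]

lemma list_sum_map_add {ι : Type*} (l : List ι) (F G : ι → ℝ) :
    (l.map fun i => F i + G i).sum = (l.map F).sum + (l.map G).sum := List.sum_map_add

lemma list_sum_map_mul {ι : Type*} (l : List ι) (F : ι → ℝ) (r : ℝ) :
    (l.map fun i => r * F i).sum = r * (l.map F).sum := List.sum_map_mul_left l F r

lemma exists_common_gv {s : ℝ} {l : List ((E3 → ℝ) × List (Fin 3))}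
    (h : ∀ p ∈ l, GevB s O p.1) : ∃ c ≥ 0, ∃ A ≥ 0, ∀ p ∈ l, Gv s O c A p.1 := by
  induction l with
  | nil => exact ⟨0, le_rfl, 0, le_rfl, by simp⟩
  | cons q l ih =>
    obtain ⟨c, hc, A, hA, h1⟩ := ih fun p hp => h p (by simp [hp])
    obtain ⟨c', A', h2⟩ := h q (by simp)
    refine ⟨max c c', hc.trans (le_max_left _ _), max A A', hA.trans (le_max_left _ _), ?_⟩
    intro p hp
    rcases List.mem_cons.1 hp with rfl | hp
    · exact h2.mono (le_max_right _ _) (le_max_right _ _)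
    · exact (h1 p hp).mono (le_max_left _ _) (le_max_left _ _)

lemma IsDO.sm {s : ℝ} {n : ℕ} {T : (E3 → ℝ) → E3 → ℝ} (hO : IsOpen O) (h : IsDO s O n T)
    (hf : Sm O f) : Sm O (T f) := by
  obtain ⟨l, hl, hT⟩ := h
  exact (Sm.list_sum fun p hp => (hl p hp).1.sm.mul (hf.dw hO p.2)).congr (hT f hf)

end

section
variable {ι : Type*} {O : Set E3} {χ : E3 → ℝ} {U : ι → E3 → ℝ} {s K : ℝ} {k : ℕ}

/-- The weighted energy bounds for all derivatives of order less than `k`. -/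
def EH (O : Set E3) (χ : E3 → ℝ) (U : ι → E3 → ℝ) (s K : ℝ) (k : ℕ) : Prop :=
  ∀ w : List (Fin 3), w.length < k → ∀ i,
    NB O (fun x => χ x ^ (w.length + 1) * dw w (U i) x)
      (K ^ (w.length + 1) * (w.length.factorial : ℝ) ^ s)

/-- A smooth cutoff function on `O` with values in `[0, 1]`. -/
structure Cut (O : Set E3) (χ : E3 → ℝ) : Prop where
  tf : TF O χ
  nonneg : ∀ x, 0 ≤ χ x
  le_one : ∀ x, χ x ≤ 1

lemma EH.cut {D : ℝ} (hO : IsOpen O) (hs : 1 ≤ s) (hK : 1 ≤ K) (hχ : Cut O χ)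
    (hU : ∀ i, Sm O (U i)) (hD1 : 1 ≤ D)
    (hD : ∀ v : List (Fin 3), v.length ≤ 4 → ∀ (n : ℕ) (x : E3),
      |dw v (fun y => χ y ^ n) x| ≤ D * (n : ℝ) ^ v.length * χ x ^ (n - v.length))
    (hE : EH O χ U s K k) {v w : List (Fin 3)} (i : ι) (hv : v.length ≤ 4)
    (hvw : v.length + w.length ≤ k) (hw : w.length < k) :
    NB O (fun x => dw v (fun y => χ y ^ (k + 1)) x * dw w (U i) x)
      (D * 5 ^ 4 * (K ^ k * (k.factorial : ℝ) ^ s)) := by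
  refine ((hE w hw i).dom (c := D * ((k + 1 : ℕ) : ℝ) ^ v.length)
    (((hχ.tf.pow_succ k).dw v).mul_sm hO ((hU i).dw hO w)) (by positivity) fun x => ?_).mono ?_
  · rw [abs_mul, abs_mul, ← mul_assoc]
    refine mul_le_mul_of_nonneg_right ((hD v hv (k + 1) x).trans ?_) (abs_nonneg _)
    rw [abs_of_nonneg (pow_nonneg (hχ.nonneg x) _)]
    exact mul_le_mul_of_nonneg_left
      (pow_le_pow_of_le_one (hχ.nonneg x) (hχ.le_one x) (by omega)) (by positivity)
  · have h1 : K ^ (w.length + 1) ≤ K ^ k := pow_le_pow_right₀ hK (by omega)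
    have h2 := succ_pow_mul_factorial_rpow_le hs hv hvw
    calc _ = D * (K ^ (w.length + 1) *
          (((k + 1 : ℕ) : ℝ) ^ v.length * (w.length.factorial : ℝ) ^ s)) := by ring
      _ ≤ D * (K ^ k * (5 ^ 4 * (k.factorial : ℝ) ^ s)) := by
          refine mul_le_mul_of_nonneg_left (mul_le_mul h1 h2 (by positivity) (by positivity))
            (by linarith)
      _ = _ := by ring

lemma EH.coef {c A : ℝ} {P : E3 → ℝ} (hO : IsOpen O) (hs : 1 ≤ s) (hK : 1 ≤ K) (hKA : 2 * A ≤ K)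
    (hχ : Cut O χ) (hU : ∀ i, Sm O (U i)) (hP : Gv s O c A P) (hE : EH O χ U s K k) (i : ι)
    {v w w' : List (Fin 3)} (hw : v.length + w.length + 4 = k) {n : ℕ} (hn : n ≤ 4)
    (hw' : w'.length = n + w.length) (hvn : v ≠ [] ∨ n ≤ 3) :
    NB O (fun x => χ x ^ (k + 1) * (dw v P x * dw w' (U i) x))
      (c * (2 * A + 1) * K ^ k * ((1 / 2) ^ v.length *
        ((v.length.factorial : ℝ) ^ s * ((k - v.length).factorial : ℝ) ^ s))) := by
  have hA := hP.A_nonneg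
  have hc := hP.c_nonneg
  have hv1 : v ≠ [] → 1 ≤ v.length := List.length_pos_iff.2
  have hlt : w'.length < k := by rcases hvn with h | h <;> [have := hv1 h; skip] <;> omega
  refine ((hE w' hlt i).dom (c := c * A ^ v.length * (v.length.factorial : ℝ) ^ s)
    ((hχ.tf.pow_succ k).mul_sm hO ((hP.sm.dw hO v).mul ((hU i).dw hO w'))) (by positivity)
    fun x => ?_).mono ?_
  · by_cases hx : x ∈ O
    · rw [abs_mul, abs_mul, abs_mul, abs_of_nonneg (pow_nonneg (hχ.nonneg x) _),
        abs_of_nonneg (pow_nonneg (hχ.nonneg x) _)]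
      calc _ ≤ χ x ^ (w'.length + 1) *
            (c * A ^ v.length * (v.length.factorial : ℝ) ^ s * |dw w' (U i) x|) :=
            mul_le_mul (pow_le_pow_of_le_one (hχ.nonneg x) (hχ.le_one x) (by omega))
              (mul_le_mul_of_nonneg_right (hP.bound v x hx) (abs_nonneg _))
              (mul_nonneg (abs_nonneg _) (abs_nonneg _)) (pow_nonneg (hχ.nonneg x) _)
        _ = _ := by ring
    · rw [hχ.tf.zero_of_notMem hx]
      simp
  · have h1 : (w'.length.factorial : ℝ) ^ s ≤ ((k - v.length).factorial : ℝ) ^ s :=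
      factorial_rpow_mono hs (by omega)
    have h2 : A ^ v.length * K ^ (w'.length + 1) ≤ (2 * A + 1) * K ^ k * (1 / 2) ^ v.length := by
      have e : A ^ v.length * K ^ (w'.length + 1) =
          (2 * A) ^ v.length * K ^ (w'.length + 1) * (1 / 2) ^ v.length := by
        rw [mul_right_comm, ← mul_pow]
        congr 2
        ring
      rw [e]
      refine mul_le_mul_of_nonneg_right ?_ (by positivity)
      have hK0 : 0 ≤ K ^ k := by positivity
      by_cases hcase : v.length + (w'.length + 1) ≤ k
      · calc (2 * A) ^ v.length * K ^ (w'.length + 1) ≤ K ^ v.length * K ^ (w'.length + 1) :=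
              mul_le_mul_of_nonneg_right (pow_le_pow_left₀ (by positivity) hKA _) (by positivity)
          _ ≤ K ^ k := by rw [← pow_add]; exact pow_le_pow_right₀ hK hcase
          _ ≤ _ := by nlinarith
      · have hv : 1 ≤ v.length := by rcases hvn with h | h <;> [exact hv1 h; omega]
        obtain ⟨r, hr⟩ := Nat.exists_eq_add_of_le' hv
        calc (2 * A) ^ v.length * K ^ (w'.length + 1)
            = 2 * A * ((2 * A) ^ r * K ^ (w'.length + 1)) := by rw [hr, pow_succ]; ring
          _ ≤ 2 * A * (K ^ r * K ^ (w'.length + 1)) :=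
              mul_le_mul_of_nonneg_left (mul_le_mul_of_nonneg_right
                (pow_le_pow_left₀ (by positivity) hKA _) (by positivity)) (by positivity)
          _ = 2 * A * K ^ k := by rw [← pow_add]; congr 2; omega
          _ ≤ _ := mul_le_mul_of_nonneg_right (by linarith) hK0
    calc _ = c * (v.length.factorial : ℝ) ^ s * ((A ^ v.length * K ^ (w'.length + 1)) *
          (w'.length.factorial : ℝ) ^ s) := by ring
      _ ≤ c * (v.length.factorial : ℝ) ^ s * (((2 * A + 1) * K ^ k * (1 / 2) ^ v.length) *
          ((k - v.length).factorial : ℝ) ^ s) := by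
          refine mul_le_mul_of_nonneg_left (mul_le_mul h2 h1 (by positivity) (by positivity))
            (by positivity)
      _ = _ := by ring

lemma splits_factorial_sum_le (hs : 1 ≤ s) {w : List (Fin 3)} (hw : w.length + 4 = k) :
    ((splits w).map fun p => (1 / 2 : ℝ) ^ p.1.length *
      ((p.1.length.factorial : ℝ) ^ s * ((k - p.1.length).factorial : ℝ) ^ s)).sum ≤
      2 * (k.factorial : ℝ) ^ s := by
  rw [splits_sum_length w fun a _ => (1 / 2 : ℝ) ^ a *
      ((a.factorial : ℝ) ^ s * ((k - a).factorial : ℝ) ^ s)]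
  calc _ ≤ ∑ p ∈ antidiagonal w.length, (1 / 2 : ℝ) ^ p.1 * (k.factorial : ℝ) ^ s := by
        refine sum_le_sum fun p hp => ?_
        have hp := HasAntidiagonal.mem_antidiagonal.1 hp
        have h1 := choose_mul_factorial_rpow_le hs p.1 (k - p.1)
        rw [show p.1 + (k - p.1) = k by omega] at h1
        have h2 : (w.length.choose p.1 : ℝ) ≤ (k.choose p.1 : ℝ) := by
          exact_mod_cast Nat.choose_le_choose p.1 (by omega)
        calc _ = (1 / 2 : ℝ) ^ p.1 * ((w.length.choose p.1 : ℝ) *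
              ((p.1.factorial : ℝ) ^ s * ((k - p.1).factorial : ℝ) ^ s)) := by ring
          _ ≤ (1 / 2 : ℝ) ^ p.1 * ((k.choose p.1 : ℝ) *
              ((p.1.factorial : ℝ) ^ s * ((k - p.1).factorial : ℝ) ^ s)) := by
              refine mul_le_mul_of_nonneg_left (mul_le_mul_of_nonneg_right h2 (by positivity))
                (by positivity)
          _ ≤ _ := mul_le_mul_of_nonneg_left h1 (by positivity)
    _ = (∑ a ∈ range (w.length + 1), (1 / 2 : ℝ) ^ a) * (k.factorial : ℝ) ^ s := by
        rw [sum_mul, Finset.Nat.sum_antidiagonal_eq_sum_range_succ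
          (fun a _ => (1 / 2 : ℝ) ^ a * (k.factorial : ℝ) ^ s)]
    _ ≤ _ := by
        refine mul_le_mul_of_nonneg_right ?_ (by positivity)
        rw [geom_sum_eq (by norm_num), div_le_iff_of_neg (by norm_num)]
        have : (0 : ℝ) < (1 / 2) ^ (w.length + 1) := by positivity
        linarith

/-- The Leibniz sum of a coefficient against derivatives of `U`, the undifferentiated coefficient
left out when the order is four. -/
lemma EH.coef_sum {c A : ℝ} {P : E3 → ℝ} (hO : IsOpen O) (hs : 1 ≤ s) (hK : 1 ≤ K)
    (hKA : 2 * A ≤ K) (hχ : Cut O χ) (hU : ∀ i, Sm O (U i)) (hP : Gv s O c A P)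
    (hE : EH O χ U s K k) (i : ι) {w v : List (Fin 3)} (hw : w.length + 4 = k)
    (hv : v.length ≤ 4) {q : Prop} [Decidable q] (hq : ¬ q → v.length ≤ 3) :
    NB O (fun x => χ x ^ (k + 1) * ((splits w).map fun p => if q ∧ p.1 = [] then 0 else
      dw p.1 P x * dw p.2 (dw v (U i)) x).sum)
      (c * (2 * A + 1) * 2 * (K ^ k * (k.factorial : ℝ) ^ s)) := by
  have hA := hP.A_nonneg
  have hc := hP.c_nonneg
  have h1 : ∀ p ∈ splits w, NB O (fun x => if q ∧ p.1 = [] then 0 else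
      χ x ^ (k + 1) * (dw p.1 P x * dw p.2 (dw v (U i)) x))
      (c * (2 * A + 1) * K ^ k * ((1 / 2) ^ p.1.length *
        ((p.1.length.factorial : ℝ) ^ s * ((k - p.1.length).factorial : ℝ) ^ s))) := by
    intro p hp
    have hl := length_of_mem_splits hp
    split_ifs with h
    · exact NB.zero.mono (by positivity)
    · simp only [← dw_append]
      refine hE.coef hO hs hK hKA hχ hU hP i (n := v.length) (w := p.2) (by omega) hv
        (by simp) ?_
      by_cases h' : p.1 = []
      · exact Or.inr (hq fun hq' => h ⟨hq', h'⟩)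
      · exact Or.inl h'
  refine ((NB.list_sum h1).congr fun x => ?_).mono ?_
  · rw [← list_sum_map_mul]
    congr 2
    funext p
    split_ifs <;> simp
  · rw [list_sum_map_mul]
    have := splits_factorial_sum_le hs hw
    calc _ ≤ c * (2 * A + 1) * K ^ k * (2 * (k.factorial : ℝ) ^ s) :=
          mul_le_mul_of_nonneg_left this (by positivity)
      _ = _ := by ring

end

end

section

section
variable {ι : Type*} {O : Set E3} {χ : E3 → ℝ} {U : ι → E3 → ℝ} {s : ℝ}

lemma EH.rhs (hO : IsOpen O) (hs : 1 ≤ s) (hχ : Cut O χ) (hU : ∀ i, Sm O (U i))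
    {T : (E3 → ℝ) → E3 → ℝ} (hT : IsDO s O 3 T) :
    ∃ D, ∀ K k, D ≤ K → 1 ≤ K → EH O χ U s K k → ∀ i (w : List (Fin 3)), w.length + 4 = k →
      NB O (fun x => χ x ^ (k + 1) * dw w (T (U i)) x) (D * (K ^ k * (k.factorial : ℝ) ^ s)) := by
  obtain ⟨l, hl, hT⟩ := hT
  obtain ⟨c, hc, A, hA, hG⟩ := exists_common_gv fun p hp => (hl p hp).1
  refine ⟨2 * A + l.length * (c * (2 * A + 1) * 2), fun K k hDK hK hE i w hw => ?_⟩
  have hKA : 2 * A ≤ K := by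
    have : 0 ≤ l.length * (c * (2 * A + 1) * 2) := by positivity
    linarith
  have h1 := NB.list_sum_const fun p hp =>
    hE.coef_sum hO hs hK hKA hχ hU (hG p hp) i hw (v := p.2) (q := False)
      (by have := (hl p hp).2; omega) (fun _ => (hl p hp).2)
  have hTF : TF O (fun x => χ x ^ (k + 1) * dw w (T (U i)) x) :=
    (hχ.tf.pow_succ k).mul_sm hO (((Sm.list_sum fun p hp =>
      (hl p hp).1.sm.mul ((hU i).dw hO p.2)).congr (hT _ (hU i))).dw hO w)
  refine (h1.congr_on hTF fun x hx => ?_).mono ?_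
  · rw [dw_congr hO (hT _ (hU i)) w hx, dw_list_sum hO (fun p hp =>
      (hl p hp).1.sm.mul ((hU i).dw hO p.2)) w hx, ← list_sum_map_mul]
    refine congrArg List.sum (List.map_congr_left fun p hp => ?_)
    rw [dw_mul hO (hl p hp).1.sm ((hU i).dw hO p.2) hx]
    simp
  · rw [add_mul, ← mul_assoc (l.length : ℝ)]
    have : 0 ≤ 2 * A * (K ^ k * (k.factorial : ℝ) ^ s) := by positivity
    linarith

lemma EH.leibniz_rest {D K : ℝ} {k : ℕ} (hO : IsOpen O) (hs : 1 ≤ s) (hK : 1 ≤ K) (hχ : Cut O χ)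
    (hU : ∀ i, Sm O (U i)) (hD1 : 1 ≤ D)
    (hD : ∀ v : List (Fin 3), v.length ≤ 4 → ∀ (n : ℕ) (x : E3),
      |dw v (fun y => χ y ^ n) x| ≤ D * (n : ℝ) ^ v.length * χ x ^ (n - v.length))
    (hE : EH O χ U s K k) (i : ι) {w v : List (Fin 3)} (hw : w.length + 4 = k)
    (hv : v.length ≤ 4) {q : Prop} [Decidable q] (hq : ¬ q → v.length ≤ 3) :
    NB O (fun x => ((splits v).map fun p => if q ∧ p.1 = [] then 0 else
      dw p.1 (fun y => χ y ^ (k + 1)) x * dw p.2 (dw w (U i)) x).sum)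
      (16 * (D * 5 ^ 4 * (K ^ k * (k.factorial : ℝ) ^ s))) := by
  refine (NB.list_sum_const (a := D * 5 ^ 4 * (K ^ k * (k.factorial : ℝ) ^ s))
    fun p hp => ?_).mono ?_
  · have hl := length_of_mem_splits hp
    split_ifs with h
    · exact NB.zero.mono (by positivity)
    · simp only [← dw_append]
      refine hE.cut hO hs hK hχ hU hD1 hD i (by omega) (by simp; omega) ?_
      have : p.1 = [] ∨ 1 ≤ p.1.length := by
        rcases p.1 with _ | ⟨a, t⟩ <;> simp
      rcases this with h' | h'
      · have := hq fun hq' => h ⟨hq', h'⟩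
        simp; omega
      · simp; omega
  · refine mul_le_mul_of_nonneg_right ?_ (by positivity)
    rw [length_splits]
    push_cast
    calc (2 : ℝ) ^ v.length ≤ 2 ^ 4 := pow_le_pow_right₀ (by norm_num) hv
      _ = 16 := by norm_num

lemma EH.comm (hO : IsOpen O) (hs : 1 ≤ s) (hχ : Cut O χ) (hU : ∀ i, Sm O (U i))
    {L : (E3 → ℝ) → E3 → ℝ} (hL : IsDO s O 4 L) (hLT : ∀ u, TF O u → TF O (L u)) :
    ∃ D, ∀ K k, D ≤ K → 1 ≤ K → EH O χ U s K k → ∀ i (w : List (Fin 3)), w.length + 4 = k →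
      NB O (fun x => L (fun y => χ y ^ (k + 1) * dw w (U i) y) x - χ x ^ (k + 1) * dw w (L (U i)) x)
        (D * (K ^ k * (k.factorial : ℝ) ^ s)) := by
  have hLs : ∀ i, Sm O (L (U i)) := fun i => hL.sm hO (hU i)
  obtain ⟨l, hl, hL⟩ := hL
  obtain ⟨c, hc, A, hA, hG⟩ := exists_common_gv fun p hp => (hl p hp).1
  obtain ⟨D, hD1, hD⟩ := pow_dw_bound hχ.tf hχ.nonneg hχ.le_one 4
  have hD0 : 0 ≤ D := by linarith
  refine ⟨2 * A + l.length * (c * (16 * (D * 5 ^ 4)) + c * (2 * A + 1) * 2),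
    fun K k hDK hK hE i w hw => ?_⟩
  have hKA : 2 * A ≤ K := by
    have : 0 ≤ l.length * (c * (16 * (D * 5 ^ 4)) + c * (2 * A + 1) * 2) := by positivity
    linarith
  have hχk := hχ.tf.pow_succ k
  have hf := (hU i).dw hO w
  have hg : TF O (fun y => χ y ^ (k + 1) * dw w (U i) y) := hχk.mul_sm hO hf
  have h1 := NB.list_sum_const (l := l) (O := O) fun p hp =>
    (((hE.leibniz_rest hO hs hK hχ hU hD1 hD i hw (v := p.2) (q := True) (hl p hp).2
      (fun h => absurd trivial h)).dom
      (TF.smul hO (hl p hp).1.sm (hE.leibniz_rest hO hs hK hχ hU hD1 hD i hw (v := p.2) (q := True)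
        (hl p hp).2 (fun h => absurd trivial h)).tf) hc (fun x => by
          rw [abs_mul]
          by_cases hx : x ∈ O
          · exact mul_le_mul_of_nonneg_right ((hG p hp).abs_le hx) (abs_nonneg _)
          · rw [(hE.leibniz_rest hO hs hK hχ hU hD1 hD i hw (v := p.2) (q := True)
              (hl p hp).2 (fun h => absurd trivial h)).tf.zero_of_notMem hx]
            simp)).sub
    (hE.coef_sum hO hs hK hKA hχ hU (hG p hp) i hw (v := p.2) (q := True)
      (hl p hp).2 (fun h => absurd trivial h)))
  have hTF : TF O (fun x => L (fun y => χ y ^ (k + 1) * dw w (U i) y) x -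
      χ x ^ (k + 1) * dw w (L (U i)) x) :=
    (hLT _ hg).sub' (hχk.mul_sm hO ((hLs i).dw hO w))
  refine (h1.congr_on hTF fun x hx => ?_).mono ?_
  · rw [hL _ (hg.sm O) x hx, dw_congr hO (hL _ (hU i)) w hx, dw_list_sum hO (fun p hp =>
      (hl p hp).1.sm.mul ((hU i).dw hO p.2)) w hx, ← list_sum_map_mul, sub_eq_iff_eq_add,
      ← list_sum_map_add]
    refine congrArg List.sum (List.map_congr_left fun p hp => ?_)
    have e1 := splits_sum_eq p.2 fun q => dw q.1 (fun y => χ y ^ (k + 1)) x *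
      dw q.2 (dw w (U i)) x
    have e2 := splits_sum_eq w fun q => dw q.1 p.1 x * dw q.2 (dw p.2 (U i)) x
    rw [dw_mul hO (hχk.sm O) hf hx, e1, dw_mul hO (hl p hp).1.sm ((hU i).dw hO p.2) hx, e2]
    simp only [true_and, dw_nil]
    rw [← dw_append, ← dw_append, dw_perm hO (List.perm_append_comm (l₁ := w) (l₂ := p.2)) (hU i)
        hx]
    ring
  · have : 0 ≤ 2 * A * (K ^ k * (k.factorial : ℝ) ^ s) := by positivity
    calc _ = l.length * (c * (16 * (D * 5 ^ 4)) + c * (2 * A + 1) * 2) *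
          (K ^ k * (k.factorial : ℝ) ^ s) := by ring
      _ ≤ _ := by rw [add_mul (2 * A)]; linarith

theorem gevrey_energy [Fintype ι] (hO : IsOpen O) (hs : 1 ≤ s) (hχ : Cut O χ)
    (hU : ∀ i, Sm O (U i)) {L : (E3 → ℝ) → E3 → ℝ} {T : ι → ι → (E3 → ℝ) → E3 → ℝ}
    (hL : IsDO s O 4 L) (hLT : ∀ u, TF O u → TF O (L u)) (hT : ∀ i j, IsDO s O 3 (T i j))
    (hsys : ∀ i, ∀ x ∈ O, L (U i) x = ∑ j, T i j (U j) x) {C : ℝ}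
    (hest : ∀ g, TF O g → ∀ a, NB O (L g) a →
      (∀ v : List (Fin 3), v.length ≤ 3 → NB O (dw v g) a) →
      ∀ u : List (Fin 3), u.length = 4 → NB O (dw u g) (C * a)) :
    ∃ K ≥ 1, ∀ k, EH O χ U s K k := by
  obtain ⟨D1, hD1⟩ := EH.comm hO hs hχ hU hL hLT
  have hrhs : ∃ D2 ≥ (0 : ℝ), ∀ ij ∈ (Set.univ : Set (ι × ι)), ∀ K k, D2 ≤ K → 1 ≤ K →
      EH O χ U s K k → ∀ (w : List (Fin 3)), w.length + 4 = k →
      NB O (fun x => χ x ^ (k + 1) * dw w (T ij.1 ij.2 (U ij.2)) x)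
        (D2 * (K ^ k * (k.factorial : ℝ) ^ s)) := by
    refine exists_uniform_bound Set.finite_univ
        (P := fun (ij : ι × ι) (D2 : ℝ) => ∀ K k, D2 ≤ K → 1 ≤ K →
      EH O χ U s K k → ∀ (w : List (Fin 3)), w.length + 4 = k →
      NB O (fun x => χ x ^ (k + 1) * dw w (T ij.1 ij.2 (U ij.2)) x)
        (D2 * (K ^ k * (k.factorial : ℝ) ^ s))) (fun ij D D' h h' K k hK h1 hE w hw =>
          (h' K k (h.trans hK) h1 hE w hw).mono (mul_le_mul_of_nonneg_right h (by positivity)))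
      (fun ij _ => ?_) 0
    obtain ⟨D, hD⟩ := EH.rhs hO hs hχ hU (hT ij.1 ij.2)
    exact ⟨D, fun K k hK h1 hE w hw => hD K k hK h1 hE ij.2 w hw⟩
  obtain ⟨D2, hD20, hD2⟩ := hrhs
  obtain ⟨D, hDone, hD⟩ := pow_dw_bound hχ.tf hχ.nonneg hχ.le_one 4
  have hD0 : 0 ≤ D := by linarith
  obtain ⟨K0, -, hK0⟩ : ∃ K0 ≥ (0 : ℝ), ∀ p ∈ {w : List (Fin 3) | w.length ≤ 3} ×ˢ
      (Set.univ : Set ι), NB O (fun x => χ x ^ (p.1.length + 1) * dw p.1 (U p.2) x) K0 :=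
    exists_uniform_bound ((List.finite_length_le (Fin 3) 3).prod Set.finite_univ)
      (P := fun (p : List (Fin 3) × ι) (K0 : ℝ) => NB O
          (fun x => χ x ^ (p.1.length + 1) * dw p.1 (U p.2) x) K0)
      (fun _ _ _ h h' => h'.mono h)
      (fun p _ => ⟨_, ((hχ.tf.pow_succ _).mul_sm hO ((hU p.2).dw hO p.1)).nb_lpNorm⟩) 0
  set D3 := |D1| + Fintype.card ι * D2 + 16 * (D * 5 ^ 4) with hD3
  have hcard : 0 ≤ (Fintype.card ι : ℝ) * D2 := by positivity
  have hD3' : 0 ≤ D3 := by positivity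
  set K := max (max 1 K0) (max (max |D1| D2) (C * D3 + 16 * (D * 5 ^ 4))) with hKdef
  have hK1 : 1 ≤ K := (le_max_left _ _).trans (le_max_left _ _)
  have hKK0 : K0 ≤ K := (le_max_right _ _).trans (le_max_left _ _)
  have hKD1 : D1 ≤ K :=
    (le_abs_self D1).trans ((le_max_left _ _).trans ((le_max_left _ _).trans (le_max_right _ _)))
  have hKD2 : D2 ≤ K := (le_max_right _ _).trans ((le_max_left _ _).trans (le_max_right _ _))
  have hKD3 : C * D3 + 16 * (D * 5 ^ 4) ≤ K := (le_max_right _ _).trans (le_max_right _ _)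
  refine ⟨K, hK1, fun k => ?_⟩
  induction k with
  | zero => intro w hw; omega
  | succ k hE =>
    intro w hw i
    by_cases hwk : w.length < k
    · exact hE w hwk i
    have hlen : w.length = k := by omega
    by_cases hk : k ≤ 3
    · refine (hK0 (w, i) ⟨by simp; omega, trivial⟩).mono (hKK0.trans ?_)
      have h1 : K ≤ K ^ (w.length + 1) := le_self_pow₀ hK1 (by omega)
      have h2 : 1 ≤ (w.length.factorial : ℝ) ^ s :=
        Real.one_le_rpow (by exact_mod_cast Nat.one_le_iff_ne_zero.2 (Nat.factorial_ne_zero _))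
          (by linarith)
      nlinarith
    push Not at hk
    rw [hlen]
    obtain ⟨w', u, rfl, hu⟩ : ∃ w' u, w = w' ++ u ∧ u.length = 4 :=
      ⟨w.take (k - 4), w.drop (k - 4), (List.take_append_drop _ _).symm, by simp; omega⟩
    have hw' : w'.length + 4 = k := by simp at hlen; omega
    set Q := K ^ k * (k.factorial : ℝ) ^ s with hQ
    have hQ0 : 0 ≤ Q := by positivity
    have hχk := hχ.tf.pow_succ k
    have hf := (hU i).dw hO w'
    have hg : TF O (fun y => χ y ^ (k + 1) * dw w' (U i) y) := hχk.mul_sm hO hf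
    have hlow : ∀ v : List (Fin 3), v.length ≤ 3 →
        NB O (dw v (fun y => χ y ^ (k + 1) * dw w' (U i) y)) (D3 * Q) := by
      intro v hv
      refine ((hE.leibniz_rest hO hs hK1 hχ hU hDone hD i hw' (v := v) (q := False)
        (by omega) (fun _ => hv)).congr_on (hg.dw v) fun x hx => ?_).mono ?_
      · rw [dw_mul hO (hχk.sm O) hf hx]
        simp
      · rw [← mul_assoc]
        refine mul_le_mul_of_nonneg_right ?_ hQ0
        have := abs_nonneg D1
        linarith
    have hrhs : NB O (fun x => χ x ^ (k + 1) * dw w' (L (U i)) x)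
        (Fintype.card ι * D2 * Q) := by
      have h1 : NB O (fun x => ∑ j, χ x ^ (k + 1) * dw w' (T i j (U j)) x)
          (∑ j : ι, D2 * Q) :=
        NB.sum fun j _ => hD2 (i, j) trivial K k hKD2 hK1 hE w' hw'
      refine (h1.congr_on (hχk.mul_sm hO ((hL.sm hO (hU i)).dw hO w')) fun x hx => ?_).mono ?_
      · rw [dw_congr hO (hsys i) w' hx, dw_sum hO (fun j _ => (hT i j).sm hO (hU j)) hx, mul_sum]
      · simp [mul_assoc]
    have hLg : NB O (L (fun y => χ y ^ (k + 1) * dw w' (U i) y)) (D3 * Q) := by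
      refine (((hD1 K k hKD1 hK1 hE i w' hw').add hrhs).congr fun x => by ring).mono ?_
      rw [← add_mul]
      refine mul_le_mul_of_nonneg_right ?_ hQ0
      have := le_abs_self D1
      have : 0 ≤ 16 * (D * 5 ^ 4) := by positivity
      linarith
    have htop := hest _ hg _ hLg hlow u hu
    have hrest := hE.leibniz_rest hO hs hK1 hχ hU hDone hD i hw' (v := u) (q := True)
      hu.le (fun h => absurd trivial h)
    refine ((htop.sub hrest).congr_on (hχk.mul_sm hO ((hU i).dw hO (w' ++ u)))
      fun x hx => ?_).mono ?_
    · rw [dw_mul hO (hχk.sm O) hf hx, splits_sum_eq]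
      simp only [true_and, dw_nil]
      rw [← dw_append]
      ring
    · calc _ = (C * D3 + 16 * (D * 5 ^ 4)) * Q := by ring
        _ ≤ K * Q := mul_le_mul_of_nonneg_right hKD3 hQ0
        _ = _ := by rw [hQ]; ring

end

end

section

variable {O : Set E3} {u f : E3 → ℝ} {a s : ℝ}

lemma TF.hasDerivAt_update (hu : TF O u) (i : Fin 3) (y : Fin 3 → ℝ) (t : ℝ) :
    HasDerivAt (fun t => u (WithLp.toLp 2 (Function.update y i t)))
      (_root_.pd i u (WithLp.toLp 2 (Function.update y i t))) t := by
  have h1 : HasDerivAt (fun t => WithLp.toLp 2 (Function.update y i t))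
      (EuclideanSpace.single i (1 : ℝ)) t := by
    have := (PiLp.continuousLinearEquiv 2 ℝ (fun _ : Fin 3 => ℝ)).symm.hasFDerivAt.comp_hasDerivAt t
      (_root_.hasDerivAt_update y i t)
    simpa [Function.comp_def] using this
  have h2 := (hu.smooth.differentiable (by simp)
    (WithLp.toLp 2 (Function.update y i t))).hasFDerivAt.comp_hasDerivAt t h1
  simpa [Function.comp_def, _root_.pd] using h2

lemma TF.enorm_le_lmarginal (hu : TF O u) (i : Fin 3) (y : Fin 3 → ℝ) :
    ‖u (WithLp.toLp 2 y)‖ₑ ≤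
      (∫⋯∫⁻_{i}, (fun z => ‖_root_.pd i u (WithLp.toLp 2 z)‖ₑ) ∂fun _ => volume) y := by
  rw [lmarginal_singleton]
  have hc : ContDiff ℝ 1 (fun t => u (WithLp.toLp 2 (Function.update y i t))) := by
    have h1 : ContDiff ℝ 1 (fun t => WithLp.toLp 2 (Function.update y i t)) :=
      (PiLp.continuousLinearEquiv 2 ℝ (fun _ : Fin 3 => ℝ)).symm.contDiff.comp
        (by convert! contDiff_update 1 y i)
    exact (hu.smooth.of_le (by simp)).comp h1
  have hs : HasCompactSupport (fun t => u (WithLp.toLp 2 (Function.update y i t))) := by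
    have h1 : HasCompactSupport (fun z : Fin 3 → ℝ => u (WithLp.toLp 2 z)) :=
      hu.cpt.comp_homeomorph
        (PiLp.continuousLinearEquiv 2 ℝ (fun _ : Fin 3 => ℝ)).symm.toHomeomorph
    exact h1.comp_isClosedEmbedding (isClosedEmbedding_update y i)
  refine le_trans (le_of_eq (by simp)) ((hs.enorm_le_lintegral_Ici_deriv hc (y i)).trans ?_)
  refine (lintegral_mono' Measure.restrict_le_self le_rfl).trans (le_of_eq ?_)
  refine lintegral_congr fun t => ?_
  rw [(hu.hasDerivAt_update i y t).deriv]

lemma TF.abs_le_integral (hu : TF O u) (x : E3) : |u x| ≤ ∫ y, |_root_.dw [0, 1, 2] u y| := by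
  set F : List (Fin 3) → (Fin 3 → ℝ) → ENNReal :=
      fun w z => ‖_root_.dw w u (WithLp.toLp 2 z)‖ₑ with hF
  have hm : ∀ w, Measurable (F w) := fun w =>
    ((hu.dw w).smooth.continuous.comp (PiLp.continuous_toLp 2 _)).enorm.measurable
  have h0 : F [] ≤ ∫⋯∫⁻_{0}, F [0] ∂fun _ => volume := fun y => hu.enorm_le_lmarginal 0 y
  have h1 : F [0] ≤ ∫⋯∫⁻_{1}, F [0, 1] ∂fun _ => volume :=
    fun y => (hu.dw [0]).enorm_le_lmarginal 1 y
  have h2 : F [0, 1] ≤ ∫⋯∫⁻_{2}, F [0, 1, 2] ∂fun _ => volume :=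
    fun y => (hu.dw [0, 1]).enorm_le_lmarginal 2 y
  have h3 := h0.trans (lmarginal_mono (h1.trans (lmarginal_mono h2)))
  rw [← lmarginal_union _ _ (hm _) (by decide), ← lmarginal_union _ _ (hm _) (by decide),
    show ({0} ∪ ({1} ∪ {2}) : Finset (Fin 3)) = univ by decide, lmarginal_univ] at h3
  have h4 := h3 (WithLp.ofLp x)
  have h5 : ∫⁻ z, F [0, 1, 2] z ∂(Measure.pi fun _ => volume) = ∫⁻ y, ‖_root_.dw [0, 1, 2] u y‖ₑ :=
    (PiLp.volume_preserving_toLp (Fin 3)).lintegral_comp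
      (hu.dw [0, 1, 2]).smooth.continuous.enorm.measurable
  rw [h5] at h4
  have h6 : F [] (WithLp.ofLp x) = ENNReal.ofReal |u x| := by
    simp [hF, dw_nil, ← Real.norm_eq_abs]
  rw [h6, ← ofReal_integral_norm_eq_lintegral_enorm (hu.dw [0, 1, 2]).integrable] at h4
  exact (ENNReal.ofReal_le_ofReal_iff (integral_nonneg fun _ => norm_nonneg _)).1 h4

lemma NB.integral_abs_le (h : NB O f a) (hO : volume O ≠ ⊤) :
    ∫ x, |f x| ≤ a * ((1 + volume.real O) / 2) := by
  have key : ∀ b, 0 < b → a ≤ b → ∫ x, |f x| ≤ b * ((1 + volume.real O) / 2) := by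
    intro b hb hab
    have hi : Integrable ((tsupport f).indicator fun _ : E3 => (1 : ℝ)) :=
      (integrable_indicator_iff (isClosed_tsupport f).measurableSet).2
        (integrableOn_const (measure_ne_top_of_subset h.tf.sub hO) (by simp))
    have h1 : ∀ x, |f x| ≤ (1 / (2 * b)) * f x ^ 2 +
        b / 2 * (tsupport f).indicator (fun _ => 1) x := by
      intro x
      by_cases hx : x ∈ tsupport f
      · rw [Set.indicator_of_mem hx, ← sq_abs, ← sub_nonneg]
        have : 1 / (2 * b) * |f x| ^ 2 + b / 2 * 1 - |f x| = (|f x| - b) ^ 2 / (2 * b) := by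
          field_simp; ring
        rw [this]; positivity
      · rw [Set.indicator_of_notMem hx, image_eq_zero_of_notMem_tsupport hx]; simp
    have h2 := integral_mono h.tf.integrable.abs
      ((h.tf.sq.integrable.const_mul (1 / (2 * b))).add (hi.const_mul (b / 2))) h1
    refine h2.trans ?_
    simp only [Pi.add_apply]
    rw [integral_add (h.tf.sq.integrable.const_mul _) (hi.const_mul _), integral_const_mul,
      integral_const_mul, integral_indicator (isClosed_tsupport f).measurableSet]
    have h3 : ∫ x in tsupport f, (1 : ℝ) ≤ volume.real O := by
      simpa using measureReal_mono h.tf.sub hO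
    have h4 : ∫ x, f x ^ 2 ≤ b ^ 2 := h.integral_le.trans (by gcongr; exact h.nonneg)
    calc _ ≤ 1 / (2 * b) * b ^ 2 + b / 2 * volume.real O := by gcongr
      _ = _ := by field_simp
  refine le_of_forall_pos_le_add fun ε hε => ?_
  have hV : 0 < (1 + volume.real O) / 2 := by positivity
  have h0 := h.nonneg
  have := key (a + ε / ((1 + volume.real O) / 2)) (by positivity) (by
    have : 0 < ε / ((1 + volume.real O) / 2) := by positivity
    linarith)
  rwa [add_mul, div_mul_cancel₀ _ hV.ne'] at this

lemma NB.abs_le (hu : TF O u) (h : NB O (dw [0, 1, 2] u) a) (hO : volume O ≠ ⊤) (x : E3) :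
    |u x| ≤ a * ((1 + volume.real O) / 2) :=
  (hu.abs_le_integral x).trans (h.integral_abs_le hO)

end

section

lemma factorial_add_four_rpow_le {s : ℝ} (hs : 1 ≤ s) (m : ℕ) :
    ((m + 4).factorial : ℝ) ^ s ≤
      ((2 : ℝ) ^ 4 * 24) ^ s * (((2 : ℝ) ^ s) ^ m * (m.factorial : ℝ) ^ s) := by
  have h1 : (m + 4).factorial ≤ 2 ^ 4 * 24 * (2 ^ m * m.factorial) := by
    have h := Nat.add_choose_mul_factorial_mul_factorial m 4
    have h2 := Nat.choose_le_two_pow (m + 4) 4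
    rw [← h, show Nat.factorial 4 = 24 from rfl]
    calc _ ≤ 2 ^ (m + 4) * m.factorial * 24 := by gcongr
      _ = _ := by ring
  have h2 : ((m + 4).factorial : ℝ) ≤ 2 ^ 4 * 24 * (2 ^ m * m.factorial) := by exact_mod_cast h1
  calc _ ≤ ((2 : ℝ) ^ 4 * 24 * (2 ^ m * m.factorial)) ^ s := by gcongr
    _ = _ := by
      rw [Real.mul_rpow (by positivity) (by positivity), Real.mul_rpow (x := 2 ^ m) (by positivity)
        (by positivity), ← Real.rpow_natCast 2 m, ← Real.rpow_natCast (2 ^ s) m,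
        ← Real.rpow_mul zero_le_two, ← Real.rpow_mul zero_le_two, mul_comm (m : ℝ) s]

variable {ι : Type*} {O O' : Set E3} {χ : E3 → ℝ} {U : ι → E3 → ℝ} {s K : ℝ}

lemma EH.gevB (hO : IsOpen O) (hV : volume O ≠ ⊤) (hs : 1 ≤ s) (hK : 1 ≤ K) (hχ : Cut O χ)
    (hU : ∀ i, Sm O (U i)) (hE : ∀ k, EH O χ U s K k) (hO' : O' ⊆ O) (h1 : ∀ x ∈ O', χ x = 1)
    (i : ι) : GevB s O' (U i) := by
  obtain ⟨D, hD1, hD⟩ := pow_dw_bound hχ.tf hχ.nonneg hχ.le_one 4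
  set V := (1 + volume.real O) / 2 with hVdef
  have hV0 : 0 ≤ V := by positivity
  refine ⟨16 * (D * 5 ^ 4 * (K ^ 4 * ((2 : ℝ) ^ 4 * 24) ^ s)) * V, K * 2 ^ s,
    (hU i).mono hO', by positivity, by positivity, fun w x hx => ?_⟩
  have hg : TF O (fun x => χ x ^ (w.length + 4 + 1) * dw w (U i) x) :=
    TF.mul_sm hO (hχ.tf.pow_succ _) ((hU i).dw hO w)
  have hr := EH.leibniz_rest hO hs hK hχ hU hD1 hD (hE (w.length + 4)) i (w := w) rfl
    (v := [0, 1, 2]) (by simp) (q := False) (by simp)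
  have hn := (hr.congr_on (hg.dw [0, 1, 2]) fun y hy => by
    rw [dw_mul hO (hχ.tf.pow_succ _ |>.sm O) ((hU i).dw hO w) hy]; simp).abs_le hg hV x
  beta_reduce at hn
  rw [h1 x hx, one_pow, one_mul] at hn
  refine hn.trans ?_
  have hf := factorial_add_four_rpow_le hs w.length
  calc 16 * (D * 5 ^ 4 * (K ^ (w.length + 4) * ((w.length + 4).factorial : ℝ) ^ s)) * V
      ≤ 16 * (D * 5 ^ 4 * (K ^ (w.length + 4) * (((2 : ℝ) ^ 4 * 24) ^ s *
        (((2 : ℝ) ^ s) ^ w.length * (w.length.factorial : ℝ) ^ s)))) * V := by gcongr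
    _ = _ := by rw [mul_pow, pow_add]; ring

lemma exists_cut {r : ℝ} (hr : 0 < r) :
    ∃ χ, Cut (ball 0 r) χ ∧ ∀ x ∈ ball (0 : E3) (r / 4), χ x = 1 := by
  let f : ContDiffBump (0 : E3) := ⟨r / 4, r / 2, by positivity, by linarith⟩
  refine ⟨f, ⟨⟨f.contDiff, f.hasCompactSupport, ?_⟩, fun _ => f.nonneg, fun _ => f.le_one⟩,
    fun x hx => f.one_of_mem_closedBall (ball_subset_closedBall hx)⟩
  rw [f.tsupport_eq]
  exact closedBall_subset_ball (by change r / 2 < r; linarith)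

lemma exists_pd_bound (hs : 1 ≤ s) {b : Fin 3 → Fin 3 → E3 → ℝ} (hb : ∀ j k, GevB s O (b j k)) :
    ∃ B, (∀ i j k, ∀ x ∈ O, |pd i (b j k) x| ≤ B) ∧
      ∀ i i' j k, ∀ x ∈ O, |pd i (pd i' (b j k)) x| ≤ B := by
  obtain ⟨B, -, hB⟩ := exists_uniform_bound (Set.finite_univ (α := Fin 3 × Fin 3))
    (P := fun (p : Fin 3 × Fin 3) (D : ℝ) => ∀ w : List (Fin 3), w.length ≤ 2 → ∀ x ∈ O,
      |dw w (b p.1 p.2) x| ≤ D)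
    (fun p D D' hDD' h w hw x hx => (h w hw x hx).trans hDD') (fun p _ => by
      obtain ⟨c, A, h⟩ := hb p.1 p.2
      have hc := h.c_nonneg
      have hA := h.A_nonneg
      refine ⟨c * (1 + A) ^ 2 * (Nat.factorial 2 : ℝ) ^ s,
          fun w hw x hx => (h.bound w x hx).trans ?_⟩
      have h2 : A ^ w.length ≤ (1 + A) ^ 2 :=
        (pow_le_pow_left₀ hA (by linarith) _).trans (pow_le_pow_right₀ (by linarith) hw)
      have := factorial_rpow_mono hs hw
      gcongr) 0
  exact ⟨B, fun i j k x hx => hB (j, k) trivial [i] (by simp) x hx,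
    fun i i' j k x hx => hB (j, k) trivial [i', i] (by simp) x hx⟩

theorem gevrey_of_system [Fintype ι] (hO : IsOpen O) (h0 : (0 : E3) ∈ O) (hs : 1 ≤ s)
    {b1 b2 : Fin 3 → Fin 3 → E3 → ℝ} (hb1 : ∀ j k, GevB s O (b1 j k))
    (hb2 : ∀ j k, GevB s O (b2 j k)) {c1 c2 : ℝ} (hc1 : 0 < c1) (hc2 : 0 < c2)
    (hell1 : ∀ ξ : Fin 3 → ℝ, c1 * (∑ i, ξ i ^ 2) ≤ ∑ j, ∑ k, b1 j k 0 * ξ j * ξ k)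
    (hell2 : ∀ ξ : Fin 3 → ℝ, c2 * (∑ i, ξ i ^ 2) ≤ ∑ j, ∑ k, b2 j k 0 * ξ j * ξ k)
    {T : ι → ι → (E3 → ℝ) → E3 → ℝ} (hT : ∀ O' ⊆ O, ∀ i j, IsDO s O' 3 (T i j))
        (hU : ∀ i, Sm O (U i))
    (hsys : ∀ i, ∀ x ∈ O, op2 b2 (op2 b1 (U i)) x = ∑ j, T i j (U j) x) :
    ∃ r > 0, ball 0 r ⊆ O ∧ ∀ i, GevB s (ball 0 r) (U i) := by
  obtain ⟨R1, hR1, -, hR1O, -, -, -, hcl1⟩ := exists_coef_bounds hO h0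
    (fun j k => (hb1 j k).sm) (show 0 < c1 / 11 by positivity)
  obtain ⟨R2, hR2, -, hR2O, -, -, -, hcl2⟩ := exists_coef_bounds hO h0
    (fun j k => (hb2 j k).sm) (show 0 < c2 / 11 by positivity)
  obtain ⟨B, hB1, hB2⟩ := exists_pd_bound hs hb1
  set R := min R1 R2
  have hR : 0 < R := lt_min hR1 hR2
  have hs1 : ball (0 : E3) R ⊆ ball 0 R1 := ball_subset_ball (min_le_left _ _)
  have hs2 : ball (0 : E3) R ⊆ ball 0 R2 := ball_subset_ball (min_le_right _ _)
  have hsO : ball (0 : E3) R ⊆ O := hs1.trans (ball_subset_closedBall.trans hR1O)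
  have hm : ∀ {f}, GevB s O f → GevB s (ball 0 R) f := fun ⟨c, A, h⟩ =>
    ⟨c, A, h.sm.mono hsO, h.c_nonneg, h.A_nonneg, fun w x hx => h.bound w x (hsO hx)⟩
  obtain ⟨C, -, hC⟩ := elliptic_fourth hc1 hc2 hell1 hell2 isOpen_ball
    (fun j k => (hm (hb1 j k)).sm) (fun j k => (hm (hb2 j k)).sm)
    (fun j k x hx => hcl1 j k x (hs1 hx)) (fun j k x hx => hcl2 j k x (hs2 hx))
    (fun i j k x hx => hB1 i j k x (hsO hx)) (fun i i' j k x hx => hB2 i i' j k x (hsO hx))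
  obtain ⟨χ, hχ, hχ1⟩ := exists_cut hR
  have hL : IsDO s (ball 0 R) 4 fun f => op2 b2 (op2 b1 f) :=
    (IsDO.id.op2 isOpen_ball hs fun j k => hm (hb1 j k)).op2 isOpen_ball hs fun j k => hm (hb2 j k)
  obtain ⟨K, hK, hE⟩ := gevrey_energy isOpen_ball hs hχ (fun i => (hU i).mono hsO) hL
    (fun u hu => (hu.op2 isOpen_ball fun j k => (hm (hb1 j k)).sm).op2 isOpen_ball
      fun j k => (hm (hb2 j k)).sm) (hT _ hsO) (fun i x hx => hsys i x (hsO hx)) hC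
  have hs4 : ball (0 : E3) (R / 4) ⊆ ball 0 R := ball_subset_ball (by linarith)
  exact ⟨R / 4, by positivity, hs4.trans hsO, fun i => EH.gevB isOpen_ball measure_ball_lt_top.ne
    hs hK hχ (fun i => (hU i).mono hsO) hE hs4 hχ1 i⟩

end

section

variable {O : Set E3} {f : E3 → ℝ} {r s c A α : ℝ}

lemma abs_coord_le (v : E3) (i : Fin 3) : |v i| ≤ ‖v‖ := PiLp.norm_apply_le v i

lemma fderiv_eq_sum_pd (f : E3 → ℝ) (x v : E3) : fderiv ℝ f x v = ∑ i, v i * pd i f x := by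
  conv_lhs => rw [← (EuclideanSpace.basisFun (Fin 3) ℝ).sum_repr v]
  simp [pd, map_sum]

lemma norm_fderiv_le {x : E3} {S : ℝ} (hS : ∀ i, |pd i f x| ≤ S) : ‖fderiv ℝ f x‖ ≤ 3 * S := by
  have h0 : 0 ≤ S := (abs_nonneg _).trans (hS 0)
  refine ContinuousLinearMap.opNorm_le_bound _ (by positivity) fun v => ?_
  rw [fderiv_eq_sum_pd, Real.norm_eq_abs]
  refine (abs_sum_le_sum_abs _ _).trans ?_
  calc ∑ i, |v i * pd i f x| ≤ ∑ _i : Fin 3, ‖v‖ * S := by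
        gcongr with i
        rw [abs_mul]
        gcongr
        · exact abs_coord_le v i
        · exact hS i
    _ = _ := by simp; ring

lemma abs_sub_le_of_pd_le (hf : Sm (ball 0 r) f) {S : ℝ}
    (hS : ∀ i, ∀ x ∈ ball (0 : E3) r, |pd i f x| ≤ S) {x y : E3} (hx : x ∈ ball (0 : E3) r)
    (hy : y ∈ ball (0 : E3) r) : |f y - f x| ≤ 3 * S * ‖y - x‖ :=
  (convex_ball (0 : E3) r).norm_image_sub_le_of_norm_fderiv_le
    (fun _ hz => hf.diffAt isOpen_ball hz) (fun z hz => norm_fderiv_le fun i => hS i z hz) hx hy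

lemma Sm.hasDerivAt_ray (hO : IsOpen O) (hf : Sm O f) (x : E3) {t : ℝ} (ht : t • x ∈ O) :
    HasDerivAt (fun t : ℝ => f (t • x)) (∑ i, x i * _root_.pd i f (t • x)) t := by
  have h1 : HasDerivAt (fun t : ℝ => t • x) x t := by
    simpa using (hasDerivAt_id t).smul_const x
  have := (hf.diffAt hO ht).hasFDerivAt.comp_hasDerivAt t h1
  rwa [fderiv_eq_sum_pd] at this

lemma abs_le_of_pd_le_pow (hf : Sm (ball 0 r) f) (h0 : f 0 = 0) {D : ℝ} {n : ℕ}
    (h : ∀ i, ∀ x ∈ ball (0 : E3) r, |pd i f x| ≤ D * ‖x‖ ^ n) {x : E3}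
    (hx : x ∈ ball (0 : E3) r) : |f x| ≤ 3 * D / (n + 1) * ‖x‖ ^ (n + 1) := by
  have hm : ∀ t ∈ Set.Icc (0 : ℝ) 1, t • x ∈ ball (0 : E3) r := fun t ht => by
    rw [mem_ball_zero_iff, norm_smul, Real.norm_of_nonneg ht.1]
    exact (mul_le_of_le_one_left (norm_nonneg x) ht.2).trans_lt (mem_ball_zero_iff.1 hx)
  have key := image_norm_le_of_norm_deriv_right_le_deriv_boundary (a := 0) (b := 1)
    (f := fun t : ℝ => f (t • x)) (f' := fun t => ∑ i, x i * pd i f (t • x))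
    (B := fun t => 3 * D / (n + 1) * ‖x‖ ^ (n + 1) * t ^ (n + 1))
    (B' := fun t => 3 * D * ‖x‖ ^ (n + 1) * t ^ n)
    (fun t ht => (hf.hasDerivAt_ray isOpen_ball x (hm t ht)).continuousAt.continuousWithinAt)
    (fun t ht => (hf.hasDerivAt_ray isOpen_ball x (hm t ⟨ht.1, ht.2.le⟩)).hasDerivWithinAt)
    (by simp [h0]) (fun t => by
      refine ((hasDerivAt_pow (n + 1) t).const_mul _).congr_deriv ?_
      rw [Nat.add_sub_cancel]
      push_cast
      field_simp)
    (fun t ht => by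
      rw [Real.norm_eq_abs]
      refine (abs_sum_le_sum_abs _ _).trans ?_
      calc ∑ i, |x i * pd i f (t • x)| ≤ ∑ _i : Fin 3, ‖x‖ * (D * ‖t • x‖ ^ n) := by
            gcongr with i
            rw [abs_mul]
            gcongr
            · exact abs_coord_le x i
            · exact h i _ (hm t ⟨ht.1, ht.2.le⟩)
        _ = _ := by
            rw [norm_smul, Real.norm_of_nonneg ht.1, mul_pow]
            simp
            ring) (x := 1) (by simp)
  simpa using key

lemma Gv.abs_le_pow (h : Gv s (ball 0 r) c A f) (hz : ∀ w, dw w f 0 = 0) (n : ℕ)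
    (w : List (Fin 3)) : ∀ x ∈ ball (0 : E3) r, |dw w f x| ≤
      3 ^ n / n.factorial * (c * A ^ (w.length + n) * ((w.length + n).factorial : ℝ) ^ s) *
        ‖x‖ ^ n := by
  have hc := h.c_nonneg
  have hA := h.A_nonneg
  induction n generalizing w with
  | zero => intro x hx; simpa using h.bound w x hx
  | succ n ih =>
    intro x hx
    have h1 := abs_le_of_pd_le_pow (h.sm.dw isOpen_ball w) (hz w)
      (D := 3 ^ n / n.factorial * (c * A ^ (w.length + (n + 1)) *
        ((w.length + (n + 1)).factorial : ℝ) ^ s)) (n := n) (fun i y hy => by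
        have := ih (w ++ [i]) y hy
        rw [dw_append, List.length_append, List.length_singleton, add_assoc, add_comm 1 n] at this
        exact this) hx
    refine h1.trans (le_of_eq ?_)
    rw [Nat.factorial_succ n]
    push_cast
    have : (n.factorial : ℝ) ≠ 0 := by positivity
    field_simp
    ring

/-- Vanishing faster than every power at the origin. -/
def Flat (f : E3 → ℝ) : Prop :=
  ∀ p : ℕ, ∃ C ≥ 0, ∃ δ > 0, ∀ x, x ≠ 0 → ‖x‖ < δ → |f x| ≤ C * ‖x‖ ^ p

lemma Flat.zero (hf : Flat f) (hO : IsOpen O) (h0 : (0 : E3) ∈ O) (hS : Sm O f) : f 0 = 0 := by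
  obtain ⟨C, hC, δ, hδ, h⟩ := hf 1
  have h1 : Filter.Tendsto (fun x => |f x|) (nhdsWithin 0 {0}ᶜ) (nhds |f 0|) :=
    ((hS.continuousOn.continuousAt (hO.mem_nhds h0)).tendsto.abs).mono_left nhdsWithin_le_nhds
  have h2 : Filter.Tendsto (fun x : E3 => C * ‖x‖ ^ 1) (nhdsWithin 0 {0}ᶜ) (nhds 0) := by
    have : Filter.Tendsto (fun x : E3 => C * ‖x‖ ^ 1) (nhds 0) (nhds (C * ‖(0 : E3)‖ ^ 1)) :=
      (by fun_prop : Continuous fun x : E3 => C * ‖x‖ ^ 1).tendsto 0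
    simpa using this.mono_left nhdsWithin_le_nhds
  have h3 : ∀ᶠ x in nhdsWithin (0 : E3) {0}ᶜ, |f x| ≤ C * ‖x‖ ^ 1 := by
    filter_upwards [self_mem_nhdsWithin, nhdsWithin_le_nhds (ball_mem_nhds 0 hδ)] with x hx hx'
    exact h x hx (mem_ball_zero_iff.1 hx')
  exact abs_nonpos_iff.1 (le_of_tendsto_of_tendsto h1 h2 h3)

lemma Flat.pd (hf : Flat f) (hr : 0 < r) (hS : Sm (ball 0 r) f) (i : Fin 3) :
    Flat (pd i f) := by
  intro p
  obtain ⟨C, hC, δ, hδ, h⟩ := hf (2 * (p + 2))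
  obtain ⟨S, hS0, hS2⟩ : ∃ S ≥ 0, ∀ j, ∀ x ∈ ball (0 : E3) (r / 2),
      |_root_.pd j (_root_.pd i f) x| ≤ S := by
    obtain ⟨S, hS0, h⟩ := exists_uniform_bound (Set.finite_univ (α := Fin 3))
      (P := fun (j : Fin 3) (D : ℝ) => ∀ x ∈ ball (0 : E3) (r / 2),
          |_root_.pd j (_root_.pd i f) x| ≤ D)
      (fun p D D' hDD' h x hx => (h x hx).trans hDD') (fun j _ => by
        obtain ⟨D, -, h⟩ := exists_bound_dw isOpen_ball hS (R := r / 2)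
          (closedBall_subset_ball (by linarith)) [i, j]
        exact ⟨D, fun x hx => h x (ball_subset_closedBall hx)⟩) 0
    exact ⟨S, hS0, fun j => h j trivial⟩
  refine ⟨C * (2 ^ (2 * (p + 2)) + 1) + 3 * S, by positivity, min (min (δ / 2) (r / 4)) (1 / 2),
    by positivity, fun x hx0 hx => ?_⟩
  have hxδ : ‖x‖ < δ / 2 := hx.trans_le ((min_le_left _ _).trans (min_le_left _ _))
  have hxr : ‖x‖ < r / 4 := hx.trans_le ((min_le_left _ _).trans (min_le_right _ _))
  have hx1 : ‖x‖ < 1 / 2 := hx.trans_le (min_le_right _ _)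
  have hxp : 0 < ‖x‖ := norm_pos_iff.2 hx0
  set t := ‖x‖ ^ (p + 2) with ht
  have htp : 0 < t := by positivity
  have htx : t ≤ ‖x‖ / 2 := by
    calc t = ‖x‖ ^ (p + 1) * ‖x‖ := pow_succ _ _
      _ ≤ ‖x‖ ^ 1 * ‖x‖ := by
          gcongr ?_ * _
          exact pow_le_pow_of_le_one hxp.le (by linarith) (by simp)
      _ ≤ _ := by nlinarith
  set e : E3 := EuclideanSpace.single i 1
  have he : ∀ τ ∈ Set.Icc 0 t, ‖x + τ • e‖ ≤ 2 * ‖x‖ ∧ x + τ • e ∈ ball (0 : E3) (r / 2) ∧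
      x + τ • e ≠ 0 := by
    intro τ hτ
    have h1 : ‖τ • e‖ = τ := by simp [e, norm_smul, abs_of_nonneg hτ.1]
    have h2 : ‖x + τ • e‖ ≤ ‖x‖ + τ := (norm_add_le _ _).trans_eq (by rw [h1])
    refine ⟨by linarith [hτ.2], by rw [mem_ball_zero_iff]; linarith [hτ.2], fun h => ?_⟩
    have : ‖x‖ = τ := by rw [eq_neg_of_add_eq_zero_left h, norm_neg, h1]
    linarith [hτ.2]
  have hsub : ball (0 : E3) (r / 2) ⊆ ball 0 r := ball_subset_ball (by linarith)
  have hd : ∀ τ ∈ Set.Icc 0 t, HasDerivAt (fun τ : ℝ => f (x + τ • e)) (_root_.pd i f (x + τ • e))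
      τ := by
    intro τ hτ
    have h1 : HasDerivAt (fun τ : ℝ => x + τ • e) e τ := by
      simpa using ((hasDerivAt_id τ).smul_const e).const_add x
    exact (hS.diffAt isOpen_ball (hsub (he τ hτ).2.1)).hasFDerivAt.comp_hasDerivAt τ h1
  obtain ⟨τ, hτ, hτe⟩ := exists_hasDerivAt_eq_slope (fun τ : ℝ => f (x + τ • e))
    (fun τ => _root_.pd i f (x + τ • e)) htp
    (fun τ hτ => (hd τ hτ).continuousAt.continuousWithinAt)
    (fun τ hτ => hd τ ⟨hτ.1.le, hτ.2.le⟩)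
  have hτ' : τ ∈ Set.Icc 0 t := ⟨hτ.1.le, hτ.2.le⟩
  have hxb : x ∈ ball (0 : E3) (r / 2) := by rw [mem_ball_zero_iff]; linarith
  have h1 := abs_sub_le_of_pd_le ((hS.pd isOpen_ball i).mono hsub) hS2 hxb (he τ hτ').2.1
  have h2 : ‖x + τ • e - x‖ = τ := by simp [e, norm_smul, abs_of_nonneg hτ'.1]
  have h3 : |f (x + t • e)| ≤ C * (2 * ‖x‖) ^ (2 * (p + 2)) := by
    have := he t ⟨htp.le, le_rfl⟩
    exact (h _ this.2.2 (by linarith [this.1])).trans (by gcongr; exact this.1)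
  have h4 : |f x| ≤ C * ‖x‖ ^ (2 * (p + 2)) := h x hx0 (by linarith)
  have h5 : ‖x‖ ^ (2 * (p + 2)) = t * t := by rw [ht, ← pow_add, two_mul]
  rw [h2] at h1
  simp only [zero_smul, add_zero, sub_zero] at hτe
  have h6 : |_root_.pd i f (x + τ • e)| ≤ C * (2 ^ (2 * (p + 2)) + 1) * t := by
    rw [hτe, abs_div, abs_of_pos htp, div_le_iff₀ htp]
    rw [mul_pow, h5] at h3
    rw [h5] at h4
    calc |f (x + t • e) - f x| ≤ |f (x + t • e)| + |f x| := abs_sub _ _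
      _ ≤ _ := by linarith
  have h7 : t ≤ ‖x‖ ^ p := pow_le_pow_of_le_one hxp.le (by linarith) (by simp)
  have h8 : 3 * S * τ ≤ 3 * S * t := by gcongr; exact hτ'.2
  calc |_root_.pd i f x|
      ≤ |_root_.pd i f (x + τ • e)| + |_root_.pd i f (x + τ • e) - _root_.pd i f x| := by
        have := abs_sub_abs_le_abs_sub (_root_.pd i f x) (_root_.pd i f (x + τ • e))
        rw [abs_sub_comm] at this
        linarith
    _ ≤ (C * (2 ^ (2 * (p + 2)) + 1) + 3 * S) * t := by linarith
    _ ≤ _ := by gcongr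

lemma Flat.dw (hf : Flat f) (hr : 0 < r) (hS : Sm (ball 0 r) f) (w : List (Fin 3)) :
    Flat (dw w f) := by
  induction w generalizing f with
  | nil => exact hf
  | cons i w ih => exact ih (hf.pd hr hS i) (hS.pd isOpen_ball i)

end

section

variable {O : Set E3} {f : E3 → ℝ} {r s c A α : ℝ}

lemma flat_of_integral (hr : 0 < r) (hf : Sm (ball 0 r) f)
    (h : ∀ N : ℝ, 0 < N → ∃ C > 0, ∃ δ > 0, ∀ R : ℝ, 0 < R → R < δ →
      (∫ x in {y : E3 | R ≤ ‖y‖ ∧ ‖y‖ ≤ 2 * R}, f x ^ 2) ≤ C * R ^ N) : Flat f := by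
  obtain ⟨S, hS0, hS⟩ : ∃ S ≥ 0, ∀ j, ∀ x ∈ ball (0 : E3) (r / 2), |pd j f x| ≤ S := by
    obtain ⟨S, hS0, h⟩ := exists_uniform_bound (Set.finite_univ (α := Fin 3))
      (P := fun (j : Fin 3) (D : ℝ) => ∀ x ∈ ball (0 : E3) (r / 2), |pd j f x| ≤ D)
      (fun p D D' hDD' h x hx => (h x hx).trans hDD') (fun j _ => by
        obtain ⟨D, -, h⟩ := exists_bound_dw isOpen_ball hf (R := r / 2)
          (closedBall_subset_ball (by linarith)) [j]
        exact ⟨D, fun x hx => h x (ball_subset_closedBall hx)⟩) 0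
    exact ⟨S, hS0, fun j => h j trivial⟩
  have hsub : ball (0 : E3) (r / 2) ⊆ ball 0 r := ball_subset_ball (by linarith)
  suffices H : ∀ p : ℕ, 2 ≤ p → ∃ C ≥ 0, ∃ δ > 0, ∀ x : E3, x ≠ 0 → ‖x‖ < δ →
      |f x| ≤ C * ‖x‖ ^ p by
    intro p
    obtain ⟨C, hC, δ, hδ, H⟩ := H (p + 2) (by simp)
    refine ⟨C, hC, min δ 1, by positivity, fun x hx hxδ => ?_⟩
    refine (H x hx (hxδ.trans_le (min_le_left _ _))).trans ?_
    gcongr ?_ * ?_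
    exact pow_le_pow_of_le_one (norm_nonneg _) (hxδ.le.trans (min_le_right _ _)) (by simp)
  intro p hp
  obtain ⟨C, hC, δ, hδ, h⟩ := h ((5 * p : ℕ) : ℝ) (by positivity)
  set v := volume.real (ball (0 : E3) 1) with hv
  have hv0 : 0 < v := by
    rw [hv, measureReal_def]
    exact ENNReal.toReal_pos (measure_ball_pos volume _ one_pos).ne' measure_ball_lt_top.ne
  refine ⟨Real.sqrt (2 * C / v + 18 * S ^ 2), by positivity,
      min (min δ (r / 4)) (1 / 2), by positivity, fun x hx0 hx => ?_⟩
  have hxδ : ‖x‖ < δ := hx.trans_le ((min_le_left _ _).trans (min_le_left _ _))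
  have hxr : ‖x‖ < r / 4 := hx.trans_le ((min_le_left _ _).trans (min_le_right _ _))
  have hx1 : ‖x‖ < 1 / 2 := hx.trans_le (min_le_right _ _)
  have hxp : 0 < ‖x‖ := norm_pos_iff.2 hx0
  set R := 2 / 3 * ‖x‖ with hR
  have hRp : 0 < R := by positivity
  set t := R ^ p with ht
  have htp : 0 < t := by positivity
  have htR : t ≤ R / 2 := by
    calc t ≤ R ^ 2 := pow_le_pow_of_le_one hRp.le (by linarith) hp
      _ ≤ R / 2 := by nlinarith
  have hann : ball x t ⊆ {y : E3 | R ≤ ‖y‖ ∧ ‖y‖ ≤ 2 * R} := fun y hy => by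
    rw [mem_ball, dist_eq_norm] at hy
    have h1 := abs_norm_sub_norm_le y x
    rw [abs_le] at h1
    exact ⟨by linarith, by linarith⟩
  have hannr : {y : E3 | R ≤ ‖y‖ ∧ ‖y‖ ≤ 2 * R} ⊆ ball 0 (r / 2) := fun y hy => by
    rw [mem_ball_zero_iff]; linarith [hy.2]
  have hcomp : IsCompact {y : E3 | R ≤ ‖y‖ ∧ ‖y‖ ≤ 2 * R} :=
    (isCompact_closedBall (0 : E3) (2 * R)).of_isClosed_subset
      ((isClosed_le continuous_const continuous_norm).inter
        (isClosed_le continuous_norm continuous_const)) fun y hy => mem_closedBall_zero_iff.2 hy.2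
  have hfi : IntegrableOn (fun y => f y ^ 2) {y : E3 | R ≤ ‖y‖ ∧ ‖y‖ ≤ 2 * R} :=
    ((hf.continuousOn.mono (hannr.trans hsub)).pow 2).integrableOn_compact hcomp
  have hvol : volume.real (ball x t) = t ^ 3 * v := by
    rw [measureReal_def, Measure.addHaar_ball volume x htp.le, ENNReal.toReal_mul,
      ENNReal.toReal_ofReal (by positivity)]
    simp [hv, measureReal_def]
  have hxb : x ∈ ball (0 : E3) (r / 2) := by rw [mem_ball_zero_iff]; linarith
  have hconst : ∀ a : ℝ, IntegrableOn (fun _ => a) (ball x t) := fun a =>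
    integrableOn_const measure_ball_lt_top.ne enorm_ne_top
  have h1 : ∀ y ∈ ball x t, f x ^ 2 ≤ 2 * f y ^ 2 + 18 * S ^ 2 * t ^ 2 := fun y hy => by
    have h2 := abs_sub_le_of_pd_le (hf.mono hsub) hS (hannr (hann hy)) hxb
    have h3 : ‖x - y‖ ≤ t := by rw [← dist_eq_norm, dist_comm]; exact hy.le
    have h4 : |f x - f y| ≤ 3 * S * t := h2.trans (by gcongr)
    have h5 : (f x - f y) ^ 2 ≤ (3 * S * t) ^ 2 := sq_le_sq' (by linarith [neg_abs_le (f x - f y)])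
      ((le_abs_self _).trans h4)
    nlinarith [sq_nonneg (f x - 2 * f y)]
  have h2 : ∫ y in ball x t, f x ^ 2 ≤ ∫ y in ball x t, (2 * f y ^ 2 + 18 * S ^ 2 * t ^ 2) :=
    setIntegral_mono_on (hconst _)
      (((hfi.mono_set hann).const_mul 2).add (hconst _))
      measurableSet_ball h1
  rw [integral_add ((hfi.mono_set hann).const_mul 2)
    (hconst _), integral_const_mul, setIntegral_const,
    setIntegral_const, smul_eq_mul, smul_eq_mul, hvol] at h2
  have h3 : ∫ y in ball x t, f y ^ 2 ≤ C * R ^ (5 * p) := by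
    refine (setIntegral_mono_set hfi (Filter.Eventually.of_forall fun y => sq_nonneg _)
      hann.eventuallyLE).trans ?_
    have := h R hRp (by linarith)
    rwa [Real.rpow_natCast] at this
  have h4 : R ^ (5 * p) = t ^ 3 * t ^ 2 := by rw [ht, ← pow_mul, ← pow_mul, ← pow_add]; ring_nf
  rw [h4] at h3
  have h5 : f x ^ 2 ≤ (2 * C / v + 18 * S ^ 2) * t ^ 2 := by
    have : t ^ 3 * v * f x ^ 2 ≤ t ^ 3 * v * ((2 * C / v + 18 * S ^ 2) * t ^ 2) := by
      refine h2.trans ?_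
      have : t ^ 3 * v * ((2 * C / v + 18 * S ^ 2) * t ^ 2) =
        2 * (C * (t ^ 3 * t ^ 2)) + t ^ 3 * v * (18 * S ^ 2 * t ^ 2) := by field_simp
      rw [this]; linarith
    exact le_of_mul_le_mul_left this (by positivity)
  have h6 : t ≤ ‖x‖ ^ p := by rw [ht]; gcongr; linarith
  calc |f x| = Real.sqrt (f x ^ 2) := (Real.sqrt_sq_eq_abs _).symm
    _ ≤ Real.sqrt ((2 * C / v + 18 * S ^ 2) * t ^ 2) := Real.sqrt_le_sqrt h5
    _ = Real.sqrt (2 * C / v + 18 * S ^ 2) * t := by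
      rw [Real.sqrt_mul (by positivity), Real.sqrt_sq htp.le]
    _ ≤ _ := by gcongr

/-- Vanishing at the origin faster than `exp (-M |x|^(-α))` for every `M`. -/
def ExpFlat (α : ℝ) (f : E3 → ℝ) : Prop :=
  ∀ M : ℝ, ∃ C ≥ 0, ∃ δ > 0, ∀ x, x ≠ 0 → ‖x‖ < δ → |f x| ≤ C * Real.exp (-M * wt α x)

lemma Gv.expFlat (h : Gv s (ball 0 r) c A f) (hr : 0 < r) (hf : Flat f) (hs : 1 ≤ s) (hα : 0 < α)
    (hsα : s < 1 + 1 / α) : ExpFlat α f := by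
  have hc := h.c_nonneg
  have hA := h.A_nonneg
  have hγ : 0 < 1 - α * (s - 1) := by
    have : α * (s - 1) < α * (1 / α) := by gcongr; linarith
    rw [mul_one_div_cancel hα.ne'] at this
    linarith
  have hz : ∀ w, dw w f 0 = 0 := fun w =>
    (hf.dw hr h.sm w).zero isOpen_ball (mem_ball_self hr) (h.sm.dw isOpen_ball w)
  have hN : ∀ N : ℕ, 1 ≤ N → ∀ x ∈ ball (0 : E3) r,
      |f x| ≤ c * (3 * A * ‖x‖ * (N : ℝ) ^ (s - 1)) ^ N := fun N hN x hx => by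
    have h1 := h.abs_le_pow hz N [] x hx
    simp only [dw_nil, List.length_nil, zero_add] at h1
    refine h1.trans ?_
    have h2 : (N.factorial : ℝ) ^ s = N.factorial * (N.factorial : ℝ) ^ (s - 1) := by
      rw [Real.rpow_sub_one (by positivity)]; field_simp
    have h3 : (N.factorial : ℝ) ^ (s - 1) ≤ ((N : ℝ) ^ (s - 1)) ^ N := by
      have : (N.factorial : ℝ) ≤ (N : ℝ) ^ N := by exact_mod_cast Nat.factorial_le_pow N
      refine (Real.rpow_le_rpow (by positivity) this (by linarith)).trans_eq ?_
      rw [← Real.rpow_natCast, ← Real.rpow_natCast, ← Real.rpow_mul (by positivity),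
        ← Real.rpow_mul (by positivity), mul_comm]
    rw [h2]
    calc 3 ^ N / (N.factorial : ℝ) * (c * A ^ N * (N.factorial * (N.factorial : ℝ) ^ (s - 1))) *
        ‖x‖ ^ N
        = c * (3 * A * ‖x‖) ^ N * (N.factorial : ℝ) ^ (s - 1) := by
          rw [mul_pow, mul_pow]; field_simp
      _ ≤ c * (3 * A * ‖x‖) ^ N * ((N : ℝ) ^ (s - 1)) ^ N := by gcongr
      _ = _ := by rw [mul_pow (3 * A * ‖x‖)]; ring
  suffices H : ∀ M ≥ 1, ∃ C ≥ 0, ∃ δ > 0, ∀ x : E3, x ≠ 0 → ‖x‖ < δ →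
      |f x| ≤ C * Real.exp (-M * wt α x) by
    intro M
    obtain ⟨C, hC, δ, hδ, H⟩ := H (max M 1) (le_max_right _ _)
    refine ⟨C, hC, δ, hδ, fun x hx hxδ => (H x hx hxδ).trans ?_⟩
    gcongr
    · unfold wt; positivity
    · exact le_max_left _ _
  intro M hM
  have hlim : Filter.Tendsto (fun ρ : ℝ => 3 * A * (2 * M) ^ (s - 1) * ρ ^ (1 - α * (s - 1)))
      (nhds 0) (nhds 0) := by
    have h1 : Filter.Tendsto (fun ρ : ℝ => 3 * A * (2 * M) ^ (s - 1) * ρ ^ (1 - α * (s - 1)))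
        (nhds 0) (nhds (3 * A * (2 * M) ^ (s - 1) * 0 ^ (1 - α * (s - 1)))) :=
      (Real.continuousAt_rpow_const 0 _ (Or.inr hγ.le)).tendsto.const_mul _
    simpa [Real.zero_rpow hγ.ne'] using h1
  obtain ⟨δ, hδ, hδ'⟩ := Metric.eventually_nhds_iff.1
    (hlim.eventually (gt_mem_nhds (Real.exp_pos (-1))))
  refine ⟨c, hc, min (min δ r) 1, by positivity, fun x hx0 hx => ?_⟩
  have hxδ : ‖x‖ < δ := hx.trans_le ((min_le_left _ _).trans (min_le_left _ _))
  have hxr : ‖x‖ < r := hx.trans_le ((min_le_left _ _).trans (min_le_right _ _))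
  have hx1 : ‖x‖ < 1 := hx.trans_le (min_le_right _ _)
  have hxp : 0 < ‖x‖ := norm_pos_iff.2 hx0
  have hw1 : 1 ≤ wt α x := Real.one_le_rpow_of_pos_of_le_one_of_nonpos hxp hx1.le (by linarith)
  set N := ⌈M * wt α x⌉₊ with hNdef
  have hMw : 1 ≤ M * wt α x := one_le_mul_of_one_le_of_one_le hM hw1
  have hN1 : M * wt α x ≤ N := Nat.le_ceil _
  have hN2 : (N : ℝ) ≤ 2 * M * wt α x := by
    have := Nat.ceil_lt_add_one (show 0 ≤ M * wt α x by linarith)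
    linarith
  have hN0 : 1 ≤ N := by exact_mod_cast hMw.trans hN1
  refine (hN N hN0 x (mem_ball_zero_iff.2 hxr)).trans ?_
  gcongr
  have h1 : 3 * A * ‖x‖ * (N : ℝ) ^ (s - 1) ≤ Real.exp (-1) := by
    have h2 := (hδ' (y := ‖x‖) (by simpa using hxδ)).le
    refine le_trans ?_ h2
    calc 3 * A * ‖x‖ * (N : ℝ) ^ (s - 1) ≤ 3 * A * ‖x‖ * (2 * M * wt α x) ^ (s - 1) := by
          gcongr
      _ = _ := by
        rw [Real.mul_rpow (by positivity) (by linarith), wt, ← Real.rpow_mul hxp.le,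
          sub_eq_add_neg 1 (α * (s - 1)), Real.rpow_add hxp, Real.rpow_one,
          show -α * (s - 1) = -(α * (s - 1)) by ring]
        ring
  calc (3 * A * ‖x‖ * (N : ℝ) ^ (s - 1)) ^ N ≤ Real.exp (-1) ^ N := by gcongr
    _ = Real.exp (-N) := by rw [← Real.exp_nat_mul]; simp
    _ ≤ _ := Real.exp_le_exp.2 (by linarith)

end

section

variable {O : Set E3} {f g u χ θ : E3 → ℝ} {r s c A α ε : ℝ}

lemma op2_congr {b : Fin 3 → Fin 3 → E3 → ℝ} (hO : IsOpen O) (h : ∀ x ∈ O, f x = g x) :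
    ∀ x ∈ O, op2 b f x = op2 b g x := fun x hx => by
  unfold op2
  simp_rw [fun j k => pd_congr hO (fun y hy => pd_congr hO h k hy) j hx]

lemma dsq_congr (hO : IsOpen O) (h : ∀ x ∈ O, f x = g x) : ∀ x ∈ O, dsq f x = dsq g x := by
  have h1 : ∀ {f g : E3 → ℝ}, (∀ x ∈ O, f x = g x) → ∀ x ∈ O, gsq f x = gsq g x :=
    fun h x hx => by unfold gsq; simp_rw [fun i => pd_congr hO h i hx]
  have h2 : ∀ {f g : E3 → ℝ}, (∀ x ∈ O, f x = g x) → ∀ x ∈ O, hsq f x = hsq g x :=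
    fun h x hx => by unfold hsq; simp_rw [fun i => h1 (fun y hy => pd_congr hO h i hy) x hx]
  intro x hx
  have h3 : tsq f x = tsq g x := by
    unfold tsq; simp_rw [fun i => h2 (fun y hy => pd_congr hO h i hy) x hx]
  unfold dsq
  rw [h3, h2 h x hx, h1 h x hx, h x hx]

lemma abs_dw_le_sqrt_dsq (f : E3 → ℝ) (x : E3) {w : List (Fin 3)} (hw : w.length ≤ 3) :
    |dw w f x| ≤ Real.sqrt (dsq f x) := by
  have h1 : ∀ (f : E3 → ℝ) i, pd i f x ^ 2 ≤ gsq f x := fun f i =>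
    single_le_sum (f := fun i => pd i f x ^ 2) (fun _ _ => sq_nonneg _) (mem_univ i)
  have h2 : ∀ (f : E3 → ℝ) i, gsq (pd i f) x ≤ hsq f x := fun f i =>
    single_le_sum (f := fun i => gsq (pd i f) x) (fun _ _ => gsq_nonneg _ _) (mem_univ i)
  have h3 : ∀ (f : E3 → ℝ) i, hsq (pd i f) x ≤ tsq f x := fun f i =>
    single_le_sum (f := fun i => hsq (pd i f) x) (fun _ _ => hsq_nonneg _ _) (mem_univ i)
  have := tsq_nonneg f x
  have := hsq_nonneg f x
  have := gsq_nonneg f x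
  have := sq_nonneg (f x)
  refine Real.abs_le_sqrt ?_
  unfold dsq
  match w, hw with
  | [], _ => simp only [dw_nil]; linarith
  | [i], _ => simp only [dw_nil, dw_cons]; linarith [h1 f i]
  | [i, j], _ => simp only [dw_nil, dw_cons]; linarith [h1 (pd i f) j, h2 f i]
  | [i, j, k], _ =>
    simp only [dw_nil, dw_cons]; linarith [h1 (pd j (pd i f)) k, h2 (pd i f) j, h3 f i]

lemma IsDO.abs_le {n : ℕ} {T : (E3 → ℝ) → E3 → ℝ} (h : IsDO s O n T) :
    ∃ K ≥ 0, ∀ f, Sm O f → ∀ x ∈ O, ∀ a,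
      (∀ w : List (Fin 3), w.length ≤ n → |_root_.dw w f x| ≤ a) → |T f x| ≤ K * a := by
  obtain ⟨l, hl, hT⟩ := h
  obtain ⟨c, hc, A, -, hcA⟩ := exists_common_gv fun p hp => (hl p hp).1
  refine ⟨l.length * c, by positivity, fun f hf x hx a ha => ?_⟩
  have ha0 : 0 ≤ a := (abs_nonneg _).trans (ha [] (by simp))
  rw [hT f hf x hx]
  refine (list_sum_abs_le _ _).trans ?_
  have h1 : (l.map fun p => |p.1 x * _root_.dw p.2 f x|).sum ≤ (l.map fun _ => c * a).sum :=
    List.sum_le_sum fun p hp => by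
      rw [abs_mul]
      have h1 := (hcA p hp).abs_le hx
      have h2 := ha p.2 (hl p hp).2
      gcongr
  refine h1.trans_eq ?_
  rw [List.map_const', List.sum_replicate, nsmul_eq_mul, mul_assoc]

lemma ExpFlat.ew_mul_abs_le (hf : ExpFlat α f) (hα : 0 < α) (τ : ℝ) :
    ∃ C ≥ 0, ∃ δ > 0, ∀ x, x ≠ 0 → ‖x‖ < δ → ew α τ x * |f x| ≤ C * ‖x‖ ^ 4 := by
  obtain ⟨C, hC, δ, hδ, h⟩ := hf (τ + 1)
  set n := ⌈4 / α⌉₊ with hn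
  refine ⟨C * n.factorial, by positivity, min δ 1, by positivity, fun x hx0 hx => ?_⟩
  have hxδ : ‖x‖ < δ := hx.trans_le (min_le_left _ _)
  have hx1 : ‖x‖ < 1 := hx.trans_le (min_le_right _ _)
  have hxp : 0 < ‖x‖ := norm_pos_iff.2 hx0
  have hw0 : 0 < wt α x := Real.rpow_pos_of_pos hxp _
  have h1 : wt α x ^ n ≤ n.factorial * Real.exp (wt α x) := by
    have := Real.pow_div_factorial_le_exp (wt α x) hw0.le n
    rwa [div_le_iff₀' (by positivity)] at this
  have h2 : 1 ≤ ‖x‖ ^ 4 * wt α x ^ n := by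
    have h3 : 4 ≤ α * n := by
      have := Nat.le_ceil (4 / α)
      rwa [div_le_iff₀' hα] at this
    unfold wt
    rw [← Real.rpow_natCast, ← Real.rpow_natCast, ← Real.rpow_mul hxp.le, ← Real.rpow_add hxp]
    refine Real.one_le_rpow_of_pos_of_le_one_of_nonpos hxp hx1.le ?_
    push_cast
    linarith
  have h3 : Real.exp (-wt α x) ≤ n.factorial * ‖x‖ ^ 4 := by
    rw [Real.exp_neg, inv_le_iff_one_le_mul₀ (Real.exp_pos _)]
    calc (1 : ℝ) ≤ ‖x‖ ^ 4 * wt α x ^ n := h2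
      _ ≤ ‖x‖ ^ 4 * (n.factorial * Real.exp (wt α x)) := by gcongr
      _ = _ := by ring
  calc ew α τ x * |f x| ≤ ew α τ x * (C * Real.exp (-(τ + 1) * wt α x)) := by
        have := ew_pos α τ x
        gcongr
        exact h x hx0 hxδ
    _ = C * Real.exp (-wt α x) := by
        rw [ew, mul_left_comm, ← Real.exp_add]; congr 2; ring
    _ ≤ _ := by rw [mul_assoc]; gcongr

lemma pd_comp_smul (hf : ContDiff ℝ (⊤ : ℕ∞) f) (c : ℝ) (i : Fin 3) (x : E3) :
    pd i (fun x => f (c • x)) x = c * pd i f (c • x) := by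
  have h1 : HasFDerivAt (fun x : E3 => c • x) (c • ContinuousLinearMap.id ℝ E3) x :=
    (hasFDerivAt_id x).const_smul c
  have h2 := ((hf.differentiable (by simp) (c • x)).hasFDerivAt.comp x h1).fderiv
  unfold pd
  rw [show (fun x => f (c • x)) = f ∘ fun x : E3 => c • x from rfl, h2]
  simp

lemma dw_comp_smul (hf : TF O f) (c : ℝ) (w : List (Fin 3)) (x : E3) :
    dw w (fun x => f (c • x)) x = c ^ w.length * dw w f (c • x) := by
  induction w generalizing f with
  | nil => simp [dw_nil]
  | cons i w ih =>
    have h1 : pd i (fun x => f (c • x)) = fun x => c * pd i f (c • x) :=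
      funext fun x => pd_comp_smul hf.smooth c i x
    have h2 : ContDiff ℝ (⊤ : ℕ∞) fun x => pd i f (c • x) :=
      (hf.pd i).smooth.comp (contDiff_const_smul c)
    rw [dw_cons, h1, dw_const_mul isOpen_univ h2.contDiffOn (Set.mem_univ x), ih (hf.pd i), dw_cons,
      List.length_cons]
    ring

/-- The function `u` cut off near the origin at scale `ε` and away from it. -/
def trunc (χ θ : E3 → ℝ) (ε : ℝ) (u : E3 → ℝ) (x : E3) : ℝ :=
  χ x * u x - θ (ε⁻¹ • x) * (χ x * u x)

lemma trunc_of_lt (hθ : Cut (ball 0 1) θ) (hε : 0 < ε) {x : E3} (hx : ε < ‖x‖) :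
    trunc χ θ ε u x = χ x * u x := by
  have : θ (ε⁻¹ • x) = 0 := hθ.tf.zero_of_notMem (by
    rw [mem_ball_zero_iff, norm_smul, norm_inv, Real.norm_of_nonneg hε.le, not_lt,
      ← div_eq_inv_mul, one_le_div hε]
    exact hx.le)
  rw [trunc, this]; ring

lemma trunc_of_norm_lt (hχ1 : ∀ x ∈ ball (0 : E3) (r / 4), χ x = 1) {x : E3} (hx : ‖x‖ < r / 4) :
    trunc χ θ ε u x = u x - θ (ε⁻¹ • x) * u x := by
  rw [trunc, hχ1 x (mem_ball_zero_iff.2 hx), one_mul]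

lemma TF.trunc (hχ : Cut (ball 0 r) χ) (hθ : Cut (ball 0 1) θ)
    (hθ1 : ∀ x ∈ ball (0 : E3) (1 / 4), θ x = 1) (hε : 0 < ε) (hu : Sm (ball 0 r) u) :
    TF (pb r) (trunc χ θ ε u) := by
  have h1 : TF (ball 0 r) (fun x => χ x * u x) := hχ.tf.mul_sm isOpen_ball hu
  have h2 : ContDiff ℝ (⊤ : ℕ∞) fun x => θ (ε⁻¹ • x) := hθ.tf.smooth.comp (contDiff_const_smul _)
  have h3 : TF (ball 0 r) (_root_.trunc χ θ ε u) := h1.sub' (h1.smul isOpen_ball h2.contDiffOn)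
  refine ⟨h3.smooth, h3.cpt, fun x hx => ⟨?_, mem_ball_zero_iff.1 (h3.sub hx)⟩⟩
  rintro rfl
  refine notMem_tsupport_iff_eventuallyEq.2 ?_ hx
  filter_upwards [ball_mem_nhds (0 : E3) (show 0 < ε / 4 by positivity)] with x hx
  rw [_root_.trunc, hθ1 (ε⁻¹ • x) (by
    rw [mem_ball_zero_iff] at hx ⊢
    rw [norm_smul, norm_inv, Real.norm_of_nonneg hε.le, ← div_eq_inv_mul, div_lt_iff₀ hε]
    linarith)]
  simp

lemma abs_dw_trunc_le (hχ1 : ∀ x ∈ ball (0 : E3) (r / 4), χ x = 1) (hθ : TF (ball 0 1) θ) {D : ℝ}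
    (hD0 : 0 ≤ D) (hD : ∀ v : List (Fin 3), v.length ≤ 4 → ∀ x, |dw v θ x| ≤ D)
    (hε : 0 < ε) (hε1 : ε ≤ 1) (hu : Sm (ball 0 r) u) {x : E3} (hx : ‖x‖ < r / 4) {m : ℝ}
    (hm : ∀ v : List (Fin 3), v.length ≤ 4 → |dw v u x| ≤ m) {w : List (Fin 3)}
    (hw : w.length ≤ 4) : |dw w (trunc χ θ ε u) x| ≤ (1 + 16 * D) * (ε⁻¹ ^ 4 * m) := by
  have hm0 : 0 ≤ m := (abs_nonneg _).trans (hm [] (by simp))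
  have hxb : x ∈ ball (0 : E3) (r / 4) := mem_ball_zero_iff.2 hx
  have hr : 0 < r / 4 := (norm_nonneg x).trans_lt hx
  have hu' : Sm (ball 0 (r / 4)) u := hu.mono (ball_subset_ball (by linarith))
  have h2 : ContDiff ℝ (⊤ : ℕ∞) fun x => θ (ε⁻¹ • x) := hθ.smooth.comp (contDiff_const_smul _)
  have hθs : Sm (ball 0 (r / 4)) fun x => θ (ε⁻¹ • x) := h2.contDiffOn
  have hε4 : 1 ≤ ε⁻¹ := (one_le_inv₀ hε).2 hε1
  rw [dw_congr isOpen_ball (fun y hy => trunc_of_norm_lt hχ1 (mem_ball_zero_iff.1 hy)) w hxb,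
    dw_sub isOpen_ball hu' (hθs.mul hu') hxb, dw_mul isOpen_ball hθs hu' hxb]
  have h3 : |((splits w).map fun p => dw p.1 (fun x => θ (ε⁻¹ • x)) x * dw p.2 u x).sum| ≤
      16 * D * (ε⁻¹ ^ 4 * m) := by
    refine (list_sum_abs_le _ _).trans ?_
    have h4 : ((splits w).map fun p => |dw p.1 (fun x => θ (ε⁻¹ • x)) x * dw p.2 u x|).sum ≤
        ((splits w).map fun _ => D * (ε⁻¹ ^ 4 * m)).sum := List.sum_le_sum fun p hp => by
      have hl := length_of_mem_splits hp
      have h5 := hm p.2 (by omega)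
      have h6 := hD p.1 (by omega) (ε⁻¹ • x)
      rw [abs_mul, dw_comp_smul hθ, abs_mul, abs_of_pos (by positivity)]
      calc ε⁻¹ ^ p.1.length * |dw p.1 θ (ε⁻¹ • x)| * |dw p.2 u x|
          ≤ ε⁻¹ ^ 4 * D * m := by
            gcongr
            omega
        _ = _ := by ring
    refine h4.trans ?_
    rw [List.map_const', List.sum_replicate, nsmul_eq_mul, length_splits]
    have : ((2 ^ w.length : ℕ) : ℝ) ≤ 16 := by
      have := Nat.pow_le_pow_right (show 0 < 2 by norm_num) hw
      exact_mod_cast this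
    calc _ ≤ 16 * (D * (ε⁻¹ ^ 4 * m)) := by gcongr
      _ = _ := by ring
  have h4 : |dw w u x| ≤ ε⁻¹ ^ 4 * m :=
    (hm w hw).trans (le_mul_of_one_le_left hm0 (one_le_pow₀ hε4))
  calc _ ≤ |dw w u x| + |((splits w).map fun p => dw p.1 (fun x => θ (ε⁻¹ • x)) x *
      dw p.2 u x).sum| :=
        abs_sub _ _
    _ ≤ _ := by linarith

end

section

variable {ι : Type*} [Fintype ι] {O : Set E3} {U : ι → E3 → ℝ} {u χ θ : E3 → ℝ} {r s α ε τ K : ℝ}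
  {b1 b2 : Fin 3 → Fin 3 → E3 → ℝ} {T : ι → ι → (E3 → ℝ) → E3 → ℝ}

lemma GevB.mono {O' : Set E3} {f : E3 → ℝ} (h : GevB s O f) (hO : O' ⊆ O) : GevB s O' f := by
  obtain ⟨c, A, h⟩ := h
  exact ⟨c, A, h.sm.mono hO, h.c_nonneg, h.A_nonneg, fun w x hx => h.bound w x (hO hx)⟩

lemma exists_system_sq_le (hT : ∀ i j, IsDO s O 3 (T i j)) : ∃ K ≥ 0, ∀ U : ι → E3 → ℝ,
    (∀ i, Sm O (U i)) → ∀ x ∈ O, ∑ i, (∑ j, T i j (U j) x) ^ 2 ≤ K * ∑ j, dsq (U j) x := by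
  choose K hK0 hK using fun i j => (hT i j).abs_le
  refine ⟨∑ i, Fintype.card ι * ∑ j, K i j ^ 2,
    sum_nonneg fun i _ => mul_nonneg (by positivity) (sum_nonneg fun j _ => sq_nonneg _),
    fun U hU x hx => ?_⟩
  rw [sum_mul]
  refine sum_le_sum fun i _ => ?_
  refine sq_sum_le_card_mul_sum_sq.trans ?_
  rw [card_univ, mul_assoc, sum_mul]
  gcongr with j
  have h1 := hK i j (U j) (hU j) x hx _ fun w hw => abs_dw_le_sqrt_dsq (U j) x hw
  have h2 : T i j (U j) x ^ 2 ≤ K i j ^ 2 * dsq (U j) x := by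
    rw [← sq_abs, ← Real.sq_sqrt (dsq_nonneg (U j) x), ← mul_pow]
    exact pow_le_pow_left₀ (abs_nonneg _) h1 2
  refine h2.trans ?_
  gcongr
  exact single_le_sum (f := fun j => dsq (U j) x) (fun k _ => dsq_nonneg _ _) (mem_univ j)

lemma exists_inner_bound (hs : 1 ≤ s) (hr : 0 < r) (hb1 : ∀ j k, GevB s (ball 0 r) (b1 j k))
    (hb2 : ∀ j k, GevB s (ball 0 r) (b2 j k)) (hα : 0 < α)
    (hχ : Cut (ball 0 r) χ) (hχ1 : ∀ x ∈ ball (0 : E3) (r / 4), χ x = 1) (hθ : Cut (ball 0 1) θ)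
    (hθ1 : ∀ x ∈ ball (0 : E3) (1 / 4), θ x = 1)
    (hu : Sm (ball 0 r) u) (hflat : ∀ w, ExpFlat α (dw w u)) (τ : ℝ) :
    ∃ Q ≥ 0, ∃ δ > 0, ∀ ε, 0 < ε → ε < δ → ∀ x, x ≠ 0 → ‖x‖ ≤ ε →
      ew α τ x ^ 2 * op2 b2 (op2 b1 (trunc χ θ ε u)) x ^ 2 ≤ Q := by
  obtain ⟨K, hK0, hK⟩ := (IsDO.op2 isOpen_ball hs hb2
    (IsDO.op2 isOpen_ball hs hb1 IsDO.id)).abs_le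
  obtain ⟨D, hD0, hD⟩ := hθ.tf.exists_dw_bound 4
  choose C hC0 δ hδ0 hCδ using fun w => (hflat w).ew_mul_abs_le hα τ
  have hfin : {w : List (Fin 3) | w.length ≤ 4}.Finite := List.finite_length_le (Fin 3) 4
  have hev : ∀ᶠ d in nhdsWithin (0 : ℝ) (Set.Ioi 0), ∀ w ∈ {w : List (Fin 3) | w.length ≤ 4},
      d < δ w := by
    rw [Filter.eventually_all_finite hfin]
    exact fun w _ => Filter.Eventually.filter_mono nhdsWithin_le_nhds (gt_mem_nhds (hδ0 w))
  obtain ⟨d, hd, hd0⟩ := (hev.and self_mem_nhdsWithin).exists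
  set M := ∑ w ∈ hfin.toFinset, C w with hM
  have hM0 : 0 ≤ M := sum_nonneg fun w _ => hC0 w
  refine ⟨(K * ((1 + 16 * D) * M)) ^ 2, sq_nonneg _, min d (min 1 (r / 4)),
    lt_min hd0 (lt_min one_pos (by positivity)), fun ε hε hεd x hx0 hxε => ?_⟩
  obtain ⟨hεd1, hεd2⟩ := lt_min_iff.1 hεd
  obtain ⟨hε1, hεr⟩ := lt_min_iff.1 hεd2
  have hxn := norm_pos_iff.2 hx0
  have hew := ew_pos α τ x
  have hm : ∀ v : List (Fin 3), v.length ≤ 4 → |dw v u x| ≤ M * ‖x‖ ^ 4 / ew α τ x := by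
    intro v hv
    rw [le_div_iff₀' hew]
    refine (hCδ v x hx0 (hxε.trans_lt (hεd1.trans (hd v hv)))).trans ?_
    gcongr
    exact single_le_sum (fun k _ => hC0 k) (hfin.mem_toFinset.2 hv)
  have h1 := hK _ ((TF.trunc hχ hθ hθ1 hε hu).sm (ball 0 r)) x
    (mem_ball_zero_iff.2 (by linarith)) _ fun w hw =>
      abs_dw_trunc_le hχ1 hθ.tf hD0 hD hε hε1.le hu (by linarith) hm hw
  beta_reduce at h1
  rw [← mul_pow, ← sq_abs]
  refine pow_le_pow_left₀ (abs_nonneg _) ?_ 2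
  rw [abs_mul, abs_of_pos hew]
  calc _ ≤ ew α τ x * (K * ((1 + 16 * D) * (ε⁻¹ ^ 4 * (M * ‖x‖ ^ 4 / ew α τ x)))) := by gcongr
    _ = K * ((1 + 16 * D) * M) * (ε⁻¹ * ‖x‖) ^ 4 := by field_simp
    _ ≤ K * ((1 + 16 * D) * M) * 1 := by
        gcongr
        refine pow_le_one₀ (by positivity) ?_
        rw [inv_mul_le_iff₀ hε]
        linarith
    _ = _ := mul_one _

end

section

variable {ι : Type*} [Fintype ι] {O : Set E3} {U : ι → E3 → ℝ} {u χ θ : E3 → ℝ} {r s α ε τ K : ℝ}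
  {b1 b2 : Fin 3 → Fin 3 → E3 → ℝ} {T : ι → ι → (E3 → ℝ) → E3 → ℝ}

lemma ew_le_of_le_norm (hα : 0 ≤ α) (hτ : 0 ≤ τ) {ρ : ℝ} (hρ : 0 < ρ) {x : E3} (hx : ρ ≤ ‖x‖) :
    ew α τ x ≤ Real.exp (τ * ρ ^ (-α)) := by
  exact Real.exp_le_exp.2 (mul_le_mul_of_nonneg_left
    (Real.rpow_le_rpow_of_nonpos hρ hx (neg_nonpos.2 hα)) hτ)

lemma le_ew_of_norm_le (hα : 0 ≤ α) (hτ : 0 ≤ τ) {ρ : ℝ} {x : E3} (hx0 : x ≠ 0) (hx : ‖x‖ ≤ ρ) :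
    Real.exp (τ * ρ ^ (-α)) ≤ ew α τ x := by
  exact Real.exp_le_exp.2 (mul_le_mul_of_nonneg_left
    (Real.rpow_le_rpow_of_nonpos (norm_pos_iff.2 hx0) hx (neg_nonpos.2 hα)) hτ)

lemma isOpen_lt_norm (ε : ℝ) : IsOpen {x : E3 | ε < ‖x‖} :=
    isOpen_lt continuous_const continuous_norm

lemma wint_trunc_le (hs : 1 ≤ s) (hr : 0 < r) (hb1 : ∀ j k, GevB s (ball 0 r) (b1 j k))
    (hb2 : ∀ j k, GevB s (ball 0 r) (b2 j k)) (hα : 0 < α)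
    (hχ : Cut (ball 0 r) χ) (hχ1 : ∀ x ∈ ball (0 : E3) (r / 4), χ x = 1) (hθ : Cut (ball 0 1) θ)
    (hθ1 : ∀ x ∈ ball (0 : E3) (1 / 4), θ x = 1)
    (hU : ∀ i, Sm (ball 0 r) (U i)) (hflat : ∀ i w, ExpFlat α (dw w (U i))) (hK0 : 0 ≤ K)
    (hK : ∀ x ∈ ball (0 : E3) r,
      ∑ i, op2 b2 (op2 b1 (U i)) x ^ 2 ≤ K * ∑ j, dsq (U j) x) :
    ∃ B ≥ 0, ∀ τ ≥ 0, ∃ Q ≥ 0, ∃ δ > 0, ∀ ε, 0 < ε → ε < δ →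
      ∑ i, wint α τ (fun x => op2 b2 (op2 b1 (trunc χ θ ε (U i))) x ^ 2) ≤
        K * ∑ j, wint α τ (dsq (trunc χ θ ε (U j))) + Real.exp (τ * (r / 4) ^ (-α)) ^ 2 * B +
          Q * ε ^ 3 := by
  have hbs1 : ∀ O' ⊆ ball (0 : E3) r, ∀ j k, Sm O' (b1 j k) := fun O' h j k => (hb1 j k).sm.mono h
  have hbs2 : ∀ O' ⊆ ball (0 : E3) r, ∀ j k, Sm O' (b2 j k) := fun O' h j k => (hb2 j k).sm.mono h
  have h1 : ∀ i, ∃ B ≥ 0, ∀ x, |op2 b2 (op2 b1 fun x => χ x * U i x) x| ≤ B := fun i => by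
    have h2 : TF (ball 0 r) fun x => χ x * U i x := by
      simpa only [mul_comm] using hχ.tf.smul isOpen_ball (hU i)
    obtain ⟨D, hD0, hD⟩ := ((h2.op2 isOpen_ball (hbs1 _ subset_rfl)).op2 isOpen_ball
      (hbs2 _ subset_rfl)).exists_dw_bound 0
    exact ⟨D, hD0, hD [] le_rfl⟩
  choose B hB0 hB using h1
  have hBB : 0 ≤ ∑ i, B i ^ 2 := sum_nonneg fun i _ => sq_nonneg _
  refine ⟨(∑ i, B i ^ 2) * volume.real (ball (0 : E3) r), by positivity, fun τ hτ => ?_⟩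
  choose Q hQ0 δ hδ0 hQ using fun i =>
    exists_inner_bound hs hr hb1 hb2 hα hχ hχ1 hθ hθ1 (hU i) (hflat i) τ
  have hQQ : 0 ≤ ∑ i, Q i := sum_nonneg fun i _ => hQ0 i
  have hev : ∀ᶠ d in nhdsWithin (0 : ℝ) (Set.Ioi 0), ∀ i, d < δ i := Filter.eventually_all.2
    fun i => Filter.Eventually.filter_mono nhdsWithin_le_nhds (gt_mem_nhds (hδ0 i))
  obtain ⟨d, hd, hd0⟩ := (hev.and self_mem_nhdsWithin).exists
  refine ⟨(∑ i, Q i) * volume.real (ball (0 : E3) 1), by positivity, min d (r / 4),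
    lt_min hd0 (by positivity), fun ε hε hεd => ?_⟩
  obtain ⟨hεd1, hεr⟩ := lt_min_iff.1 hεd
  set g := fun i => trunc χ θ ε (U i) with hg
  have hgT : ∀ i, TF (pb r) (g i) := fun i => TF.trunc hχ hθ hθ1 hε (hU i)
  have hLT : ∀ i, TF (pb r) (op2 b2 (op2 b1 (g i))) := fun i =>
    ((hgT i).op2 (isOpen_pb r) (hbs1 _ (pb_subset_ball r))).op2 (isOpen_pb r)
      (hbs2 _ (pb_subset_ball r))
  set E := Real.exp (τ * (r / 4) ^ (-α)) with hE
  set P := E ^ 2 * ∑ i, B i ^ 2 with hP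
  have hP0 : 0 ≤ P := by positivity
  have key : ∀ x, ew α τ x ^ 2 * ∑ i, op2 b2 (op2 b1 (g i)) x ^ 2 ≤
      K * (ew α τ x ^ 2 * ∑ j, dsq (g j) x) + (ball (0 : E3) r).indicator (fun _ => P) x +
        (closedBall (0 : E3) ε).indicator (fun _ => ∑ i, Q i) x := by
    intro x
    have n1 : 0 ≤ K * (ew α τ x ^ 2 * ∑ j, dsq (g j) x) :=
      mul_nonneg hK0 (mul_nonneg (sq_nonneg _) (sum_nonneg fun j _ => dsq_nonneg _ _))
    have n2 : 0 ≤ (ball (0 : E3) r).indicator (fun _ => P) x :=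
      Set.indicator_nonneg (fun _ _ => hP0) x
    have n3 : 0 ≤ (closedBall (0 : E3) ε).indicator (fun _ => ∑ i, Q i) x :=
      Set.indicator_nonneg (fun _ _ => hQQ) x
    by_cases hx : x ∈ pb r
    swap
    · have : ∀ i, op2 b2 (op2 b1 (g i)) x = 0 := fun i => (hLT i).zero_of_notMem hx
      simp only [this]
      simp only [ne_eq, OfNat.ofNat_ne_zero, not_false_eq_true, zero_pow, sum_const_zero, mul_zero]
      positivity
    rcases le_or_gt ‖x‖ ε with hxε | hxε
    · rw [Set.indicator_of_mem (mem_closedBall_zero_iff.2 hxε), mul_sum]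
      have := sum_le_sum fun i (_ : i ∈ univ) => hQ i ε hε (hεd1.trans (hd i)) x hx.1 hxε
      linarith
    rcases lt_or_ge ‖x‖ (r / 4) with hxr | hxr
    · have hA : IsOpen ({x : E3 | ε < ‖x‖} ∩ ball 0 (r / 4)) :=
        (isOpen_lt_norm ε).inter isOpen_ball
      have hxA : x ∈ {x : E3 | ε < ‖x‖} ∩ ball 0 (r / 4) := ⟨hxε, mem_ball_zero_iff.2 hxr⟩
      have hgU : ∀ i, ∀ y ∈ {x : E3 | ε < ‖x‖} ∩ ball 0 (r / 4), g i y = U i y := fun i y hy => by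
        rw [hg]; beta_reduce
        rw [trunc_of_lt hθ hε hy.1, hχ1 y hy.2, one_mul]
      have e1 : ∀ i, op2 b2 (op2 b1 (g i)) x = op2 b2 (op2 b1 (U i)) x := fun i =>
        op2_congr hA (op2_congr hA (hgU i)) x hxA
      have e2 : ∀ i, dsq (g i) x = dsq (U i) x := fun i => dsq_congr hA (hgU i) x hxA
      simp only [e1, e2] at n1 ⊢
      have := mul_le_mul_of_nonneg_left (hK x (pb_subset_ball r hx)) (sq_nonneg (ew α τ x))
      linarith
    · rw [Set.indicator_of_mem (pb_subset_ball r hx)]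
      have hA := isOpen_lt_norm ε
      have e1 : ∀ i, op2 b2 (op2 b1 (g i)) x = op2 b2 (op2 b1 fun x => χ x * U i x) x := fun i =>
        op2_congr hA (op2_congr hA fun y hy => trunc_of_lt hθ hε hy) x hxε
      have h3 : ew α τ x ^ 2 * ∑ i, op2 b2 (op2 b1 (g i)) x ^ 2 ≤ P := by
        rw [hP]
        have := ew_pos α τ x
        refine mul_le_mul (pow_le_pow_left₀ this.le
          (ew_le_of_le_norm hα.le hτ (by positivity) hxr) 2) (sum_le_sum fun i _ => ?_)
          (sum_nonneg fun i _ => sq_nonneg _) (sq_nonneg _)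
        rw [e1, ← sq_abs]
        exact pow_le_pow_left₀ (abs_nonneg _) (hB i x) 2
      linarith
  have i1 : ∀ (c : ℝ), Integrable ((ball (0 : E3) r).indicator fun _ => c) volume := fun c =>
    (integrable_indicator_iff measurableSet_ball).2
      (integrableOn_const measure_ball_lt_top.ne enorm_ne_top)
  have i2 : ∀ (c : ℝ), Integrable ((closedBall (0 : E3) ε).indicator fun _ => c) volume := fun c =>
    (integrable_indicator_iff measurableSet_closedBall).2
      (integrableOn_const measure_closedBall_lt_top.ne enorm_ne_top)
  have t1 : TF (pb r) fun x => ew α τ x ^ 2 * ∑ i, op2 b2 (op2 b1 (g i)) x ^ 2 :=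
    TF.ew_sq_mul (TF.sum fun i _ => (hLT i).sq) α τ
  have t2 : TF (pb r) fun x => ew α τ x ^ 2 * ∑ j, dsq (g j) x :=
    TF.ew_sq_mul (TF.sum fun i _ => (hgT i).dsq) α τ
  rw [← wint_sum fun i _ => (hLT i).sq, ← wint_sum fun i _ => (hgT i).dsq]
  have t3 := (t2.const_mul K).integrable
  have hfi := integral_mono t1.integrable ((t3.add (i1 P)).add (i2 (∑ i, Q i))) key
  rw [integral_add' (t3.add (i1 P)) (i2 _), integral_add' t3 (i1 _), integral_const_mul,
    integral_indicator_const _ measurableSet_ball,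
    integral_indicator_const _ measurableSet_closedBall, Measure.addHaar_real_closedBall _ _ hε.le,
    finrank_euclideanSpace_fin, smul_eq_mul, smul_eq_mul] at hfi
  refine hfi.trans (le_of_eq ?_)
  rw [wint]
  ring

end

section

variable {ι : Type*} [Fintype ι] {O : Set E3} {U : ι → E3 → ℝ} {u χ θ : E3 → ℝ} {r s α ε τ K : ℝ}
  {b1 b2 : Fin 3 → Fin 3 → E3 → ℝ} {T : ι → ι → (E3 → ℝ) → E3 → ℝ}

lemma le_wint {f : E3 → ℝ} {c ρ a : ℝ} {x₀ : E3} (hf : TF (pb r) f) (hf0 : ∀ x, 0 ≤ f x)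
    (hα : 0 ≤ α) (hτ : 0 ≤ τ) (hc : 0 ≤ c) (h : ∀ x ∈ ball x₀ ρ, x ≠ 0 ∧ ‖x‖ ≤ a ∧ c ≤ f x) :
    Real.exp (τ * a ^ (-α)) ^ 2 * (c * volume.real (ball x₀ ρ)) ≤ wint α τ f := by
  have h1 : ∀ x, (ball x₀ ρ).indicator (fun _ => Real.exp (τ * a ^ (-α)) ^ 2 * c) x ≤
      ew α τ x ^ 2 * f x := by
    intro x
    by_cases hx : x ∈ ball x₀ ρ
    · obtain ⟨h2, h3, h4⟩ := h x hx
      rw [Set.indicator_of_mem hx]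
      exact mul_le_mul (pow_le_pow_left₀ (Real.exp_pos _).le (le_ew_of_norm_le hα hτ h2 h3) 2) h4
        hc (sq_nonneg _)
    · rw [Set.indicator_of_notMem hx]
      exact mul_nonneg (sq_nonneg _) (hf0 x)
  have h2 := integral_mono ((integrable_indicator_iff measurableSet_ball).2
    (integrableOn_const measure_ball_lt_top.ne enorm_ne_top)) (hf.ew_sq_mul α τ).integrable h1
  rw [integral_indicator_const _ measurableSet_ball, smul_eq_mul] at h2
  rw [wint]
  linarith

/-- A solution of the system all of whose derivatives decay like `exp (-M ‖x‖ ^ (-α))` for every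
`M` vanishes near the origin. -/
theorem eq_zero_of_expFlat (h1 : Adm O b1 α) (h2 : Adm O b2 α) (hα : 0 < α) (hs : 1 ≤ s)
    (hb1 : ∀ j k, GevB s O (b1 j k)) (hb2 : ∀ j k, GevB s O (b2 j k))
    (hT : ∀ i j, IsDO s O 3 (T i j)) (hU : ∀ i, Sm O (U i))
    (hsys : ∀ i, ∀ x ∈ O, op2 b2 (op2 b1 (U i)) x = ∑ j, T i j (U j) x)
    (hflat : ∀ i w, ExpFlat α (dw w (U i))) (h00 : ∀ i, U i 0 = 0) :
    ∃ ε > 0, ∀ x : E3, ‖x‖ < ε → ∀ i, U i x = 0 := by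
  obtain ⟨R, hR0, hR1, hRO, C, hC0, τ0, hτ0, hcarl⟩ := carleman_product h1 h2 hα
  obtain ⟨K, hK0, hK⟩ := exists_system_sq_le hT
  have hCK : 0 ≤ C * K := by positivity
  obtain ⟨r, hr0, hrR, hrK⟩ : ∃ r > 0, r ≤ R ∧ C * r ^ 2 * K ≤ 1 / 2 := by
    refine ⟨min R (1 / (2 * (C * K + 1))), lt_min hR0 (by positivity), min_le_left _ _, ?_⟩
    set r := min R (1 / (2 * (C * K + 1))) with hr
    have hr0 : 0 < r := lt_min hR0 (by positivity)
    have hr1 : r ≤ 1 := (min_le_left _ _).trans hR1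
    have hr2 : r * (2 * (C * K + 1)) ≤ 1 := (le_div_iff₀ (by positivity)).1 (min_le_right _ _)
    nlinarith [mul_le_mul_of_nonneg_left hr1 hr0.le]
  have hrO : ball 0 r ⊆ O := (ball_subset_closedBall.trans
      (closedBall_subset_closedBall hrR)).trans hRO
  obtain ⟨χ, hχ, hχ1⟩ := exists_cut hr0
  obtain ⟨θ, hθ, hθ1⟩ := exists_cut one_pos
  have hUr : ∀ i, Sm (ball 0 r) (U i) := fun i => (hU i).mono hrO
  obtain ⟨B, hB0, hB⟩ := wint_trunc_le hs hr0 (fun j k => (hb1 j k).mono hrO)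
    (fun j k => (hb2 j k).mono hrO) hα hχ hχ1 hθ hθ1 hUr hflat hK0 fun x hx => by
      rw [sum_congr rfl fun i _ => by rw [hsys i x (hrO hx)]]
      exact hK U hU x (hrO hx)
  refine ⟨r / 8, by positivity, fun x₀ hx₀ i => ?_⟩
  by_contra hne
  have hx00 : x₀ ≠ 0 := fun h => hne (by rw [h, h00 i])
  have hxn := norm_pos_iff.2 hx00
  have hx₀r : x₀ ∈ ball (0 : E3) r := mem_ball_zero_iff.2 (by linarith)
  have hcont : ContinuousAt (U i) x₀ :=
      (hUr i).continuousOn.continuousAt (isOpen_ball.mem_nhds hx₀r)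
  have hev : ∀ᶠ x in nhds x₀, |U i x₀| / 2 < |U i x| ∧ ‖x₀‖ / 2 < ‖x‖ ∧ ‖x‖ < r / 8 :=
    (hcont.abs.eventually (lt_mem_nhds (half_lt_self (abs_pos.2 hne)))).and
      ((continuous_norm.continuousAt.eventually (lt_mem_nhds (half_lt_self hxn))).and
        (continuous_norm.continuousAt.eventually (gt_mem_nhds hx₀)))
  obtain ⟨ρ, hρ0, hρ⟩ := Metric.eventually_nhds_iff_ball.1 hev
  set c := (|U i x₀| / 2) ^ 2 with hc
  have hc0 : 0 < c := by positivity
  set V := volume.real (ball x₀ ρ) with hV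
  have hV0 : 0 < V := ENNReal.toReal_pos (measure_ball_pos volume x₀ hρ0).ne' measure_ball_lt_top.ne
  have key : ∀ τ ≥ τ0, Real.exp (τ * (r / 8) ^ (-α)) ^ 2 * (c * V) ≤
      Real.exp (τ * (r / 4) ^ (-α)) ^ 2 * (2 * (C * r ^ 2) * B) := by
    intro τ hτ
    have hτ' : 0 ≤ τ := by linarith
    obtain ⟨Q, hQ0, δ, hδ0, hQ⟩ := hB τ hτ'
    have hlim : Filter.Tendsto (fun ε : ℝ => 2 * (C * r ^ 2) *
        (Real.exp (τ * (r / 4) ^ (-α)) ^ 2 * B + Q * ε ^ 3)) (nhdsWithin 0 (Set.Ioi 0))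
        (nhds (2 * (C * r ^ 2) * (Real.exp (τ * (r / 4) ^ (-α)) ^ 2 * B + Q * 0 ^ 3))) :=
      (Continuous.tendsto (by fun_prop) 0).mono_left nhdsWithin_le_nhds
    have hle : Real.exp (τ * (r / 8) ^ (-α)) ^ 2 * (c * V) ≤
        2 * (C * r ^ 2) * (Real.exp (τ * (r / 4) ^ (-α)) ^ 2 * B + Q * 0 ^ 3) := by
      refine ge_of_tendsto hlim ?_
      filter_upwards [self_mem_nhdsWithin, Filter.Eventually.filter_mono nhdsWithin_le_nhds
        (gt_mem_nhds hδ0), Filter.Eventually.filter_mono nhdsWithin_le_nhds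
        (gt_mem_nhds (half_pos hxn))] with ε hε hεδ hεx
      have hε : 0 < ε := hε
      have hgT : ∀ j, TF (pb r) (trunc χ θ ε (U j)) := fun j => TF.trunc hχ hθ hθ1 hε (hUr j)
      have e1 := hQ ε hε hεδ
      have e2 := sum_le_sum fun j (_ : j ∈ univ) => hcarl τ hτ r hr0 hrR _ (hgT j)
      rw [← mul_sum] at e2
      have e3 : Real.exp (τ * (r / 8) ^ (-α)) ^ 2 * (c * V) ≤
          ∑ j, wint α τ (dsq (trunc χ θ ε (U j))) := by
        refine (le_wint (hgT i).dsq (fun x => dsq_nonneg _ _) hα.le hτ' hc0.le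
          fun x hx => ?_).trans (single_le_sum (f := fun j => wint α τ (dsq (trunc χ θ ε (U j))))
            (fun j _ => wint_nonneg fun x => dsq_nonneg _ _) (mem_univ i))
        obtain ⟨p1, p2, p3⟩ := hρ x hx
        refine ⟨norm_pos_iff.1 (by linarith), p3.le, ?_⟩
        have p4 : trunc χ θ ε (U i) x = U i x := by
          rw [trunc_of_lt hθ hε (by linarith), hχ1 x (mem_ball_zero_iff.2 (by linarith)), one_mul]
        have p5 : c ≤ trunc χ θ ε (U i) x ^ 2 := by
          rw [p4, hc, ← sq_abs (U i x)]
          exact pow_le_pow_left₀ (by positivity) p1.le 2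
        have p6 := tsq_nonneg (trunc χ θ ε (U i)) x
        have p7 := hsq_nonneg (trunc χ θ ε (U i)) x
        have p8 := gsq_nonneg (trunc χ θ ε (U i)) x
        rw [dsq]
        linarith
      have hCr : 0 ≤ C * r ^ 2 := by positivity
      have e4 := mul_le_mul_of_nonneg_left e1 hCr
      have e5 : 0 ≤ ∑ j, wint α τ (dsq (trunc χ θ ε (U j))) :=
        sum_nonneg fun j _ => wint_nonneg fun x => dsq_nonneg _ _
      have e6 := mul_le_mul_of_nonneg_right hrK e5
      linarith
    linarith
  have hab : (r / 4) ^ (-α) < (r / 8) ^ (-α) :=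
    Real.rpow_lt_rpow_of_neg (by positivity) (by linarith) (neg_neg_of_pos hα)
  set d := (r / 8) ^ (-α) - (r / 4) ^ (-α) with hd
  have hd0 : 0 < d := sub_pos.2 hab
  have hbd : ∀ τ ≥ τ0, τ * d * (c * V) ≤ 2 * (C * r ^ 2) * B := by
    intro τ hτ
    have k := key τ hτ
    have hτd : 0 ≤ τ * d := mul_nonneg (by linarith) hd0.le
    have e : Real.exp (τ * (r / 8) ^ (-α)) = Real.exp (τ * (r / 4) ^ (-α)) * Real.exp (τ * d) := by
      rw [← Real.exp_add, hd]; congr 1; ring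
    rw [e, mul_pow, mul_assoc] at k
    have k2 := le_of_mul_le_mul_left k (by positivity)
    have k3 : τ * d ≤ Real.exp (τ * d) ^ 2 := by nlinarith [Real.add_one_le_exp (τ * d)]
    exact (mul_le_mul_of_nonneg_right k3 (by positivity)).trans k2
  have hdcV : 0 < d * (c * V) := by positivity
  have h3 := hbd (max τ0 ((2 * (C * r ^ 2) * B + 1) / (d * (c * V)))) (le_max_left _ _)
  have h4 := mul_le_mul_of_nonneg_right
      (le_max_right τ0 ((2 * (C * r ^ 2) * B + 1) / (d * (c * V))))
    hdcV.le
  rw [div_mul_cancel₀ _ hdcV.ne'] at h4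
  linarith

end

section

variable {Ω : Set E3} {f g : E3 → ℝ} {s α : ℝ}

/-- The sorted word corresponding to a multiindex. -/
def wordOf (β : Fin 3 → ℕ) : List (Fin 3) :=
  List.replicate (β 2) 2 ++ (List.replicate (β 1) 1 ++ List.replicate (β 0) 0)

lemma dw_replicate (n : ℕ) (i : Fin 3) (f : E3 → ℝ) : dw (List.replicate n i) f = (pd i)^[n] f := by
  induction n generalizing f with
  | zero => rfl
  | succ n ih => rw [List.replicate_succ, dw_cons, ih, Function.iterate_succ_apply]

lemma mpd_eq_dw (β : Fin 3 → ℕ) (f : E3 → ℝ) : mpd β f = dw (wordOf β) f := by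
  rw [wordOf, dw_append, dw_append, dw_replicate, dw_replicate, dw_replicate, mpd]

lemma length_wordOf (β : Fin 3 → ℕ) : (wordOf β).length = mdeg β := by
  simp [wordOf, mdeg]; ring

lemma perm_wordOf (w : List (Fin 3)) : w.Perm (wordOf fun i => w.count i) := by
  rw [List.perm_iff_count]
  intro i
  fin_cases i <;> simp [wordOf, List.count_replicate]

lemma GevreyOn.gevB (hΩ : IsOpen Ω) (h : GevreyOn s Ω f) : GevB s Ω f := by
  obtain ⟨hf, c, hc, A, hA, hb⟩ := h
  refine ⟨c, A, hf, hc.le, hA.le, fun w x hx => ?_⟩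
  have hp := perm_wordOf w
  rw [dw_perm hΩ hp hf hx, ← mpd_eq_dw, hp.length_eq, length_wordOf]
  exact hb _ x hx

lemma isDO_mul_mpd {a : E3 → ℝ} (ha : GevB s Ω a) {β : Fin 3 → ℕ} {n : ℕ} (hβ : mdeg β ≤ n) :
    IsDO s Ω n fun f x => a x * mpd β f x :=
  ⟨[(a, wordOf β)], by simpa [length_wordOf] using ⟨ha, hβ⟩, fun f _ x _ => by simp [mpd_eq_dw]⟩

lemma GevB.dw (hΩ : IsOpen Ω) (hs : 1 ≤ s) (hf : GevB s Ω f) (w : List (Fin 3)) :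
    GevB s Ω (dw w f) := by
  induction w generalizing f with
  | nil => exact hf
  | cons i w ih => exact ih (hf.pd hΩ hs i)

lemma measurableSet_shell (R : ℝ) : MeasurableSet {y : E3 | R ≤ ‖y‖ ∧ ‖y‖ ≤ 2 * R} :=
  (measurableSet_le measurable_const measurable_norm).inter
    (measurableSet_le measurable_norm measurable_const)

lemma integrableOn_shell {r R : ℝ} (hf : Sm (ball 0 r) f) (hR : 2 * R < r) :
    IntegrableOn f {y : E3 | R ≤ ‖y‖ ∧ ‖y‖ ≤ 2 * R} := by
  have h1 : ContinuousOn f (closedBall 0 (2 * R)) :=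
    hf.continuousOn.mono (closedBall_subset_ball hR)
  exact (h1.integrableOn_compact (isCompact_closedBall _ _)).mono_set fun y hy =>
    mem_closedBall_zero_iff.2 hy.2

lemma flat_of_integral_sum {ι : Type*} [Fintype ι] {U : ι → E3 → ℝ} {r : ℝ} (hr : 0 < r)
    (hU : ∀ i, Sm (ball 0 r) (U i))
    (h : ∀ N : ℝ, 0 < N → ∃ C > 0, ∃ δ > 0, ∀ R : ℝ, 0 < R → R < δ →
      (∫ x in {y : E3 | R ≤ ‖y‖ ∧ ‖y‖ ≤ 2 * R}, ∑ i, U i x ^ 2) ≤ C * R ^ N) (i : ι) :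
    Flat (U i) := by
  refine flat_of_integral hr (hU i) fun N hN => ?_
  obtain ⟨C, hC, δ, hδ, h⟩ := h N hN
  refine ⟨C, hC, min δ (r / 2), lt_min hδ (by positivity), fun R hR hRδ => ?_⟩
  obtain ⟨h1, h2⟩ := lt_min_iff.1 hRδ
  refine le_trans ?_ (h R hR h1)
  refine setIntegral_mono_on (integrableOn_shell ((hU i).pow 2) (by linarith))
    (integrableOn_shell (Sm.sum fun j _ => (hU j).pow 2) (by linarith)) (measurableSet_shell R)
    fun x _ => ?_
  exact single_le_sum (f := fun j => U j x ^ 2) (fun j _ => sq_nonneg _) (mem_univ i)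

lemma UnifElliptic.at_zero {b : Fin 3 → Fin 3 → E3 → ℝ} (h : UnifElliptic b Ω) (h0 : (0 : E3) ∈ Ω) :
    ∃ c0 > 0, ∀ ξ : Fin 3 → ℝ, c0 * ∑ i, ξ i ^ 2 ≤ ∑ j, ∑ k, b j k 0 * ξ j * ξ k := by
  obtain ⟨c, hc, h⟩ := h
  exact ⟨c, hc, h 0 h0⟩

/-- Strong unique continuation for general fourth-order systems with principal part a product of
two elliptic operators. -/
theorem eq_zero_of_flat {ι : Type*} [Fintype ι] {b1 b2 : Fin 3 → Fin 3 → E3 → ℝ}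
    {T : ι → ι → (E3 → ℝ) → E3 → ℝ} {U : ι → E3 → ℝ} (h1 : Adm Ω b1 α) (h2 : Adm Ω b2 α)
    (hα : 0 < α) (hs : 1 ≤ s) (hsα : s < 1 + 1 / α)
    (hb1 : ∀ j k, GevB s Ω (b1 j k)) (hb2 : ∀ j k, GevB s Ω (b2 j k))
    (hT : ∀ O' ⊆ Ω, ∀ i j, IsDO s O' 3 (T i j)) (hU : ∀ i, Sm Ω (U i))
    (hsys : ∀ i, ∀ x ∈ Ω, op2 b2 (op2 b1 (U i)) x = ∑ j, T i j (U j) x)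
    (hflat : ∀ N : ℝ, 0 < N → ∃ C > 0, ∃ δ > 0, ∀ R : ℝ, 0 < R → R < δ →
      (∫ x in {y : E3 | R ≤ ‖y‖ ∧ ‖y‖ ≤ 2 * R}, ∑ i, U i x ^ 2) ≤ C * R ^ N) :
    ∃ ε > 0, ∀ x : E3, ‖x‖ < ε → ∀ i, U i x = 0 := by
  obtain ⟨c1, hc1, hell1⟩ := h1.ell
  obtain ⟨c2, hc2, hell2⟩ := h2.ell
  obtain ⟨r, hr, hrΩ, hG⟩ := gevrey_of_system h1.isOpen h1.zero_mem hs hb1 hb2 hc1 hc2 hell1 hell2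
    hT hU hsys
  have h0 : (0 : E3) ∈ ball (0 : E3) r := mem_ball_self hr
  have hF := flat_of_integral_sum hr (fun i => (hG i).sm) hflat
  have hadm : ∀ b, Adm Ω b α → Adm (ball 0 r) b α := fun b h =>
    ⟨isOpen_ball, h0, fun j k => (h.smooth j k).mono hrΩ, fun j k x hx => h.sym j k x (hrΩ hx),
      h.ell, h.eig⟩
  refine eq_zero_of_expFlat (hadm _ h1) (hadm _ h2) hα hs (fun j k => (hb1 j k).mono hrΩ)
    (fun j k => (hb2 j k).mono hrΩ) (hT _ hrΩ) (fun i => (hG i).sm)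
    (fun i x hx => hsys i x (hrΩ hx)) (fun i w => ?_)
    (fun i => (hF i).zero isOpen_ball h0 (hG i).sm)
  obtain ⟨c, A, h⟩ := (hG i).dw isOpen_ball hs w
  exact h.expFlat hr ((hF i).dw hr (hG i).sm w) hs hα hsα

end

/-- **SUCP for the fourth-order system** (Theorem 4.1).  With `P₁, P₂` the
residual-stress second-order operators, uniformly elliptic, with Gevrey `G^s`
coefficients, eigenvalue gap `α` at `0` and `s < 1 + 1/α`, any smooth
`U : Ω → ℝ⁷` solving `P₂P₁U = Σ_{|β|≤3} a_β ∂^β U` (with `a_β ∈ G^s`) that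
vanishes to infinite order at `0` vanishes identically near `0`. -/
theorem sucp_fourth_order_system
    (Ω : Set E3) (hΩopen : IsOpen Ω) (hΩconn : IsConnected Ω) (h0Ω : (0 : E3) ∈ Ω)
    (s α : ℝ) (hs : 1 ≤ s) (hα : 0 < α) (hsα : s < 1 + 1 / α)
    (t : Fin 3 → Fin 3 → E3 → ℝ) (lam mu : E3 → ℝ)
    (htsym : ∀ j k : Fin 3, ∀ x ∈ Ω, t j k x = t k j x)
    (hGt : ∀ j k : Fin 3, GevreyOn s Ω (t j k))
    (hGlam : GevreyOn s Ω lam) (hGmu : GevreyOn s Ω mu)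
    (hell1 : UnifElliptic (a1coef t mu) Ω) (hell2 : UnifElliptic (a2coef t lam mu) Ω)
    (heig1 : EigCond (a1coef t mu) α) (heig2 : EigCond (a2coef t lam mu) α)
    (aβ : (Fin 3 → ℕ) → E3 → Fin 7 → Fin 7 → ℝ)
    (hGaβ : ∀ β : Fin 3 → ℕ, mdeg β ≤ 3 → ∀ i j : Fin 7, GevreyOn s Ω (fun x => aβ β x i j))
    (U : E3 → Fin 7 → ℝ) (hU : ∀ i : Fin 7, ContDiffOn ℝ (⊤ : ℕ∞) (fun x => U x i) Ω)
    (hsol : ∀ x ∈ Ω, ∀ i : Fin 7,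
      op2 (a2coef t lam mu) (op2 (a1coef t mu) (fun y => U y i)) x = lowOrd aβ U x i)
    (hflat : ∀ N : ℝ, 0 < N → ∃ C > 0, ∃ δ > 0, ∀ R : ℝ, 0 < R → R < δ →
      (∫ x in {y : E3 | R ≤ ‖y‖ ∧ ‖y‖ ≤ 2 * R}, ∑ i, (U x i) ^ 2) ≤ C * R ^ N) :
    ∃ ε > 0, ∀ x : E3, ‖x‖ < ε → ∀ i : Fin 7, U x i = 0 := by
  classical
  have hδ : ∀ j k : Fin 3, GevB s Ω fun _ => if j = k then (1 : ℝ) else 0 := fun j k => .const _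
  have hb1 : ∀ j k, GevB s Ω (a1coef t mu j k) := fun j k =>
    ((hGmu.gevB hΩopen).mul hΩopen hs (hδ j k)).add hΩopen ((hGt j k).gevB hΩopen)
  have hb2 : ∀ j k, GevB s Ω (a2coef t lam mu j k) := fun j k =>
    (((hGlam.gevB hΩopen).add hΩopen ((GevB.const 2).mul hΩopen hs (hGmu.gevB hΩopen))).mul
      hΩopen hs (hδ j k)).add hΩopen ((hGt j k).gevB hΩopen)
  have h1 : Adm Ω (a1coef t mu) α :=
    ⟨hΩopen, h0Ω, fun j k => (hb1 j k).sm,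
      fun j k x hx => by simp only [a1coef, htsym j k x hx, eq_comm], hell1.at_zero h0Ω, heig1⟩
  have h2 : Adm Ω (a2coef t lam mu) α :=
    ⟨hΩopen, h0Ω, fun j k => (hb2 j k).sm,
      fun j k x hx => by simp only [a2coef, htsym j k x hx, eq_comm], hell2.at_zero h0Ω, heig2⟩
  let T : Fin 7 → Fin 7 → (E3 → ℝ) → E3 → ℝ := fun i j f x =>
    ∑ β ∈ Finset.univ.filter (fun β : Fin 3 → Fin 4 => mdeg (fun k => (β k : ℕ)) ≤ 3),
      aβ (fun k => (β k : ℕ)) x i j * mpd (fun k => (β k : ℕ)) f x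
  have hT : ∀ O' ⊆ Ω, ∀ i j, IsDO s O' 3 (T i j) := fun O' hO' i j => IsDO.sum fun β hβ =>
    isDO_mul_mpd (((hGaβ _ (Finset.mem_filter.1 hβ).2 i j).gevB hΩopen).mono hO')
      (Finset.mem_filter.1 hβ).2
  exact eq_zero_of_flat (U := fun i x => U x i) h1 h2 hα hs hsα hb1 hb2 hT hU
    (fun i x hx => by rw [hsol x hx i, lowOrd, Finset.sum_comm]) hflat
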